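/- arXiv:1702.03403 — 2 statements merged into one kernel-verified Lean document; each statement's English description precedes it below -/
import Mathlib

section
/- Let G be a finite abelian group with exp(G) ≥ √|G|. Then the Davenport constant satisfies D(G) ≤ exp(G) + |G|/exp(G) − 1. -/
/-- The Davenport constant of a finite abelian group `G`: the least `k` such that
every multiset of `k` elements of `G` has a nonempty zero-sum submultiset. -/
noncomputable def davenportConstant (G : Type*) [AddCommGroup G] [Fintype G] : ℕ :=
  sInf {k : ℕ | ∀ S : Multiset G, S.card = k →
    ∃ T : Multiset G, T ≤ S ∧ T ≠ 0 ∧ T.sum = 0}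

namespace Davenport

open Finset

section Degree

variable {ι R : Type*} [DecidableEq ι] [CommRing R]

/-- Functions on the subsets of `s` that are multilinear polynomials of degree at most `d`
in the indicator variables of the elements. -/
def degLE (R : Type*) [CommRing R] (s : Finset ι) (d : ℕ) : Submodule R (Finset ι → R) :=
  Submodule.span R {F | ∃ u : Finset ι, #u ≤ d ∧ ∀ t ⊆ s, F t = if u ⊆ t then 1 else 0}

lemma degLE_mono (s : Finset ι) {d d' : ℕ} (h : d ≤ d') : degLE R s d ≤ degLE R s d' :=
  Submodule.span_mono fun _ ⟨u, hu, hF⟩ => ⟨u, hu.trans h, hF⟩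

lemma indicator_mem_degLE (s u : Finset ι) :
    (fun t => if u ⊆ t then (1 : R) else 0) ∈ degLE R s #u :=
  Submodule.subset_span ⟨u, le_rfl, fun _ _ => rfl⟩

lemma degLE_congr {s : Finset ι} {d : ℕ} {F F' : Finset ι → R} (hF : F ∈ degLE R s d)
    (h : ∀ t ⊆ s, F' t = F t) : F' ∈ degLE R s d := by
  have h1 : (fun _ => 1 : Finset ι → R) ∈ degLE R s d :=
    Submodule.subset_span ⟨∅, by simp, fun _ _ => by simp⟩
  have h2 : (fun t => 1 + (F' t - F t) : Finset ι → R) ∈ degLE R s d :=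
    Submodule.subset_span ⟨∅, by simp, fun t ht => by simp [h t ht]⟩
  have := add_mem hF (sub_mem h2 h1)
  convert this using 1
  ext t
  simp

lemma const_mem_degLE (s : Finset ι) (d : ℕ) (c : R) : (fun _ => c) ∈ degLE R s d := by
  have h1 : (fun _ => 1 : Finset ι → R) ∈ degLE R s d :=
    Submodule.subset_span ⟨∅, by simp, fun _ _ => by simp⟩
  convert (degLE R s d).smul_mem c h1 using 1
  ext t
  simp

lemma mul_mem_degLE {s : Finset ι} {d d' : ℕ} {F F' : Finset ι → R} (hF : F ∈ degLE R s d)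
    (hF' : F' ∈ degLE R s d') : (fun t => F t * F' t) ∈ degLE R s (d + d') := by
  have h := Submodule.mul_mem_mul hF hF'
  rw [degLE, degLE, Submodule.span_mul_span] at h
  refine Submodule.span_mono ?_ h
  rintro _ ⟨A, ⟨u, hu, hA⟩, B, ⟨v, hv, hB⟩, rfl⟩
  refine ⟨u ∪ v, (card_union_le u v).trans (add_le_add hu hv), fun t ht => ?_⟩
  simp only [Pi.mul_apply, hA t ht, hB t ht, union_subset_iff]
  split_ifs <;> simp_all

lemma prod_mem_degLE {κ : Type*} (s : Finset ι) (J : Finset κ) (F : κ → Finset ι → R)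
    (d : ℕ) (hF : ∀ j ∈ J, F j ∈ degLE R s d) :
    (fun t => ∏ j ∈ J, F j t) ∈ degLE R s (#J * d) := by
  classical
  induction J using Finset.induction_on with
  | empty => simpa using const_mem_degLE s 0 (1 : R)
  | insert a J ha ih =>
    simp only [prod_insert ha, card_insert_of_notMem ha]
    rw [add_mul, one_mul, add_comm]
    exact mul_mem_degLE (hF a (mem_insert_self a J))
      (ih fun j hj => hF j (mem_insert_of_mem hj))

lemma sum_mem_degLE (s : Finset ι) (a : ι → R) :
    (fun t => ∑ i ∈ t, a i) ∈ degLE R s 1 := by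
  have h : (∑ i ∈ s, a i • fun t => if ({i} : Finset ι) ⊆ t then (1 : R) else 0) ∈
      degLE R s 1 :=
    sum_mem fun i _ => Submodule.smul_mem _ _ (indicator_mem_degLE s {i})
  refine degLE_congr h fun t ht => ?_
  simp only [Finset.sum_apply, Pi.smul_apply, singleton_subset_iff, smul_eq_mul, mul_ite, mul_one,
    mul_zero, ← sum_filter]
  rw [filter_mem_eq_inter, inter_eq_right.2 ht]

lemma card_mem_degLE (s : Finset ι) : (fun t => (#t : R)) ∈ degLE R s 1 := by
  simpa using sum_mem_degLE s (fun _ => (1 : R))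

lemma choose_mem_degLE (s : Finset ι) (i : ℕ) :
    (fun t => ((#t).choose i : R)) ∈ degLE R s i := by
  have h : (∑ u ∈ s.powersetCard i, fun t => if u ⊆ t then (1 : R) else 0) ∈ degLE R s i :=
    sum_mem fun u hu => by
      have := indicator_mem_degLE (R := R) s u
      rwa [(mem_powersetCard.1 hu).2] at this
  refine degLE_congr h fun t ht => ?_
  simp only [Finset.sum_apply, ← sum_filter, sum_const, nsmul_eq_mul, mul_one]
  rw [← card_powersetCard]
  congr 2
  ext u
  simp only [mem_powersetCard, mem_filter]
  exact ⟨fun h => ⟨⟨h.1.trans ht, h.2⟩, h.1⟩, fun h => ⟨h.2, h.1.2⟩⟩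

lemma choose_add_mem_degLE (s : Finset ι) (i h : ℕ) :
    (fun t => ((#t + h).choose i : R)) ∈ degLE R s i := by
  have key : (∑ ij ∈ antidiagonal i, (h.choose ij.2 : R) •
      fun t : Finset ι => ((#t).choose ij.1 : R)) ∈ degLE R s i :=
    sum_mem fun ij hij => Submodule.smul_mem _ _
      (degLE_mono s (by have := mem_antidiagonal.1 hij; omega) (choose_mem_degLE s ij.1))
  refine degLE_congr key fun t _ => ?_
  simp [Nat.add_choose_eq, mul_comm]

lemma prod_card_sub_mem_degLE (s : Finset ι) (A : Finset ℕ) :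
    (fun t => ∏ r ∈ A, ((#t : R) - r)) ∈ degLE R s #A := by
  have := prod_mem_degLE s A (fun r t => (#t : R) - r) 1
    fun r _ => sub_mem (card_mem_degLE s) (const_mem_degLE s 1 (r : R))
  rwa [mul_one] at this

/-- The alternating sum of a function of degree less than `#s` over the subsets of `s`
vanishes. -/
lemma alternating_sum_eq_zero {s : Finset ι} {d : ℕ} (hd : d < #s) {F : Finset ι → R}
    (hF : F ∈ degLE R s d) : ∑ t ∈ s.powerset, (-1) ^ #t * F t = 0 := by
  induction hF using Submodule.span_induction with
  | zero => simp
  | add A B _ _ hA hB => simp [mul_add, sum_add_distrib, hA, hB]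
  | smul c A _ hA =>
    simp only [Pi.smul_apply, smul_eq_mul, mul_left_comm _ c, ← mul_sum, hA, mul_zero]
  | mem F hF =>
    obtain ⟨u, hu, hF⟩ := hF
    obtain ⟨x, hxs, hxu⟩ := exists_mem_notMem_of_card_lt_card (hu.trans_lt hd)
    obtain ⟨s, hx, rfl⟩ : ∃ s' : Finset ι, x ∉ s' ∧ s = insert x s' :=
      ⟨s.erase x, notMem_erase x s, (insert_erase hxs).symm⟩
    rw [sum_powerset_insert hx, ← sum_add_distrib]
    refine sum_eq_zero fun t ht => ?_
    rw [mem_powerset] at ht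
    rw [hF t (ht.trans (subset_insert x s)), hF _ (insert_subset_insert x ht),
      card_insert_of_notMem (fun h => hx (ht h)), pow_succ]
    have : u ⊆ insert x t ↔ u ⊆ t := subset_insert_iff_of_notMem hxu
    simp only [this]
    ring

end Degree

section ZeroSum

variable {ι V : Type*} [DecidableEq ι] [AddCommGroup V] {p : ℕ} [Fact p.Prime]
  [Module (ZMod p) V] [Module.Finite (ZMod p) V]

/-- If a polynomial of small degree does not vanish at the empty set, then it does not vanish
at some nonempty zero-sum subsequence either. -/
lemma exists_zeroSum_of_degLE (f : ι → V) {s : Finset ι} {d : ℕ} {W : Finset ι → ZMod p}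
    (hW : W ∈ degLE (ZMod p) s d) (h0 : W ∅ ≠ 0)
    (hs : Module.finrank (ZMod p) V * (p - 1) + d < #s) :
    ∃ t ⊆ s, t.Nonempty ∧ ∑ i ∈ t, f i = 0 ∧ W t ≠ 0 := by
  by_contra! hcon
  let b := Module.finBasis (ZMod p) V
  let I : Finset ι → ZMod p := fun t =>
    ∏ j : Fin (Module.finrank (ZMod p) V) × (ZMod p)ˣ, (∑ i ∈ t, b.repr (f i) j.1 - j.2)
  have hI : I ∈ degLE (ZMod p) s (Module.finrank (ZMod p) V * (p - 1)) := by
    have := prod_mem_degLE s (univ : Finset (Fin (Module.finrank (ZMod p) V) × (ZMod p)ˣ))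
      (fun j t => ∑ i ∈ t, b.repr (f i) j.1 - (j.2 : ZMod p)) 1
      fun j _ => sub_mem (sum_mem_degLE s _) (const_mem_degLE s 1 _)
    rwa [card_univ, Fintype.card_prod, Fintype.card_fin, ZMod.card_units, mul_one] at this
  have hI0 : I ∅ ≠ 0 := by
    simp [I, prod_eq_zero_iff]
  have hI1 : ∀ t, ∑ i ∈ t, f i ≠ 0 → I t = 0 := by
    intro t ht
    have : b.repr (∑ i ∈ t, f i) ≠ 0 :=
      (map_ne_zero_iff _ b.repr.injective).2 ht
    obtain ⟨j, hj⟩ := Finsupp.ne_iff.1 this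
    refine prod_eq_zero (mem_univ (j, Units.mk0 _ hj)) ?_
    simp
  have key := alternating_sum_eq_zero hs (mul_mem_degLE hI hW)
  rw [sum_eq_single_of_mem ∅ (empty_mem_powerset s)] at key
  · simp [hI0, h0] at key
  · intro t ht hne
    by_cases h : ∑ i ∈ t, f i = 0
    · rw [hcon t (mem_powerset.1 ht) (nonempty_iff_ne_empty.2 hne) h]; simp
    · rw [hI1 t h]; simp

end ZeroSum

lemma prod_card_sub_empty_ne_zero {ι : Type*} {p : ℕ} [Fact p.Prime] {A : Finset ℕ}
    (hA : ∀ r ∈ A, 0 < r ∧ r < p) : ∏ r ∈ A, ((#(∅ : Finset ι) : ZMod p) - r) ≠ 0 := by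
  refine prod_ne_zero_iff.2 fun r hr h => ?_
  have : (r : ZMod p) = 0 := by simpa using h
  rw [ZMod.natCast_eq_zero_iff] at this
  exact absurd (Nat.le_of_dvd (hA r hr).1 this) (not_le.2 (hA r hr).2)

lemma card_mod_notMem {ι : Type*} {p : ℕ} {A : Finset ℕ} {t : Finset ι}
    (h : ∏ r ∈ A, ((#t : ZMod p) - r) ≠ 0) : #t % p ∉ A :=
  fun hr => h (prod_eq_zero hr (by simp))

lemma choose_prime_eq {p : ℕ} [Fact p.Prime] (n : ℕ) : (n.choose p : ZMod p) = (n / p : ℕ) := by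
  have h := Choose.choose_modEq_choose_mod_mul_choose_div_nat (n := n) (k := p) (p := p)
  rw [Nat.mod_self, Nat.div_self (Fact.out : p.Prime).pos] at h
  simpa using (ZMod.natCast_eq_natCast_iff _ _ _).2 h

section Short

variable {ι V : Type*} [AddCommGroup V]

/-- Some nonempty zero-sum subsequence has length at most `l`. -/
def HasZeroSum (f : ι → V) (s : Finset ι) (l : ℕ) : Prop :=
  ∃ t ⊆ s, t.Nonempty ∧ ∑ i ∈ t, f i = 0 ∧ #t ≤ l

lemma HasZeroSum.mono {f : ι → V} {s s' : Finset ι} {l l' : ℕ} (h : HasZeroSum f s l)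
    (hs : s ⊆ s') (hl : l ≤ l') : HasZeroSum f s' l' :=
  let ⟨t, ht, hne, h0, hc⟩ := h
  ⟨t, ht.trans hs, hne, h0, hc.trans hl⟩

variable [DecidableEq ι] {p : ℕ} [Fact p.Prime] [Module (ZMod p) V] [Module.Finite (ZMod p) V]

lemma hasZeroSum_olson (f : ι → V) {s : Finset ι} {e : ℕ}
    (he : Module.finrank (ZMod p) V = e) (hs : e * (p - 1) < #s) :
    HasZeroSum f s (e * (p - 1) + 1) := by
  obtain ⟨s', hs', hc⟩ := exists_subset_card_eq hs
  obtain ⟨t, ht, hne, h0, -⟩ := exists_zeroSum_of_degLE (p := p) f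
    (const_mem_degLE s' 0 1) one_ne_zero (by rw [he, hc]; simp)
  exact ⟨t, ht.trans hs', hne, h0, (card_le_card ht).trans hc.le⟩

/-- A long zero-sum sequence splits into two, so that one part has at most half its length. -/
lemma exists_zeroSum_half (f : ι → V) {t : Finset ι} {e : ℕ}
    (he : Module.finrank (ZMod p) V = e) (ht : e * (p - 1) + 1 < #t)
    (h0 : ∑ i ∈ t, f i = 0) : HasZeroSum f t (#t / 2) := by
  obtain ⟨x, hx⟩ := card_pos.1 (Nat.zero_lt_of_lt ht)
  obtain ⟨u, hu, hne, hu0, -⟩ := hasZeroSum_olson (p := p) f (s := t.erase x) he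
    (by rw [card_erase_of_mem hx]; omega)
  have hut : u ⊆ t := hu.trans (erase_subset x t)
  have hxu : x ∉ u := fun h => notMem_erase x t (hu h)
  have hc := card_sdiff_add_card_eq_card hut
  rcases le_total #u #(t \ u) with h | h
  · exact ⟨u, hut, hne, hu0, by omega⟩
  · refine ⟨t \ u, sdiff_subset, ⟨x, mem_sdiff.2 ⟨hx, hxu⟩⟩, ?_, by omega⟩
    rw [← sum_sdiff hut, hu0, add_zero] at h0
    exact h0

lemma hasZeroSum_multiple (f : ι → V) {s : Finset ι} {e : ℕ}
    (he : Module.finrank (ZMod p) V = e) (h2 : 2 ≤ e) (hs : (e + 1) * (p - 1) < #s) :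
    HasZeroSum f s ((e - 1) * p) := by
  have hp := (Fact.out : p.Prime).two_le
  obtain ⟨s', hs', hc⟩ := exists_subset_card_eq hs
  obtain ⟨t, ht, hne, h0, hW⟩ := exists_zeroSum_of_degLE (p := p) f
    (prod_card_sub_mem_degLE s' (Icc 1 (p - 1)))
    (prod_card_sub_empty_ne_zero fun r hr => by rw [mem_Icc] at hr; omega)
    (by rw [he, hc, Nat.card_Icc, add_mul]; omega)
  have hmod := card_mod_notMem hW
  have hlt := Nat.mod_lt #t (by omega : p > 0)
  obtain ⟨j, hj⟩ : p ∣ #t := Nat.dvd_of_mod_eq_zero (by rw [mem_Icc] at hmod; omega)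
  obtain ⟨q, rfl⟩ : ∃ q, p = q + 1 := ⟨p - 1, by omega⟩
  obtain ⟨c, rfl⟩ : ∃ c, e = c + 2 := ⟨e - 2, by omega⟩
  have htc := card_le_card ht
  simp only [Nat.add_sub_cancel] at *
  have hj' : j ≤ c + 2 := by
    by_contra! hlt
    have : (q + 1) * (c + 3) ≤ (q + 1) * j := Nat.mul_le_mul_left _ hlt
    nlinarith
  rcases hj'.lt_or_eq with hlt | rfl
  · refine ⟨t, ht.trans hs', hne, h0, ?_⟩
    rw [hj, mul_comm]
    exact Nat.mul_le_mul_right _ (by omega)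
  · refine (exists_zeroSum_half (p := q + 1) f he ?_ h0).mono (ht.trans hs') ?_
    · rw [Nat.add_sub_cancel, hj]; nlinarith
    · rw [hj]
      refine Nat.div_le_of_le_mul ?_
      have : c + 2 - 1 = c + 1 := by omega
      rw [this]; nlinarith

/-- In dimension three, `(9 p - 5) / 2` elements contain a zero-sum of length at most
`(3 p - 1) / 2`. -/
lemma hasZeroSum_three (f : ι → V) {s : Finset ι} {h : ℕ} (hp : p = 2 * h + 1)
    (he : Module.finrank (ZMod p) V = 3) (hs : 9 * h + 1 < #s) :
    HasZeroSum f s (3 * h + 1) := by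
  have hp2 := (Fact.out : p.Prime).two_le
  by_contra hcon
  have hlong : ∀ t ⊆ s, t.Nonempty → ∑ i ∈ t, f i = 0 → 3 * h + 2 ≤ #t := by
    intro t ht hne h0
    by_contra! hlt
    exact hcon ⟨t, ht, hne, h0, by omega⟩
  have h20 : (2 : ZMod p) ≠ 0 := by
    intro h0
    have := (ZMod.natCast_eq_zero_iff 2 p).1 (by exact_mod_cast h0)
    have := Nat.le_of_dvd two_pos this
    omega
  obtain ⟨s', hs', hc⟩ := exists_subset_card_eq hs
  obtain ⟨Z, hZ, hne, hZ0, hW⟩ := exists_zeroSum_of_degLE (p := p) f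
    (mul_mem_degLE (sub_mem (choose_add_mem_degLE s' p 0) (const_mem_degLE s' p (2 : ZMod p)))
      (prod_card_sub_mem_degLE s' (Icc (h + 1) (2 * h))))
    (mul_ne_zero (by simpa [Nat.choose_eq_zero_of_lt (by omega : 0 < p)] using h20)
      (prod_card_sub_empty_ne_zero fun r hr => by rw [mem_Icc] at hr; omega))
    (by rw [he, hc, Nat.card_Icc]; omega)
  have hZs := hZ.trans hs'
  have hZmod := card_mod_notMem (right_ne_zero_of_mul hW)
  have hZdiv : #Z / p ≠ 2 := by
    intro h2
    refine left_ne_zero_of_mul hW ?_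
    simp [choose_prime_eq, h2]
  have hdm := Nat.div_add_mod #Z p
  have hmlt := Nat.mod_lt #Z (by omega : p > 0)
  have hZc := card_le_card hZ
  have hZl := hlong Z hZs hne hZ0
  obtain ⟨x, hx⟩ := hne
  have hsub : ∀ u ⊆ Z.erase x, u.Nonempty → ∑ i ∈ u, f i = 0 →
      3 * h + 2 ≤ #u ∧ #u + (3 * h + 2) ≤ #Z := by
    intro u hu hune hu0
    have huZ : u ⊆ Z := hu.trans (erase_subset x Z)
    have hxu : x ∉ u := fun h => notMem_erase x Z (hu h)
    have hcu := card_sdiff_add_card_eq_card huZ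
    refine ⟨hlong u (huZ.trans hZs) hune hu0, ?_⟩
    have := hlong (Z \ u) (sdiff_subset.trans hZs) ⟨x, mem_sdiff.2 ⟨hx, hxu⟩⟩ (by
      rw [← sum_sdiff huZ, hu0, add_zero] at hZ0
      exact hZ0)
    omega
  have hcx := card_erase_of_mem hx
  generalize hq : #Z / p = q at *
  generalize hr : #Z % p = r at *
  have hrh : r ≤ h := by rw [mem_Icc] at hZmod; omega
  have hA : ∀ a ∈ Icc (h + 1) (h + r), 0 < a ∧ a < p := fun a ha => by
    rw [mem_Icc] at ha; omega
  have hq34 : q = 3 ∨ q = 4 := by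
    rcases lt_or_ge q 3 with h3 | h3
    · interval_cases q <;> omega
    · rcases lt_or_ge q 5 with h5 | h5
      · omega
      · have := Nat.mul_le_mul_left p h5
        omega
  rcases hq34 with rfl | rfl
  · obtain ⟨u, hu, hune, hu0, hWu⟩ := exists_zeroSum_of_degLE (p := p) f
      (prod_card_sub_mem_degLE (Z.erase x) (Icc (h + 1) (h + r)))
      (prod_card_sub_empty_ne_zero hA)
      (by rw [he, hcx, Nat.card_Icc]; omega)
    have hmod := card_mod_notMem hWu
    have hb := hsub u hu hune hu0
    have : #u % p = #u - p := by
      rw [Nat.mod_eq_sub_mod (by omega), Nat.mod_eq_of_lt (by omega)]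
    rw [this, mem_Icc] at hmod
    omega
  · obtain ⟨u, hu, hune, hu0, hWu⟩ := exists_zeroSum_of_degLE (p := p) f
      (mul_mem_degLE (sub_mem (choose_add_mem_degLE (Z.erase x) p h)
        (const_mem_degLE (Z.erase x) p (2 : ZMod p)))
        (prod_card_sub_mem_degLE (Z.erase x) (Icc (h + 1) (h + r))))
      (mul_ne_zero (by simpa [Nat.choose_eq_zero_of_lt (by omega : h < p)] using h20)
        (prod_card_sub_empty_ne_zero hA))
      (by rw [he, hcx, Nat.card_Icc]; omega)
    have hmod := card_mod_notMem (right_ne_zero_of_mul hWu)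
    have hb := hsub u hu hune hu0
    rcases lt_or_ge (#u + h) (3 * p) with h3 | h3
    · refine left_ne_zero_of_mul hWu ?_
      have : (#u + h) / p = 2 := Nat.div_eq_of_lt_le (by omega) (by omega)
      simp [choose_prime_eq, this]
    · have : #u % p = #u - p - p := by
        rw [Nat.mod_eq_sub_mod (by omega), Nat.mod_eq_sub_mod (by omega),
          Nat.mod_eq_of_lt (by omega)]
      rw [this, mem_Icc] at hmod
      omega

end Short

section Averaging

variable {ι V : Type*} [AddCommGroup V] {p : ℕ} [Fact p.Prime]
  [Module (ZMod p) V] [Module.Finite (ZMod p) V]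

lemma finrank_ker_of_ne_zero {φ : Module.Dual (ZMod p) V} (hφ : φ ≠ 0) {e : ℕ}
    (he : Module.finrank (ZMod p) V = e + 1) :
    Module.finrank (ZMod p) (LinearMap.ker φ) = e := by
  have := Module.Dual.finrank_ker_add_one_of_ne_zero hφ
  omega

lemma natCard_dual_vanishing {x : V} (hx : x ≠ 0) {e : ℕ}
    (he : Module.finrank (ZMod p) V = e + 1) :
    Nat.card {φ : Module.Dual (ZMod p) V // φ x = 0} = p ^ e := by
  have hne : Module.Dual.eval (ZMod p) V x ≠ 0 := by
    rwa [Ne, Module.eval_apply_eq_zero_iff]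
  have h1 := Module.natCard_eq_pow_finrank (K := ZMod p)
    (V := LinearMap.ker (Module.Dual.eval (ZMod p) V x))
  rw [finrank_ker_of_ne_zero hne (Subspace.dual_finrank_eq.trans he), Nat.card_zmod] at h1
  rw [← h1]
  rfl

/-- Some hyperplane contains at least the average number of terms of the sequence. -/
lemma exists_dual_card_filter (f : ι → V) (s : Finset ι) (hf : ∀ i ∈ s, f i ≠ 0) {e : ℕ}
    (he : Module.finrank (ZMod p) V = e + 1) :
    ∃ φ : Module.Dual (ZMod p) V, φ ≠ 0 ∧
      #s * ((p : ℝ) ^ e - 1) ≤ #{i ∈ s | φ (f i) = 0} * ((p : ℝ) ^ (e + 1) - 1) := by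
  classical
  have : Finite (Module.Dual (ZMod p) V) := Module.finite_of_finite (ZMod p)
  have := Fintype.ofFinite (Module.Dual (ZMod p) V)
  have hp1 : (1 : ℝ) < p := by exact_mod_cast (Fact.out : p.Prime).one_lt
  have hcard : ((#((univ : Finset (Module.Dual (ZMod p) V)).erase 0) : ℕ) : ℝ) =
      (p : ℝ) ^ (e + 1) - 1 := by
    have h1 := Module.natCard_eq_pow_finrank (K := ZMod p) (V := Module.Dual (ZMod p) V)
    rw [Subspace.dual_finrank_eq, he, Nat.card_zmod, Nat.card_eq_fintype_card] at h1
    rw [card_erase_of_mem (mem_univ _), card_univ, h1, Nat.cast_sub, Nat.cast_pow, Nat.cast_one]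
    exact Nat.one_le_pow _ _ (Fact.out : p.Prime).pos
  have hx : ∀ i ∈ s, ((#{φ ∈ (univ : Finset (Module.Dual (ZMod p) V)).erase 0 |
      φ (f i) = 0} : ℕ) : ℝ) = (p : ℝ) ^ e - 1 := by
    intro i hi
    have h1 := natCard_dual_vanishing (p := p) (hf i hi) he
    rw [Nat.card_eq_fintype_card, Fintype.card_subtype] at h1
    rw [filter_erase, card_erase_of_mem (by simp), h1, Nat.cast_sub, Nat.cast_pow, Nat.cast_one]
    exact Nat.one_le_pow _ _ (Fact.out : p.Prime).pos
  have hsum : ∑ φ ∈ (univ : Finset (Module.Dual (ZMod p) V)).erase 0,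
      ((#{i ∈ s | φ (f i) = 0} : ℕ) : ℝ) = #s * ((p : ℝ) ^ e - 1) := by
    have := sum_card_bipartiteAbove_eq_sum_card_bipartiteBelow
      (s := (univ : Finset (Module.Dual (ZMod p) V)).erase 0) (t := s)
      (fun φ i => φ (f i) = 0)
    unfold bipartiteAbove bipartiteBelow at this
    rw [← Nat.cast_sum, this, Nat.cast_sum, sum_congr rfl hx, sum_const, nsmul_eq_mul]
  have hpos : 0 < (p : ℝ) ^ (e + 1) - 1 := sub_pos.2 (one_lt_pow₀ hp1 (by omega))
  obtain ⟨φ, hφ, hle⟩ := exists_le_of_sum_le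
    (s := (univ : Finset (Module.Dual (ZMod p) V)).erase 0)
    (f := fun _ => #s * ((p : ℝ) ^ e - 1) / ((p : ℝ) ^ (e + 1) - 1))
    (g := fun φ : Module.Dual (ZMod p) V => ((#{i ∈ s | φ (f i) = 0} : ℕ) : ℝ))
    (by
      rw [← card_pos, ← Nat.cast_pos (α := ℝ), hcard]
      exact hpos)
    (by rw [hsum, sum_const, nsmul_eq_mul, hcard, mul_div_cancel₀ _ hpos.ne'])
  refine ⟨φ, (mem_erase.1 hφ).1, ?_⟩
  exact (div_le_iff₀ hpos).1 hle

/-- Over every `e`-dimensional space, sequences of length more than `τ` have a nonempty zero-sum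
subsequence of length at most `l`. -/
def ForcesShort.{u, v} (p : ℕ) [Fact p.Prime] (e : ℕ) (τ : ℝ) (l : ℕ) : Prop :=
  ∀ (V : Type u) [AddCommGroup V] [Module (ZMod p) V] [Module.Finite (ZMod p) V],
    Module.finrank (ZMod p) V = e → ∀ (ι : Type v) (f : ι → V) (s : Finset ι),
      τ < #s → HasZeroSum f s l

lemma ForcesShort.succ.{u, v} {e l : ℕ} {α : ℝ} (he : 1 ≤ e) (hl : 1 ≤ l)
    (h : ForcesShort.{u, v} p e (α * (p ^ e - 1)) l) :
    ForcesShort.{u, v} p (e + 1) (α * (p ^ (e + 1) - 1)) l := by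
  intro V _ _ _ hV ι f s hs
  by_cases hf : ∀ i ∈ s, f i ≠ 0
  · obtain ⟨φ, hφ, hle⟩ := exists_dual_card_filter (p := p) f s hf hV
    have hp1 : (1 : ℝ) < p := by exact_mod_cast (Fact.out : p.Prime).one_lt
    have hpos : 0 < (p : ℝ) ^ (e + 1) - 1 := sub_pos.2 (one_lt_pow₀ hp1 (by omega))
    have hpos' : 0 < (p : ℝ) ^ e - 1 := sub_pos.2 (one_lt_pow₀ hp1 (by omega))
    have hlt : α * ((p : ℝ) ^ e - 1) < #{i ∈ s | φ (f i) = 0} := by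
      have := mul_lt_mul_of_pos_right hs hpos'
      nlinarith
    obtain ⟨t, ht, hne, h0, hc⟩ := h (LinearMap.ker φ) (finrank_ker_of_ne_zero hφ hV) ι
      (fun i => if hi : φ (f i) = 0 then ⟨f i, hi⟩ else 0) _ hlt
    refine ⟨t, ht.trans (filter_subset _ s), hne, ?_, hc⟩
    have h1 := congrArg Subtype.val h0
    rw [AddSubmonoidClass.coe_finsetSum] at h1
    refine (sum_congr rfl fun i hi => ?_).trans h1
    rw [dif_pos (mem_filter.1 (ht hi)).2]
  · push Not at hf
    obtain ⟨i, hi, h0⟩ := hf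
    exact ⟨{i}, by simpa using hi, by simp, by simpa using h0, by simpa using hl⟩

lemma ForcesShort.of_le.{u, v} {e d l M : ℕ} (he : 1 ≤ e) (hl : 1 ≤ l) (hed : e ≤ d)
    (h : ForcesShort.{u, v} p e M l) :
    ForcesShort.{u, v} p d (M / (p ^ e - 1) * (p ^ d - 1)) l := by
  induction d, hed using Nat.le_induction with
  | base =>
    have hp1 : (1 : ℝ) < p := by exact_mod_cast (Fact.out : p.Prime).one_lt
    rwa [div_mul_cancel₀ _ (sub_pos.2 (one_lt_pow₀ hp1 (by omega))).ne']
  | succ d hd ih => exact ih.succ (he.trans hd) hl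

end Averaging

section Packing

variable {ι V : Type*} [AddCommGroup V]

/-- There are `k` pairwise disjoint nonempty zero-sum subsequences. -/
def HasPacking (f : ι → V) (s : Finset ι) (k : ℕ) : Prop :=
  ∃ P : Finset (Finset ι), #P = k ∧ (∀ t ∈ P, t ⊆ s ∧ t.Nonempty ∧ ∑ i ∈ t, f i = 0) ∧
    (P : Set (Finset ι)).PairwiseDisjoint id

lemma HasPacking.zero (f : ι → V) (s : Finset ι) : HasPacking f s 0 :=
  ⟨∅, by simp, by simp, by simp⟩

lemma HasPacking.mono {f : ι → V} {s s' : Finset ι} {k : ℕ} (h : HasPacking f s k)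
    (hs : s ⊆ s') : HasPacking f s' k :=
  let ⟨P, hc, hP, hd⟩ := h
  ⟨P, hc, fun t ht => ⟨(hP t ht).1.trans hs, (hP t ht).2⟩, hd⟩

/-- Every sequence of length `N` contains more than `b * N - c` disjoint zero-sum subsequences,
and this is witnessed by a potential which is Lipschitz with constant `b`. -/
def PackingBound (f : ι → V) (b c : ℝ) : Prop :=
  ∃ Φ : ℝ → ℝ, (∀ x y, x ≤ y → Φ y ≤ Φ x + b * (y - x)) ∧ (∀ x, b * x - c ≤ Φ x) ∧
    ∀ (s : Finset ι) (k : ℕ), (k : ℝ) - 1 < Φ #s → HasPacking f s k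

lemma PackingBound.zero (f : ι → V) : PackingBound f 0 0 :=
  ⟨0, by simp, by simp, fun s k hk => by
    have : (k : ℝ) < 1 := by simpa using hk
    obtain rfl : k = 0 := Nat.lt_one_iff.1 (by exact_mod_cast this)
    exact .zero f s⟩

lemma PackingBound.hasPacking {f : ι → V} {b c : ℝ} (h : PackingBound f b c) {s : Finset ι}
    {k : ℕ} (hk : (k : ℝ) - 1 < b * #s - c) : HasPacking f s k :=
  let ⟨_, _, hlow, hpack⟩ := h
  hpack s k (hk.trans_le (hlow _))

variable [DecidableEq ι]

lemma HasPacking.cons {f : ι → V} {s t : Finset ι} {k : ℕ} (hts : t ⊆ s) (hne : t.Nonempty)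
    (h0 : ∑ i ∈ t, f i = 0) (h : HasPacking f (s \ t) k) : HasPacking f s (k + 1) := by
  obtain ⟨P, hc, hP, hd⟩ := h
  have hdt : ∀ u ∈ P, Disjoint t u := fun u hu =>
    disjoint_sdiff.mono_right (hP u hu).1
  have htP : t ∉ P := fun ht => hne.ne_empty (disjoint_self.1 (hdt t ht))
  refine ⟨insert t P, by rw [card_insert_of_notMem htP, hc], ?_, ?_⟩
  · simp only [mem_insert, forall_eq_or_imp]
    exact ⟨⟨hts, hne, h0⟩, fun u hu => ⟨(hP u hu).1.trans sdiff_subset, (hP u hu).2⟩⟩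
  · rw [coe_insert]
    exact hd.insert fun u hu _ => hdt u hu

lemma PackingBound.step {f : ι → V} {b c : ℝ} (h : PackingBound f b c) {l : ℕ} {τ : ℝ}
    (hl : 0 < l) (hb : b ≤ (l : ℝ)⁻¹) (hτ : ∀ s : Finset ι, τ < #s → HasZeroSum f s l) :
    PackingBound f (l : ℝ)⁻¹ (c + ((l : ℝ)⁻¹ - b) * τ) := by
  obtain ⟨Φ, hlip, hlow, hpack⟩ := h
  have hlip' : ∀ x y, x ≤ y → Φ y + ((l : ℝ)⁻¹ - b) * max 0 (y - τ) ≤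
      Φ x + ((l : ℝ)⁻¹ - b) * max 0 (x - τ) + (l : ℝ)⁻¹ * (y - x) := by
    intro x y hxy
    have h1 : max 0 (y - τ) ≤ max 0 (x - τ) + (y - x) :=
      max_le (by have := le_max_left 0 (x - τ); linarith)
        (by have := le_max_right 0 (x - τ); linarith)
    have := mul_le_mul_of_nonneg_left h1 (sub_nonneg.2 hb)
    have := hlip x y hxy
    nlinarith
  refine ⟨fun x => Φ x + ((l : ℝ)⁻¹ - b) * max 0 (x - τ), hlip', fun x => ?_, ?_⟩
  · have := mul_le_mul_of_nonneg_left (le_max_right 0 (x - τ)) (sub_nonneg.2 hb)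
    have := hlow x
    simp only
    linarith
  · intro s k
    induction k generalizing s with
    | zero => exact fun _ => .zero f s
    | succ k ih =>
      intro hk
      rcases le_or_gt (#s : ℝ) τ with hs | hs
      · refine hpack s _ ?_
        beta_reduce at hk
        rwa [max_eq_left (by linarith), mul_zero, add_zero] at hk
      · obtain ⟨t, hts, hne, h0, hc⟩ := hτ s hs
        refine .cons hts hne h0 (ih (s \ t) ?_)
        have hcard : (#(s \ t) : ℝ) = #s - #t := by
          rw [← card_sdiff_add_card_eq_card hts]; push_cast; ring
        have := hlip' #(s \ t) #s (by rw [hcard]; linarith [(Nat.cast_nonneg #t : (0:ℝ) ≤ #t)])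
        have h1 : (l : ℝ)⁻¹ * (#s - #(s \ t)) ≤ 1 := by
          rw [hcard, inv_mul_le_iff₀ (by exact_mod_cast hl), mul_one]
          have : (#t : ℝ) ≤ l := by exact_mod_cast hc
          linarith
        push_cast at hk
        linarith

end Packing

section Characteristic

variable {ι V : Type*} [DecidableEq ι] [AddCommGroup V]

lemma hasPacking_plane {p : ℕ} [Fact p.Prime] [Module (ZMod p) V] [Module.Finite (ZMod p) V]
    (hV : Module.finrank (ZMod p) V = 2) (f : ι → V) (s : Finset ι) (k : ℕ)
    (hs : p * k + p ≤ #s + 1) : HasPacking f s k := by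
  have hp := (Fact.out : p.Prime).two_le
  induction k generalizing s with
  | zero => exact .zero f s
  | succ k ih =>
    rcases Nat.eq_zero_or_pos k with rfl | hk
    · obtain ⟨t, hts, hne, h0, -⟩ := hasZeroSum_olson (p := p) f hV (s := s) (by omega)
      exact .cons hts hne h0 (.zero f _)
    · have h1 := Nat.mul_le_mul_left p hk
      have h2 : p * (k + 1) = p * k + p := by ring
      obtain ⟨t, hts, hne, h0, hc⟩ := hasZeroSum_multiple (p := p) f hV le_rfl (s := s)
        (by omega)
      refine .cons hts hne h0 (ih _ ?_)
      have := card_sdiff_add_card_eq_card hts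
      omega

end Characteristic

section CharTwo

variable {ι V : Type*} [DecidableEq ι] [AddCommGroup V]

/-- In an elementary 2-group, pairs of terms that differ by a fixed term of the sequence can be
combined into zero-sum subsequences. -/
lemma hasPacking_of_pairs (h2 : ∀ x : V, x + x = 0) (f : ι → V) {i₀ : ι} (hi₀ : f i₀ ≠ 0)
    (k : ℕ) (s C : Finset ι) (hs : i₀ ∈ s) (hC : C ⊆ s.erase i₀)
    (hinj : Set.InjOn f C) (hpair : ∀ i ∈ C, ∃ j ∈ C, f j = f i + f i₀)
    (hk : 4 * k ≤ #C + 2) : HasPacking f s k := by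
  have hadd : ∀ {x y : V}, x = y + f i₀ → y = x + f i₀ := by
    rintro _ y rfl
    rw [add_assoc, h2, add_zero]
  have hne : ∀ {i j : ι}, f j = f i + f i₀ → i ≠ j := by
    rintro i _ h rfl
    exact hi₀ (by simpa using h.symm)
  induction k generalizing s C with
  | zero => exact .zero f s
  | succ k ih =>
    have hCs : ∀ {i}, i ∈ C → i ∈ s ∧ i ≠ i₀ := fun h =>
      ⟨mem_of_mem_erase (hC h), ne_of_mem_erase (hC h)⟩
    obtain ⟨i, hi⟩ : C.Nonempty := card_pos.1 (by omega)
    obtain ⟨j, hj, hij⟩ := hpair i hi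
    rcases Nat.eq_zero_or_pos k with rfl | hk0
    · refine .cons (t := {i₀, i, j}) ?_ (by simp) ?_ (.zero f _)
      · simp [insert_subset_iff, hs, hCs hi, hCs hj]
      · rw [sum_insert (by simp [(hCs hi).2.symm, (hCs hj).2.symm]), sum_pair (hne hij), hij,
          ← add_assoc (f i), h2, zero_add, h2]
    · have hij2 : #({i, j} : Finset ι) ≤ 2 := card_le_two
      obtain ⟨l, hl, hlij⟩ := exists_mem_notMem_of_card_lt_card
        (s := ({i, j} : Finset ι)) (t := C) (by omega)
      obtain ⟨m, hm, hlm⟩ := hpair l hl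
      simp only [mem_insert, mem_singleton, not_or] at hlij
      have hmi : m ≠ i := fun h => hlij.2 (hinj hl hj (by rw [hij, ← h]; exact hadd hlm))
      have hmj : m ≠ j := fun h => hlij.1 (hinj hl hi (by rw [hadd hij, ← h]; exact hadd hlm))
      have hQC : ({i, j, l, m} : Finset ι) ⊆ C := by
        simp [insert_subset_iff, hi, hj, hl, hm]
      have hcard : #({i, j, l, m} : Finset ι) ≤ 4 := card_le_four
      refine .cons (t := {i, j, l, m}) (fun x hx => (hCs (hQC hx)).1) (by simp) ?_
        (ih (s \ {i, j, l, m}) (C \ {i, j, l, m}) ?_ ?_ ?_ ?_ ?_)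
      · rw [sum_insert (by simp [hne hij, Ne.symm hlij.1, hmi.symm]),
          sum_insert (by simp [Ne.symm hlij.2, hmj.symm]), sum_pair (hne hlm), hij, hlm,
          ← add_assoc (f l), h2, zero_add, ← add_assoc, ← add_assoc, h2, zero_add, h2]
      · exact mem_sdiff.2 ⟨hs, fun h => (hCs (hQC h)).2 rfl⟩
      · intro x hx
        rw [mem_sdiff] at hx
        exact mem_erase.2 ⟨(hCs hx.1).2, mem_sdiff.2 ⟨(hCs hx.1).1, hx.2⟩⟩
      · exact hinj.mono (by simp)
      · intro a ha
        rw [mem_sdiff] at ha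
        obtain ⟨b, hb, hab⟩ := hpair a ha.1
        refine ⟨b, mem_sdiff.2 ⟨hb, fun hbQ => ha.2 ?_⟩, hab⟩
        simp only [mem_insert, mem_singleton] at hbQ ⊢
        rcases hbQ with rfl | rfl | rfl | rfl
        · exact .inr (.inl (hinj ha.1 hj (by rw [hij]; exact hadd hab)))
        · exact .inl (hinj ha.1 hi (by rw [hadd hij]; exact hadd hab))
        · exact .inr (.inr (.inr (hinj ha.1 hm (by rw [hlm]; exact hadd hab))))
        · exact .inr (.inr (.inl (hinj ha.1 hl (by rw [hadd hlm]; exact hadd hab))))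
      · have := card_sdiff_add_card_eq_card hQC
        omega

lemma hasPacking_two [Finite V] (h2 : ∀ x : V, x + x = 0) (f : ι → V) (s : Finset ι) (k : ℕ)
    (hs : 4 * k + Nat.card V ≤ 2 * #s + 2) : HasPacking f s k := by
  classical
  have := Fintype.ofFinite V
  rw [Nat.card_eq_fintype_card] at hs
  induction k generalizing s with
  | zero => exact .zero f s
  | succ k ih =>
    by_cases h0 : ∃ i ∈ s, f i = 0
    · obtain ⟨i, hi, h0⟩ := h0
      refine .cons (t := {i}) (by simpa using hi) (by simp) (by simpa using h0) (ih _ ?_)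
      have := card_sdiff_add_card_eq_card (singleton_subset_iff.2 hi)
      rw [card_singleton] at this
      omega
    by_cases hinj : Set.InjOn f s
    · push Not at h0
      have hV : 0 < Fintype.card V := Fintype.card_pos
      obtain ⟨i₀, hi₀⟩ : s.Nonempty := card_pos.1 (by omega)
      set A := (s.erase i₀).image f with hA
      have hinj' : Set.InjOn f (s.erase i₀) := hinj.mono (by simp)
      have hAc : #A = #s - 1 := by rw [hA, card_image_of_injOn hinj', card_erase_of_mem hi₀]
      have hsc : 0 < #s := card_pos.2 ⟨i₀, hi₀⟩
      have hA0 : ∀ x ∈ A, x ≠ 0 ∧ x ≠ f i₀ := by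
        intro x hx
        obtain ⟨i, hi, rfl⟩ := mem_image.1 hx
        exact ⟨h0 i (mem_of_mem_erase hi), fun h =>
          ne_of_mem_erase hi (hinj (mem_of_mem_erase hi) hi₀ h)⟩
      have hB : #(A.image (· + f i₀)) = #A := card_image_of_injective _ (add_left_injective _)
      have hU : A ∪ A.image (· + f i₀) ⊆ (univ.erase 0).erase (f i₀) := by
        refine union_subset (fun x hx => by simpa using (hA0 x hx).symm) fun x hx => ?_
        obtain ⟨y, hy, rfl⟩ := mem_image.1 hx
        refine mem_erase.2 ⟨fun h => (hA0 y hy).1 (by simpa using h), mem_erase.2 ⟨fun h => ?_,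
          mem_univ _⟩⟩
        refine (hA0 y hy).2 ?_
        rw [← add_zero y, ← h2 (f i₀), ← add_assoc, h, zero_add]
      have hUc := card_le_card hU
      rw [card_erase_of_mem (by simp [h0 i₀ hi₀]), card_erase_of_mem (mem_univ _), card_univ]
        at hUc
      have hun := card_union_add_card_inter A (A.image (· + f i₀))
      set C := {i ∈ s.erase i₀ | f i + f i₀ ∈ A} with hC
      have hCA : C.image f = A ∩ A.image (· + f i₀) := by
        ext x
        simp only [hC, mem_image, mem_filter, mem_inter, hA]
        constructor
        · rintro ⟨i, ⟨hi, j, hj, hij⟩, rfl⟩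
          exact ⟨⟨i, hi, rfl⟩, f i + f i₀, ⟨j, hj, hij⟩, by rw [add_assoc, h2, add_zero]⟩
        · rintro ⟨⟨i, hi, rfl⟩, y, hy, hyi⟩
          refine ⟨i, ⟨hi, ?_⟩, rfl⟩
          rwa [← hyi, add_assoc, h2, add_zero]
      have hCsub : C ⊆ s.erase i₀ := filter_subset _ _
      have hCc : #(C.image f) = #C := card_image_of_injOn (hinj'.mono (by exact_mod_cast hCsub))
      refine hasPacking_of_pairs h2 f (h0 i₀ hi₀) (k + 1) s C hi₀ hCsub
        (hinj'.mono (by exact_mod_cast hCsub)) ?_ ?_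
      · intro i hi
        obtain ⟨hi, hiA⟩ := mem_filter.1 hi
        obtain ⟨j, hj, hij⟩ := mem_image.1 hiA
        refine ⟨j, mem_filter.2 ⟨hj, ?_⟩, hij⟩
        rw [hij, add_assoc, h2, add_zero]
        exact mem_image_of_mem f hi
      · rw [← hCc, hCA]
        omega
    · simp only [Set.InjOn, not_forall] at hinj
      obtain ⟨i, hi, j, hj, hij, hne⟩ := hinj
      have hsub : ({i, j} : Finset ι) ⊆ s := by simp_all [insert_subset_iff]
      refine .cons (t := {i, j}) hsub (by simp) ?_ (ih _ ?_)
      · rw [sum_pair hne, hij, h2]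
      · have := card_sdiff_add_card_eq_card hsub
        rw [card_pair hne] at this
        omega

end CharTwo

section CharThree

/-- In an elementary 3-group, a set containing no zero, no pair of opposite elements and no three
distinct elements of sum zero has density at most one third. -/
lemma card_le_of_cap {V : Type*} [AddCommGroup V] [Fintype V] [DecidableEq V]
    (h3 : ∀ x : V, x + x + x = 0) (W : Finset V) (hzero : 0 ∉ W)
    (hneg : ∀ x ∈ W, -x ∉ W)
    (hline : ∀ x ∈ W, ∀ y ∈ W, ∀ z ∈ W, x ≠ y → x ≠ z → y ≠ z → x + y + z ≠ 0) :
    3 * #W ≤ Fintype.card V := by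
  rcases W.eq_empty_or_nonempty with rfl | ⟨g, hg⟩
  · simp
  have hg0 : g ≠ 0 := fun h => hzero (h ▸ hg)
  have hgg : -g ∉ W := hneg g hg
  have hgg2 : g + g = -g := eq_neg_of_add_eq_zero_left (h3 g)
  let w : V → ℕ := fun x => if x ∈ W then 1 else 0
  have hsum : ∀ e : V ≃ V, ∑ a, w (e a) = #W := by
    intro e
    rw [e.sum_comp w]
    simp [w]
  have key : ∀ a, w a + w (a + g) + w (a - g) + w (-a) + w (-a - g) + w (-a + g) ≤ 2 := by
    intro a
    by_cases ha0 : a = 0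
    · subst ha0
      simp [w, hzero, hg, hgg]
    by_cases hag : a = g
    · subst hag
      have : -a - a = a := by rw [sub_eq_add_neg, ← neg_add, hgg2, neg_neg]
      simp [w, hzero, hg, hgg, hgg2, this]
    by_cases hag' : a = -g
    · subst hag'
      have : -g - g = g := by rw [sub_eq_add_neg, ← neg_add, hgg2, neg_neg]
      simp [w, hzero, hg, hgg, hgg2, this]
    have h3a := h3 a
    have h3g := h3 g
    have e1 : ¬ (a ∈ W ∧ -a ∈ W) := fun h => hneg a h.1 h.2
    have e2 : ¬ (a + g ∈ W ∧ -a - g ∈ W) := fun h => hneg _ h.1 (by rw [neg_add']; exact h.2)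
    have e3 : ¬ (a - g ∈ W ∧ -a + g ∈ W) := fun h => hneg _ h.1 (by
      rw [neg_sub, sub_eq_neg_add]; exact h.2)
    have hthird : ∀ x ∈ W, ∀ y ∈ W, ∀ z, x ≠ y → x + y + z = 0 → z ∉ W := by
      intro x hx y hy z hxy h hz
      refine hline x hx y hy z hz hxy ?_ ?_ h
      · rintro rfl
        refine hxy (add_right_cancel (b := x) (add_left_cancel (a := x) ?_))
        rw [← add_assoc, ← add_assoc, h3, h]
      · rintro rfl
        refine hxy (add_right_cancel (b := y + y) ?_)
        rw [← add_assoc, ← add_assoc, h3, h]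
    have e4 : ¬ (a ∈ W ∧ -a - g ∈ W) := fun h =>
      hthird a h.1 g hg _ hag (by abel) h.2
    have e5 : ¬ (a + g ∈ W ∧ -a + g ∈ W) := fun h =>
      hthird _ h.1 g hg _ (by simpa using ha0) (by rw [← h3g]; abel) h.2
    have e6 : ¬ (a - g ∈ W ∧ -a ∈ W) := fun h =>
      hthird _ h.2 g hg _ (fun h => hag' (by rw [← h, neg_neg])) (by abel) h.1
    have e7 : ¬ (a ∈ W ∧ a + g ∈ W ∧ a - g ∈ W) := fun h =>
      hthird _ h.1 _ h.2.1 _ (by simpa using hg0) (by rw [← h3a]; abel) h.2.2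
    have e8 : ¬ (-a ∈ W ∧ -a - g ∈ W ∧ -a + g ∈ W) := fun h =>
      hthird _ h.1 _ h.2.1 _ (fun h => hg0 (by simpa using h.symm)) (by rw [← neg_zero, ← h3a]; abel) h.2.2
    have hw : ∀ x, w x ≤ 1 := fun x => by by_cases hx : x ∈ W <;> simp [w, hx]
    have hpair : ∀ x y, ¬ (x ∈ W ∧ y ∈ W) → w x + w y ≤ 1 := fun x y h => by
      by_cases hx : x ∈ W <;> by_cases hy : y ∈ W <;> simp_all [w]
    have htriple : ∀ x y z, ¬ (x ∈ W ∧ y ∈ W ∧ z ∈ W) →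
        w x + w y + w z ≤ 2 := fun x y z h => by
      by_cases hx : x ∈ W <;> by_cases hy : y ∈ W <;> by_cases hz : z ∈ W <;> simp_all [w]
    have w1 := hw a
    have w2 := hw (a + g)
    have w3 := hw (a - g)
    have w4 := hw (-a)
    have w5 := hw (-a - g)
    have w6 := hw (-a + g)
    have p1 := hpair _ _ e1
    have p2 := hpair _ _ e2
    have p3 := hpair _ _ e3
    have p4 := hpair _ _ e4
    have p5 := hpair _ _ e5
    have p6 := hpair _ _ e6
    have p7 := htriple _ _ _ e7
    have p8 := htriple _ _ _ e8
    omega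
  have htot := sum_le_sum fun a (_ : a ∈ (univ : Finset V)) => key a
  simp only [sum_add_distrib, sum_const, card_univ, smul_eq_mul] at htot
  have s1 := hsum (Equiv.refl V)
  have s2 := hsum (Equiv.addRight g)
  have s3 := hsum (Equiv.subRight g)
  have s4 := hsum (Equiv.neg V)
  have s5 := hsum ((Equiv.neg V).trans (Equiv.subRight g))
  have s6 := hsum ((Equiv.neg V).trans (Equiv.addRight g))
  simp only [Equiv.refl_apply, Equiv.coe_addRight, Equiv.subRight_apply, Equiv.neg_apply,
    Equiv.trans_apply] at s1 s2 s3 s4 s5 s6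
  omega

lemma hasZeroSum_of_three {ι V : Type*} [AddCommGroup V] [Finite V]
    (h3 : ∀ x : V, x + x + x = 0) (f : ι → V) (s : Finset ι)
    (hs : 2 * Nat.card V < 3 * #s) : HasZeroSum f s 3 := by
  classical
  have := Fintype.ofFinite V
  rw [Nat.card_eq_fintype_card] at hs
  by_contra hcon
  have hno : ∀ t ⊆ s, t.Nonempty → #t ≤ 3 → ∑ i ∈ t, f i ≠ 0 :=
    fun t ht hne hc h0 => hcon ⟨t, ht, hne, h0, hc⟩
  have hzero : ∀ i ∈ s, f i ≠ 0 := fun i hi => by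
    simpa using hno {i} (by simpa using hi) (by simp) (by simp)
  have hpair : ∀ i ∈ s, ∀ j ∈ s, f i + f j ≠ 0 := by
    intro i hi j hj h
    by_cases hij : i = j
    · subst hij
      have := h3 (f i)
      rw [h, zero_add] at this
      exact hzero i hi this
    · refine hno {i, j} (by simp [insert_subset_iff, hi, hj]) (by simp)
        (card_le_two.trans (by norm_num)) ?_
      rw [sum_pair hij, h]
  have htriple : ∀ i ∈ s, ∀ j ∈ s, ∀ k ∈ s, i ≠ j → i ≠ k → j ≠ k → f i + f j + f k ≠ 0 := by
    intro i hi j hj k hk hij hik hjk h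
    refine hno {i, j, k} (by simp [insert_subset_iff, hi, hj, hk]) (by simp) card_le_three ?_
    rw [sum_insert (by simp [hij, hik]), sum_pair hjk, ← add_assoc, h]
  have hW := card_le_of_cap h3 (s.image f)
    (by
      simp only [mem_image, not_exists, not_and]
      exact hzero)
    (by
      simp only [mem_image, not_exists, not_and]
      rintro _ ⟨i, hi, rfl⟩ j hj h
      exact hpair i hi j hj (by rw [h, add_neg_cancel]))
    (by
      simp only [mem_image]
      rintro _ ⟨i, hi, rfl⟩ _ ⟨j, hj, rfl⟩ _ ⟨k, hk, rfl⟩ hij hik hjk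
      exact htriple i hi j hj k hk (fun h => hij (by rw [h])) (fun h => hik (by rw [h]))
        (fun h => hjk (by rw [h])))
  have hfib := card_le_mul_card_image (f := f) s 2 (by
    intro x _
    by_contra! hlt
    obtain ⟨i, hi, j, hj, k, hk, hij, hik, hjk⟩ := two_lt_card.1 hlt
    simp only [mem_filter] at hi hj hk
    refine htriple i hi.1 j hj.1 k hk.1 hij hik hjk ?_
    rw [hi.2, hj.2, hk.2, h3])
  omega

end CharThree

section OddChain

variable {p : ℕ} [Fact p.Prime]

lemma forcesShort_olson.{u, v} {h : ℕ} (hp : p = 2 * h + 1) (e : ℕ) :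
    ForcesShort.{u, v} p e (e * (2 * h) : ℕ) (e * (2 * h) + 1) := by
  classical
  intro V _ _ _ hV ι f s hs
  have := hasZeroSum_olson (p := p) f hV (s := s)
    (by rw [hp, Nat.add_sub_cancel]; exact_mod_cast hs)
  rwa [show p - 1 = 2 * h by omega] at this

lemma forcesShort_multiple.{u, v} {h : ℕ} (hp : p = 2 * h + 1) {e : ℕ} (he : 2 ≤ e) :
    ForcesShort.{u, v} p e ((e + 1) * (2 * h) : ℕ) ((e - 1) * (2 * h + 1)) := by
  classical
  intro V _ _ _ hV ι f s hs
  have := hasZeroSum_multiple (p := p) f hV he (s := s)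
    (by rw [hp, Nat.add_sub_cancel]; exact_mod_cast hs)
  rwa [hp] at this

lemma forcesShort_three.{u, v} {h : ℕ} (hp : p = 2 * h + 1) :
    ForcesShort.{u, v} p 3 (9 * h + 1 : ℕ) (3 * h + 1) := by
  classical
  intro V _ _ _ hV ι f s hs
  exact hasZeroSum_three f hp hV (by exact_mod_cast hs)

universe u v

variable {ι : Type v} {V : Type u} [AddCommGroup V] [Module (ZMod p) V]
  [Module.Finite (ZMod p) V]

lemma PackingBound.step_of_forcesShort {f : ι → V} {d e l M : ℕ} {b ε : ℝ}
    (h : PackingBound f b (ε * (p ^ d - 1))) (hV : Module.finrank (ZMod p) V = d)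
    (hF : ForcesShort.{u, v} p e M l) (he : 1 ≤ e) (hl : 1 ≤ l) (hed : e ≤ d) (hb : b ≤ (l : ℝ)⁻¹) :
    PackingBound f (l : ℝ)⁻¹ ((ε + ((l : ℝ)⁻¹ - b) * (M / (p ^ e - 1))) * (p ^ d - 1)) := by
  classical
  have := h.step hl hb (hF.of_le he hl hed V hV ι f)
  convert this using 1
  ring

lemma PackingBound.hasPacking_of_lt {f : ι → V} {d l k : ℕ} {c : ℝ} {s : Finset ι}
    (h : PackingBound f (l : ℝ)⁻¹ c) (hl : l = p) (hc : p * c < p ^ (d - 1) + p - 1)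
    (hs : p * k + p ^ (d - 1) ≤ #s + 1) : HasPacking f s k := by
  subst hl
  have hp : (0 : ℝ) < l := by exact_mod_cast (Fact.out : l.Prime).pos
  refine h.hasPacking ?_
  have hs' : (l : ℝ) * k + l ^ (d - 1) ≤ #s + 1 := by exact_mod_cast hs
  rw [← mul_lt_mul_iff_right₀ hp, mul_sub, mul_sub, mul_inv_cancel_left₀ hp.ne']
  linarith

lemma chain_dim_three {y : ℝ} (hy : 0 ≤ y) {x h : ℝ} (hh : h = y + 1) (hx : x = 2 * h + 1) :
    x * ((0 + ((3 * (2 * h) + 1)⁻¹ - 0) * (3 * (2 * h) / (x ^ 3 - 1))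
      + ((2 * (2 * h + 1))⁻¹ - (3 * (2 * h) + 1)⁻¹) * (4 * (2 * h) / (x ^ 3 - 1))
      + ((3 * h + 1)⁻¹ - (2 * (2 * h + 1))⁻¹) * ((9 * h + 1) / (x ^ 3 - 1))
      + ((2 * h + 1)⁻¹ - (3 * h + 1)⁻¹) * (3 * (2 * h) / (x ^ 2 - 1))) * (x ^ 3 - 1)) <
      x ^ 2 + x - 1 := by
  have h3 : x ^ 3 - 1 = 2 * h * (1 + x + x ^ 2) := by rw [hx]; ring
  have h2 : x ^ 2 - 1 = 2 * h * (1 + x) := by rw [hx]; ring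
  have h0 : 0 < h := by linarith
  rw [h3, h2, ← sub_pos]
  subst hx hh
  field_simp
  ring_nf
  positivity

lemma chain_dim_four {y : ℝ} (hy : 0 ≤ y) {x h : ℝ} (hh : h = y + 1) (hx : x = 2 * h + 1) :
    x * ((0 + ((4 * (2 * h) + 1)⁻¹ - 0) * (4 * (2 * h) / (x ^ 4 - 1))
      + ((3 * (2 * h + 1))⁻¹ - (4 * (2 * h) + 1)⁻¹) * (5 * (2 * h) / (x ^ 4 - 1))
      + ((3 * (2 * h) + 1)⁻¹ - (3 * (2 * h + 1))⁻¹) * (3 * (2 * h) / (x ^ 3 - 1))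
      + ((2 * (2 * h + 1))⁻¹ - (3 * (2 * h) + 1)⁻¹) * (4 * (2 * h) / (x ^ 3 - 1))
      + ((3 * h + 1)⁻¹ - (2 * (2 * h + 1))⁻¹) * ((9 * h + 1) / (x ^ 3 - 1))
      + ((2 * h + 1)⁻¹ - (3 * h + 1)⁻¹) * (3 * (2 * h) / (x ^ 2 - 1))) * (x ^ 4 - 1)) <
      x ^ 3 + x - 1 := by
  have h4 : x ^ 4 - 1 = 2 * h * (1 + x + x ^ 2 + x ^ 3) := by rw [hx]; ring
  have h3 : x ^ 3 - 1 = 2 * h * (1 + x + x ^ 2) := by rw [hx]; ring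
  have h2 : x ^ 2 - 1 = 2 * h * (1 + x) := by rw [hx]; ring
  have h0 : 0 < h := by linarith
  rw [h4, h3, h2, ← sub_pos]
  subst hx hh
  field_simp
  ring_nf
  positivity

lemma chain_dim_ge_five {y : ℝ} (hy : 0 ≤ y) {x h : ℝ} (hh : h = y + 2) (hx : x = 2 * h + 1) :
    0 + ((5 * (2 * h) + 1)⁻¹ - 0) * (5 * (2 * h) / (x ^ 5 - 1))
      + ((4 * (2 * h) + 1)⁻¹ - (5 * (2 * h) + 1)⁻¹) * (4 * (2 * h) / (x ^ 4 - 1))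
      + ((3 * (2 * h + 1))⁻¹ - (4 * (2 * h) + 1)⁻¹) * (5 * (2 * h) / (x ^ 4 - 1))
      + ((3 * (2 * h) + 1)⁻¹ - (3 * (2 * h + 1))⁻¹) * (3 * (2 * h) / (x ^ 3 - 1))
      + ((2 * (2 * h + 1))⁻¹ - (3 * (2 * h) + 1)⁻¹) * (4 * (2 * h) / (x ^ 3 - 1))
      + ((3 * h + 1)⁻¹ - (2 * (2 * h + 1))⁻¹) * ((9 * h + 1) / (x ^ 3 - 1))
      + ((2 * h + 1)⁻¹ - (3 * h + 1)⁻¹) * (3 * (2 * h) / (x ^ 2 - 1)) < 1 / x ^ 2 := by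
  have h5 : x ^ 5 - 1 = 2 * h * (1 + x + x ^ 2 + x ^ 3 + x ^ 4) := by rw [hx]; ring
  have h4 : x ^ 4 - 1 = 2 * h * (1 + x + x ^ 2 + x ^ 3) := by rw [hx]; ring
  have h3 : x ^ 3 - 1 = 2 * h * (1 + x + x ^ 2) := by rw [hx]; ring
  have h2 : x ^ 2 - 1 = 2 * h * (1 + x) := by rw [hx]; ring
  have h0 : 0 < h := by linarith
  rw [h5, h4, h3, h2, ← sub_pos]
  subst hx hh
  field_simp
  ring_nf
  positivity

end OddChain

lemma packingBound_zero_mul {ι V : Type*} [AddCommGroup V] (f : ι → V) (x : ℝ) :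
    PackingBound f 0 (0 * x) := by
  rw [zero_mul]
  exact .zero f

section OddPacking

variable {p : ℕ} [Fact p.Prime] {ι V : Type*} [AddCommGroup V] [Module (ZMod p) V]
  [Module.Finite (ZMod p) V]

lemma natCast_inv_le_inv {a b : ℕ} (hb : 1 ≤ b) (h : b ≤ a) : (a : ℝ)⁻¹ ≤ (b : ℝ)⁻¹ :=
  inv_anti₀ (by exact_mod_cast hb) (by exact_mod_cast h)

lemma hasPacking_dim_three {h : ℕ} (hp : p = 2 * h + 1) (hh : 1 ≤ h)
    (hV : Module.finrank (ZMod p) V = 3) (f : ι → V) (s : Finset ι) (k : ℕ)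
    (hs : p * k + p ^ (3 - 1) ≤ #s + 1) : HasPacking f s k := by
  have b1 := (packingBound_zero_mul f (p ^ 3 - 1)).step_of_forcesShort hV
    (forcesShort_olson hp 3) (by omega) (by omega) (by omega) (by positivity)
  have b2 := b1.step_of_forcesShort hV (forcesShort_multiple hp (e := 3) (by omega))
    (by omega) (by omega) (by omega) (natCast_inv_le_inv (by omega) (by omega))
  have b3 := b2.step_of_forcesShort hV (forcesShort_three hp)
    (by omega) (by omega) (by omega) (natCast_inv_le_inv (by omega) (by omega))
  have b4 := b3.step_of_forcesShort hV (forcesShort_multiple hp (e := 2) (by omega))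
    (by omega) (by omega) (by omega) (natCast_inv_le_inv (by omega) (by omega))
  refine b4.hasPacking_of_lt (by omega) ?_ hs
  have hy : (0 : ℝ) ≤ h - 1 := sub_nonneg.2 (by exact_mod_cast hh)
  have := chain_dim_three hy (x := p) (h := h) (by ring) (by rw [hp]; push_cast; ring)
  convert this using 1
  push_cast
  norm_num

lemma hasPacking_dim_four {h : ℕ} (hp : p = 2 * h + 1) (hh : 1 ≤ h)
    (hV : Module.finrank (ZMod p) V = 4) (f : ι → V) (s : Finset ι) (k : ℕ)
    (hs : p * k + p ^ (4 - 1) ≤ #s + 1) : HasPacking f s k := by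
  have b1 := (packingBound_zero_mul f (p ^ 4 - 1)).step_of_forcesShort hV
    (forcesShort_olson hp 4) (by omega) (by omega) (by omega) (by positivity)
  have b2 := b1.step_of_forcesShort hV (forcesShort_multiple hp (e := 4) (by omega))
    (by omega) (by omega) (by omega) (natCast_inv_le_inv (by omega) (by omega))
  have b3 := b2.step_of_forcesShort hV (forcesShort_olson hp 3)
    (by omega) (by omega) (by omega) (natCast_inv_le_inv (by omega) (by omega))
  have b4 := b3.step_of_forcesShort hV (forcesShort_multiple hp (e := 3) (by omega))
    (by omega) (by omega) (by omega) (natCast_inv_le_inv (by omega) (by omega))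
  have b5 := b4.step_of_forcesShort hV (forcesShort_three hp)
    (by omega) (by omega) (by omega) (natCast_inv_le_inv (by omega) (by omega))
  have b6 := b5.step_of_forcesShort hV (forcesShort_multiple hp (e := 2) (by omega))
    (by omega) (by omega) (by omega) (natCast_inv_le_inv (by omega) (by omega))
  refine b6.hasPacking_of_lt (by omega) ?_ hs
  have hy : (0 : ℝ) ≤ h - 1 := sub_nonneg.2 (by exact_mod_cast hh)
  have := chain_dim_four hy (x := p) (h := h) (by ring) (by rw [hp]; push_cast; ring)
  convert this using 1
  push_cast
  norm_num

lemma hasPacking_dim_ge_five {h d : ℕ} (hp : p = 2 * h + 1) (hh : 2 ≤ h) (hd : 5 ≤ d)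
    (hV : Module.finrank (ZMod p) V = d) (f : ι → V) (s : Finset ι) (k : ℕ)
    (hs : p * k + p ^ (d - 1) ≤ #s + 1) : HasPacking f s k := by
  have b1 := (packingBound_zero_mul f (p ^ d - 1)).step_of_forcesShort hV
    (forcesShort_olson hp 5) (by omega) (by omega) (by omega) (by positivity)
  have b2 := b1.step_of_forcesShort hV (forcesShort_olson hp 4)
    (by omega) (by omega) (by omega) (natCast_inv_le_inv (by omega) (by omega))
  have b3 := b2.step_of_forcesShort hV (forcesShort_multiple hp (e := 4) (by omega))
    (by omega) (by omega) (by omega) (natCast_inv_le_inv (by omega) (by omega))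
  have b4 := b3.step_of_forcesShort hV (forcesShort_olson hp 3)
    (by omega) (by omega) (by omega) (natCast_inv_le_inv (by omega) (by omega))
  have b5 := b4.step_of_forcesShort hV (forcesShort_multiple hp (e := 3) (by omega))
    (by omega) (by omega) (by omega) (natCast_inv_le_inv (by omega) (by omega))
  have b6 := b5.step_of_forcesShort hV (forcesShort_three hp)
    (by omega) (by omega) (by omega) (natCast_inv_le_inv (by omega) (by omega))
  have b7 := b6.step_of_forcesShort hV (forcesShort_multiple hp (e := 2) (by omega))
    (by omega) (by omega) (by omega) (natCast_inv_le_inv (by omega) (by omega))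
  refine b7.hasPacking_of_lt (by omega) ?_ hs
  have hy : (0 : ℝ) ≤ h - 2 := sub_nonneg.2 (by exact_mod_cast hh)
  have key := chain_dim_ge_five hy (x := p) (h := h) (by ring) (by rw [hp]; push_cast; ring)
  have hp1 : (1 : ℝ) < p := by exact_mod_cast (Fact.out : p.Prime).one_lt
  have hpow : 0 < (p : ℝ) ^ d - 1 := sub_pos.2 (one_lt_pow₀ hp1 (by omega))
  have hlt := mul_lt_mul_of_pos_left (mul_lt_mul_of_pos_right key hpow) (zero_lt_one.trans hp1)
  refine lt_of_le_of_lt (le_of_eq ?_) (hlt.trans_le ?_)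
  · push_cast
    norm_num
  · have hd' : (p : ℝ) ^ d = p ^ (d - 1) * p := by rw [← pow_succ, Nat.sub_add_cancel (by omega)]
    rw [hd', show (p : ℝ) * (1 / p ^ 2 * (p ^ (d - 1) * p - 1)) = p ^ (d - 1) - 1 / p by
      field_simp]
    have : 0 ≤ 1 / (p : ℝ) := by positivity
    linarith

end OddPacking

section CharThree

variable {ι V : Type*} [AddCommGroup V] [Module (ZMod 3) V] [Module.Finite (ZMod 3) V]

lemma hasPacking_char_three {d : ℕ} (hd : 5 ≤ d) (hV : Module.finrank (ZMod 3) V = d) (f : ι → V)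
    (s : Finset ι) (k : ℕ) (hs : 3 * k + 3 ^ (d - 1) ≤ #s + 1) : HasPacking f s k := by
  classical
  have b1 := (packingBound_zero_mul f ((3 : ℕ) ^ d - 1)).step_of_forcesShort hV
    (forcesShort_olson (h := 1) (by omega) 5) (by omega) (by omega) (by omega) (by positivity)
  have b2 := b1.step_of_forcesShort hV (forcesShort_olson (h := 1) (by omega) 4)
    (by omega) (by omega) (by omega) (natCast_inv_le_inv (by omega) (by omega))
  have b3 := b2.step_of_forcesShort hV (forcesShort_olson (h := 1) (by omega) 3)
    (by omega) (by omega) (by omega) (natCast_inv_le_inv (by omega) (by omega))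
  have b4 := b3.step_of_forcesShort hV
    (forcesShort_multiple (h := 1) (by omega) (e := 3) (by omega))
    (by omega) (by omega) (by omega) (natCast_inv_le_inv (by omega) (by omega))
  have b5 := b4.step_of_forcesShort hV (forcesShort_three (h := 1) (by omega))
    (by omega) (by omega) (by omega) (natCast_inv_le_inv (by omega) (by omega))
  have : Finite V := Module.finite_of_finite (ZMod 3)
  have hcard : Nat.card V = 3 * 3 ^ (d - 1) := by
    rw [Module.natCard_eq_pow_finrank (K := ZMod 3), hV, Nat.card_zmod, ← pow_succ',
      Nat.sub_add_cancel (by omega)]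
  have htors : ∀ x : V, x + x + x = 0 := fun x => by
    have h := ZModModule.char_nsmul_eq_zero 3 x
    rwa [succ_nsmul, two_nsmul] at h
  have b6 := b5.step (l := 3) (τ := 2 * 3 ^ (d - 1)) (by omega)
    (natCast_inv_le_inv (by omega) (by omega)) (fun s hs => by
      refine hasZeroSum_of_three htors f s ?_
      have : 2 * 3 ^ (d - 1) < #s := by exact_mod_cast hs
      omega)
  refine b6.hasPacking_of_lt (p := 3) rfl ?_ hs
  have hd' : (3 : ℝ) ^ d = 3 ^ (d - 1) * 3 := by rw [← pow_succ, Nat.sub_add_cancel (by omega)]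
  push_cast
  rw [hd']
  have : (0 : ℝ) < 3 ^ (d - 1) := by positivity
  norm_num
  linarith

end CharThree

/-- In dimension `d ≥ 2`, a sequence of length at least `p * k + p ^ (d - 1) - 1` contains `k`
disjoint nonempty zero-sum subsequences. -/
lemma hasPacking_of_finrank {p : ℕ} [Fact p.Prime] {ι V : Type*} [AddCommGroup V]
    [Finite V] [Module (ZMod p) V] {d : ℕ} (hd : 2 ≤ d)
    (hV : Module.finrank (ZMod p) V = d) (f : ι → V) (s : Finset ι) (k : ℕ)
    (hs : p * k + p ^ (d - 1) ≤ #s + 1) : HasPacking f s k := by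
  classical
  have : Module.Finite (ZMod p) V := .of_finite
  have hprime : p.Prime := Fact.out
  rcases hd.eq_or_lt with rfl | hd3
  · exact hasPacking_plane (p := p) hV f s k (by simpa using hs)
  rcases hprime.eq_two_or_odd' with rfl | ⟨h, hp⟩
  · refine hasPacking_two (fun x => ?_) f s k ?_
    · have h := ZModModule.char_nsmul_eq_zero 2 x
      rwa [two_nsmul] at h
    · have hcard : Nat.card V = 2 * 2 ^ (d - 1) := by
        rw [Module.natCard_eq_pow_finrank (K := ZMod 2), hV, Nat.card_zmod, ← pow_succ',
          Nat.sub_add_cancel (by omega)]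
      omega
  have hh : 1 ≤ h := by
    have := hprime.one_lt
    omega
  obtain rfl | rfl | hd5 : d = 3 ∨ d = 4 ∨ 5 ≤ d := by omega
  · exact hasPacking_dim_three hp hh hV f s k hs
  · exact hasPacking_dim_four hp hh hV f s k hs
  rcases hh.eq_or_lt with rfl | hh2
  · subst hp
    exact hasPacking_char_three hd5 hV f s k hs
  · exact hasPacking_dim_ge_five hp hh2 hd5 hV f s k hs

lemma exists_zeroSum_of_card_le {ι G : Type*} [AddCommGroup G] [Finite G] (f : ι → G)
    (s : Finset ι) (hs : Nat.card G ≤ #s) : ∃ t ⊆ s, t.Nonempty ∧ ∑ i ∈ t, f i = 0 := by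
  classical
  have := Fintype.ofFinite G
  rw [Nat.card_eq_fintype_card] at hs
  let e := s.equivFin.symm
  let I : Fin (#s + 1) → Finset (Fin #s) := fun m => {j | j.val < m.val}
  let P : Fin (#s + 1) → G := fun m => ∑ j ∈ I m, f (e j)
  obtain ⟨a, b, hab, hP⟩ : ∃ a b, a < b ∧ P a = P b := by
    obtain ⟨a, b, hne, hP⟩ := Fintype.exists_ne_map_eq_of_card_lt P (by
      rw [Fintype.card_fin]; omega)
    rcases hne.lt_or_gt with h | h
    exacts [⟨a, b, h, hP⟩, ⟨b, a, h, hP.symm⟩]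
  have hsub : I a ⊆ I b := fun j hj =>
    mem_filter.2 ⟨mem_univ j, (mem_filter.1 hj).2.trans hab⟩
  refine ⟨(I b \ I a).map (e.toEmbedding.trans (.subtype _)), ?_, ?_, ?_⟩
  · intro i hi
    obtain ⟨j, -, rfl⟩ := mem_map.1 hi
    exact (e j).2
  · rw [map_nonempty]
    refine ⟨⟨a, by omega⟩, ?_⟩
    simpa [I] using hab
  · rw [sum_map]
    have := sum_sdiff hsub (f := fun j => f (e j))
    change _ + P a = P b at this
    rw [hP] at this
    exact left_eq_add.1 (this.symm.trans (add_comm _ _))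

section Torsion

variable {G : Type*} [AddCommGroup G]

lemma card_nsmul_eq_zero_le [Fintype G] [DecidableEq G]
    (h : ∀ p : ℕ, p.Prime → #{x : G | p • x = 0} ≤ p) (n : ℕ) (hn : 0 < n) :
    #{x : G | n • x = 0} ≤ n := by
  induction n using induction_on_primes with
  | zero => omega
  | one =>
    simp only [one_nsmul]
    exact card_le_one.2 (by simp +contextual)
  | prime_mul p a hp ih =>
    have ha := ih (Nat.pos_of_mul_pos_left hn)
    refine (card_le_mul_card_image_of_maps_to (f := fun x : G => p • x)
      (t := {x : G | a • x = 0}) ?_ p ?_).trans (Nat.mul_le_mul_left p ha)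
    · intro x hx
      simp only [mem_filter, mem_univ, true_and] at hx ⊢
      rw [← mul_nsmul, hx]
    · intro b _
      refine le_trans ?_ (h p hp)
      rcases (filter (fun x : G => p • x = b) {x : G | (p * a) • x = 0}).eq_empty_or_nonempty
        with h0 | ⟨x₀, hx₀⟩
      · simp [h0]
      · refine card_le_card_of_injOn (fun x => x - x₀) ?_ (sub_left_injective.injOn)
        intro x hx
        simp only [coe_filter, mem_filter, mem_univ, true_and, Set.mem_ofPred_eq] at hx hx₀ ⊢
        rw [nsmul_sub, hx.2, hx₀.2, sub_self]

lemma exists_prime_lt_card_of_not_isAddCyclic [Finite G] (h : ¬ IsAddCyclic G) :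
    ∃ p : ℕ, p.Prime ∧ p < Nat.card (nsmulAddMonoidHom (α := G) p).ker := by
  classical
  have := Fintype.ofFinite G
  by_contra! hcon
  refine h (isAddCyclic_of_card_nsmul_eq_zero_le (card_nsmul_eq_zero_le fun p hp => ?_))
  refine le_trans (le_of_eq ?_) (hcon p hp)
  rw [Nat.card_eq_fintype_card, Fintype.card_subtype]
  refine congrArg card (filter_congr fun x _ => ?_)
  exact (AddMonoidHom.mem_ker (f := nsmulAddMonoidHom (α := G) p)).symm

lemma card_quotient_nsmul_range [Finite G] (n : ℕ) :
    Nat.card (G ⧸ (nsmulAddMonoidHom (α := G) n).range) =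
      Nat.card (nsmulAddMonoidHom (α := G) n).ker := by
  have h1 := AddSubgroup.card_mul_index (nsmulAddMonoidHom (α := G) n).ker
  have h2 := AddSubgroup.card_mul_index (nsmulAddMonoidHom (α := G) n).range
  rw [AddSubgroup.index_ker, ← h2, mul_comm] at h1
  exact (Nat.eq_of_mul_eq_mul_left Nat.card_pos h1).symm

lemma exponent_nsmul_range [Finite G] {p : ℕ} (hp : p.Prime)
    (hker : 1 < Nat.card (nsmulAddMonoidHom (α := G) p).ker) :
    AddMonoid.exponent G = p * AddMonoid.exponent (nsmulAddMonoidHom (α := G) p).range := by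
  refine Nat.dvd_antisymm (AddMonoid.exponent_dvd_of_forall_nsmul_eq_zero fun g => ?_) ?_
  · have := AddMonoid.exponent_nsmul_eq_zero
      (⟨p • g, g, rfl⟩ : (nsmulAddMonoidHom (α := G) p).range)
    rw [mul_nsmul]
    simpa using congrArg Subtype.val this
  · obtain ⟨n, hn⟩ : p ∣ AddMonoid.exponent G := by
      have := (Finite.one_lt_card_iff_nontrivial).1 hker
      obtain ⟨x, hx⟩ := exists_ne (0 : (nsmulAddMonoidHom (α := G) p).ker)
      have hxp : addOrderOf (x : G) = p :=
        addOrderOf_eq_prime_iff (hp := ⟨hp⟩) |>.2 ⟨x.2, by simpa using hx⟩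
      exact hxp ▸ AddMonoid.addOrder_dvd_exponent _
    rw [hn]
    refine mul_dvd_mul_left p (AddMonoid.exponent_dvd_of_forall_nsmul_eq_zero ?_)
    rintro ⟨_, g, rfl⟩
    refine Subtype.ext ?_
    change n • p • g = 0
    rw [← mul_nsmul, ← hn, AddMonoid.exponent_nsmul_eq_zero]

end Torsion

lemma natCard_eq_pow_finrank_zmod (p : ℕ) [Fact p.Prime] (V : Type*) [AddCommGroup V] [Finite V]
    [Module (ZMod p) V] : Nat.card V = p ^ Module.finrank (ZMod p) V := by
  have := Module.natCard_eq_pow_finrank (K := ZMod p) (V := V)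
  rwa [Nat.card_zmod] at this

/-- A sequence of length at least `exp G + |G| / exp G - 1` has a nonempty zero-sum subsequence. -/
theorem exists_zeroSum_of_exponent_add_le.{u, v} (N : ℕ) :
    ∀ (G : Type u) [AddCommGroup G] [Finite G] (ι : Type v) (f : ι → G) (s : Finset ι) (m : ℕ),
      Nat.card G = N → Nat.card G = AddMonoid.exponent G * m →
      AddMonoid.exponent G + m ≤ #s + 1 → ∃ t ⊆ s, t.Nonempty ∧ ∑ i ∈ t, f i = 0 := by
  classical
  induction N using Nat.strong_induction_on with
  | _ N ih =>
  intro G _ _ ι f s m hN hm hs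
  by_cases hcyc : IsAddCyclic G
  · refine exists_zeroSum_of_card_le f s ?_
    rw [IsAddCyclic.exponent_eq_card] at hm hs
    have hpos : 0 < Nat.card G := Nat.card_pos
    have : m = 1 := by nlinarith
    omega
  obtain ⟨p, hp, hlt⟩ := exists_prime_lt_card_of_not_isAddCyclic hcyc
  have := Fact.mk hp
  have hn := exponent_nsmul_range hp (hp.one_lt.trans hlt)
  have hV := card_quotient_nsmul_range (G := G) p
  have hGK := AddSubgroup.card_eq_card_quotient_mul_card_addSubgroup
    (nsmulAddMonoidHom (α := G) p).range
  rw [← hV] at hlt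
  generalize hK : (nsmulAddMonoidHom (α := G) p).range = K at *
  have hmem : ∀ x : G, p • x ∈ K := fun x => hK ▸ ⟨x, rfl⟩
  let inst : Module (ZMod p) (G ⧸ K) := QuotientAddGroup.zmodModule hmem
  have hcard := natCard_eq_pow_finrank_zmod p (G ⧸ K)
  obtain ⟨d, hd⟩ : ∃ d, Module.finrank (ZMod p) (G ⧸ K) = d + 1 + 1 := by
    refine ⟨Module.finrank (ZMod p) (G ⧸ K) - 2, ?_⟩
    rw [hcard] at hlt
    have : 1 < Module.finrank (ZMod p) (G ⧸ K) := by
      rwa [← Nat.pow_lt_pow_iff_right hp.one_lt, pow_one]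
    omega
  rw [hd, pow_succ] at hcard
  obtain ⟨m', hm'⟩ : AddMonoid.exponent K ∣ Nat.card K := AddGroup.exponent_dvd_nat_card
  have hKpos : 0 < Nat.card K := Nat.card_pos
  have hepos : 0 < AddMonoid.exponent K := Nat.pos_of_ne_zero fun h => by simp [h] at hm'; omega
  have hm'pos : 0 < m' := Nat.pos_of_ne_zero fun h => by simp [h] at hm'; omega
  have hmm : m = p ^ (d + 1) * m' := by
    rw [hGK, hcard, hn, hm'] at hm
    refine Nat.eq_of_mul_eq_mul_left (Nat.mul_pos hp.pos hepos) ?_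
    rw [← hm]
    ring
  have hpp : p ≤ p ^ (d + 1) := Nat.le_self_pow (by omega) p
  obtain ⟨P, hPcard, hP, hPd⟩ := hasPacking_of_finrank (p := p) (by omega) hd
    (fun i => (QuotientAddGroup.mk (f i) : G ⧸ K)) s (AddMonoid.exponent K + m' - 1) (by
      obtain ⟨r, rfl⟩ : ∃ r, m' = r + 1 := ⟨m' - 1, by omega⟩
      refine le_trans ?_ hs
      rw [hn, hmm, ← add_assoc, Nat.add_sub_cancel, Nat.add_sub_cancel]
      nlinarith)
  have hPK : ∀ t ∈ P, ∑ i ∈ t, f i ∈ K := fun t ht => by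
    have := (hP t ht).2.2
    rw [← QuotientAddGroup.eq_zero_iff, ← this]
    exact map_sum (QuotientAddGroup.mk' K) f t
  let F : Finset ι → K := fun t => if h : ∑ i ∈ t, f i ∈ K then ⟨_, h⟩ else 0
  have hlt' : Nat.card K < N := by
    rw [← hN, hGK]
    exact (Nat.lt_mul_iff_one_lt_left hKpos).2 (hp.one_lt.trans hlt)
  obtain ⟨T, hT, hTne, hTsum⟩ := ih _ hlt' K (Finset ι) F P m' rfl hm' (by omega)
  refine ⟨T.biUnion id, biUnion_subset.2 fun t ht => (hP t (hT ht)).1, ?_, ?_⟩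
  · obtain ⟨t, ht⟩ := hTne
    exact biUnion_nonempty.2 ⟨t, ht, (hP t (hT ht)).2.1⟩
  · rw [sum_biUnion (hPd.subset (by exact_mod_cast hT))]
    have := congrArg K.subtype hTsum
    rw [map_sum, map_zero] at this
    rw [← this]
    refine sum_congr rfl fun t ht => ?_
    simp [F, hPK t (hT ht)]

end Davenport

theorem davenport_le_of_large_exponent (G : Type*) [AddCommGroup G] [Fintype G]
    (h : Real.sqrt (Fintype.card G) ≤ (AddMonoid.exponent G : ℝ)) :
    davenportConstant G ≤
      AddMonoid.exponent G + Fintype.card G / AddMonoid.exponent G - 1 := by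
  refine Nat.sInf_le fun S hS => ?_
  obtain ⟨m, hm⟩ : AddMonoid.exponent G ∣ Nat.card G := AddGroup.exponent_dvd_nat_card
  have hpos : 0 < Nat.card G := Nat.card_pos
  have hepos : 0 < AddMonoid.exponent G :=
    Nat.pos_of_ne_zero fun h => by simp [h] at hm
  rw [← Nat.card_eq_fintype_card, hm, Nat.mul_div_cancel_left _ hepos] at hS
  obtain ⟨l, rfl⟩ := Quot.exists_rep S
  obtain ⟨t, -, hne, hsum⟩ := Davenport.exists_zeroSum_of_exponent_add_le (Nat.card G) G
    (Fin l.length) l.get Finset.univ m rfl hm (by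
      rw [Finset.card_univ, Fintype.card_fin]
      change l.length = _ at hS
      omega)
  refine ⟨t.val.map l.get, ?_, ?_, hsum⟩
  · refine (Multiset.map_le_map (Finset.val_le_iff.2 t.subset_univ)).trans (le_of_eq ?_)
    simp [Fin.univ_val_map]
  · simpa using hne.ne_empty
end

section
/- Let G be a finite abelian group with exp(G) < √|G|. Then the Davenport constant satisfies D(G) ≤ 2·√|G| − 1 (i.e., D(G) ≤ 2·Real.sqrt(|G|) − 1, equivalently (D(G)+1)² ≤ 4·|G|). -/
universe u

namespace Davenport

/-- `S` contains `k` disjoint nonempty zero-sum submultisets. -/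
def HasBlocks {G : Type*} [AddCommGroup G] (k : ℕ) (S : Multiset G) : Prop :=
  ∃ F : Multiset (Multiset G), F.card = k ∧ (∀ T ∈ F, T ≠ 0 ∧ T.sum = 0) ∧ F.sum ≤ S

/-- Every multiset with at least `L` elements contains `k` disjoint nonempty zero-sum
submultisets. -/
def DavLE (G : Type*) [AddCommGroup G] (k L : ℕ) : Prop :=
  ∀ S : Multiset G, L ≤ S.card → HasBlocks k S

/-- Every multiset with more than `θ` elements contains a nonempty zero-sum submultiset with at
most `ℓ` elements. -/
def Short (G : Type*) [AddCommGroup G] (θ : ℝ) (ℓ : ℕ) : Prop :=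
  ∀ S : Multiset G, θ < S.card → ∃ T ≤ S, T ≠ 0 ∧ T.sum = 0 ∧ T.card ≤ ℓ

/-- Every multiset with more than `ℓ (k - 1) + b` elements contains `k` disjoint nonempty
zero-sum submultisets. -/
def Good (G : Type*) [AddCommGroup G] (ℓ : ℕ) (b : ℝ) : Prop :=
  ∀ (k : ℕ) (S : Multiset G), ℓ * ((k : ℝ) - 1) + b < S.card → HasBlocks k S

section Blocks

variable {G : Type*} [AddCommGroup G]

theorem hasBlocks_zero (S : Multiset G) : HasBlocks 0 S :=
  ⟨0, by simp⟩

theorem HasBlocks.cons {k : ℕ} {T R : Multiset G} (h : HasBlocks k R) (hT : T ≠ 0)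
    (hs : T.sum = 0) : HasBlocks (k + 1) (T + R) := by
  obtain ⟨F, h1, h2, h3⟩ := h
  refine ⟨T ::ₘ F, by simp [h1], ?_, ?_⟩
  · intro U hU
    rcases Multiset.mem_cons.1 hU with rfl | hU
    · exact ⟨hT, hs⟩
    · exact h2 U hU
  · rw [Multiset.sum_cons]
    exact Multiset.add_le_add_iff_left.2 h3

theorem DavLE.exists_block {L : ℕ} (h : DavLE G 1 L) {S : Multiset G} (hS : L ≤ S.card) :
    ∃ T ≤ S, T ≠ 0 ∧ T.sum = 0 := by
  obtain ⟨F, h1, h2, h3⟩ := h S hS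
  obtain ⟨T, rfl⟩ := Multiset.card_eq_one.1 h1
  exact ⟨T, by simpa using h3, h2 T (by simp)⟩

theorem hasBlocks_one {S T : Multiset G} (h : T ≤ S) (h0 : T ≠ 0) (hs : T.sum = 0) :
    HasBlocks 1 S :=
  ⟨{T}, by simp, by simpa using ⟨h0, hs⟩, by simpa using h⟩

theorem exists_map_eq_of_le_map {α β : Type*} (f : α → β) {S : Multiset α} {T : Multiset β}
    (h : T ≤ S.map f) : ∃ U ≤ S, U.map f = T := by
  induction S using Quotient.inductionOn
  induction T using Quotient.inductionOn
  rename_i s t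
  simp only [Multiset.quot_mk_to_coe, Multiset.map_coe, Multiset.coe_le] at h ⊢
  obtain ⟨t', ht', hs⟩ := h
  obtain ⟨u, hu, rfl⟩ := List.sublist_map_iff.1 hs
  exact ⟨u, Multiset.coe_le.2 hu.subperm, by simpa using ht'⟩

theorem exists_map_map_eq_of_sum_le_map {α β : Type*} (f : α → β) (F' : Multiset (Multiset β)) :
    ∀ {S : Multiset α}, F'.sum ≤ S.map f →
      ∃ F : Multiset (Multiset α), F.map (Multiset.map f) = F' ∧ F.sum ≤ S := by
  induction F' using Multiset.induction with
  | empty => intro S _; exact ⟨0, by simp⟩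
  | cons T F' ih =>
    intro S h
    rw [Multiset.sum_cons] at h
    obtain ⟨U, hU, hUT⟩ := exists_map_eq_of_le_map f ((Multiset.le_add_right T _).trans h)
    obtain ⟨R, rfl⟩ := Multiset.le_iff_exists_add.1 hU
    rw [Multiset.map_add, hUT, Multiset.add_le_add_iff_left] at h
    obtain ⟨F, hF, hFR⟩ := ih h
    exact ⟨U ::ₘ F, by simp [hUT, hF], by simpa using hFR⟩

theorem DavLE.comp {Q : Type*} [AddCommGroup Q] (φ : G →+ Q) {k k' L : ℕ}
    (hK : DavLE φ.ker k k') (hQ : DavLE Q k' L) : DavLE G k L := by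
  intro S hS
  obtain ⟨F', h1, h2, h3⟩ := hQ (S.map φ) (by simpa using hS)
  obtain ⟨F, rfl, hFS⟩ := exists_map_map_eq_of_sum_le_map φ F' h3
  have hF : ∀ T ∈ F, T ≠ 0 ∧ T.sum ∈ φ.ker := by
    intro T hT
    obtain ⟨h4, h5⟩ := h2 _ (Multiset.mem_map_of_mem _ hT)
    refine ⟨by rintro rfl; simp at h4, ?_⟩
    rw [AddMonoidHom.mem_ker, map_multiset_sum, h5]
  obtain ⟨W, hW⟩ : ∃ W : Multiset φ.ker, W.map Subtype.val = F.map Multiset.sum := by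
    lift F.map Multiset.sum to Multiset φ.ker with W hW
    · intro x hx
      obtain ⟨T, hT, rfl⟩ := Multiset.mem_map.1 hx
      exact (hF T hT).2
    exact ⟨W, rfl⟩
  have hWc : W.card = k' := by
    have := congrArg Multiset.card hW
    simp only [Multiset.card_map] at this h1
    omega
  obtain ⟨F2, g1, g2, g3⟩ := hK W hWc.ge
  have g4 : (F2.map (Multiset.map Subtype.val)).sum ≤ F.map Multiset.sum := by
    rw [← hW]
    have : (F2.map (Multiset.map (Subtype.val : φ.ker → G))).sum = F2.sum.map Subtype.val := by
      have := map_multiset_sum (Multiset.mapAddMonoidHom (Subtype.val : φ.ker → G)) F2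
      simpa using this.symm
    rw [this]
    exact Multiset.map_le_map g3
  obtain ⟨F3, e1, e2⟩ := exists_map_map_eq_of_sum_le_map Multiset.sum _ g4
  refine ⟨F3.map Multiset.sum, ?_, ?_, ?_⟩
  · have := congrArg Multiset.card e1
    simpa [g1] using this
  · intro T hT
    obtain ⟨U, hU, rfl⟩ := Multiset.mem_map.1 hT
    have hUm : U.map Multiset.sum ∈ F2.map (Multiset.map (Subtype.val : φ.ker → G)) := by
      rw [← e1]; exact Multiset.mem_map_of_mem _ hU
    obtain ⟨B, hB, hBU⟩ := Multiset.mem_map.1 hUm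
    obtain ⟨hB0, hBs⟩ := g2 B hB
    have hUF : U ≤ F := (Multiset.le_sum_of_mem hU).trans e2
    constructor
    · have hU0 : U ≠ 0 := by
        rintro rfl
        simp at hBU
        exact hB0 hBU
      obtain ⟨T, hT⟩ := Multiset.exists_mem_of_ne_zero hU0
      intro h0
      have := Multiset.le_sum_of_mem hT
      rw [h0] at this
      exact (hF T (Multiset.mem_of_le hUF hT)).1 (Multiset.le_zero.1 this)
    · have h5 : U.sum.sum = (U.map Multiset.sum).sum := by
        have := map_multiset_sum (Multiset.sumAddMonoidHom : Multiset G →+ G) U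
        simpa using this
      rw [h5, ← hBU]
      have := map_multiset_sum φ.ker.subtype B
      rw [hBs] at this
      simpa using this.symm
  · refine le_trans ?_ hFS
    obtain ⟨R, rfl⟩ := Multiset.le_iff_exists_add.1 e2
    have h5 : F3.sum.sum = (F3.map Multiset.sum).sum := by
      have := map_multiset_sum (Multiset.sumAddMonoidHom : Multiset (Multiset G) →+ Multiset G) F3
      simpa using this
    rw [Multiset.sum_add, h5]
    exact Multiset.le_add_right _ _

end Blocks

section Good

variable {G : Type*} [AddCommGroup G]

theorem Short.good_step {θ b b' : ℝ} {ℓ ℓ' : ℕ} (hs : Short G θ ℓ) (hg : Good G ℓ' b')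
    (hℓ : 0 < ℓ) (hℓ' : ℓ ≤ ℓ') (hb : (θ - b) * ℓ' ≤ (θ - b') * ℓ) : Good G ℓ b := by
  intro k
  induction k with
  | zero => intro S _; exact hasBlocks_zero S
  | succ k ih =>
    intro S hS
    by_cases hθ : θ < S.card
    · obtain ⟨T, hTS, hT0, hT1, hTc⟩ := hs S hθ
      obtain ⟨R, rfl⟩ := Multiset.le_iff_exists_add.1 hTS
      refine (ih R ?_).cons hT0 hT1
      have : (T.card : ℝ) ≤ ℓ := by exact_mod_cast hTc
      push_cast [Multiset.card_add] at hS
      nlinarith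
    · refine hg (k + 1) S ?_
      push Not at hθ
      have h1 : (0 : ℝ) < ℓ := by exact_mod_cast hℓ
      have h2 : (ℓ : ℝ) ≤ ℓ' := by exact_mod_cast hℓ'
      push_cast at hS ⊢
      rw [add_sub_cancel_right] at *
      have h3 : (k : ℝ) * ℓ < S.card - b := by linarith
      have h4 : (k : ℝ) * ℓ * ℓ' < (S.card - b) * ℓ' := by
        apply mul_lt_mul_of_pos_right h3; linarith
      have h5 : (S.card - b) * (ℓ' : ℝ) ≤ (S.card - b') * ℓ := by
        nlinarith
      nlinarith

theorem Short.good {θ : ℝ} {ℓ : ℕ} (hs : Short G θ ℓ) : Good G ℓ θ := by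
  intro k
  induction k with
  | zero => intro S _; exact hasBlocks_zero S
  | succ k ih =>
    intro S hS
    push_cast at hS
    have : θ < S.card := by nlinarith [(by positivity : (0 : ℝ) ≤ ℓ * k)]
    obtain ⟨T, hTS, hT0, hT1, hTc⟩ := hs S this
    obtain ⟨R, rfl⟩ := Multiset.le_iff_exists_add.1 hTS
    refine (ih R ?_).cons hT0 hT1
    have : (T.card : ℝ) ≤ ℓ := by exact_mod_cast hTc
    push_cast [Multiset.card_add] at hS
    nlinarith

theorem Good.davLE {ℓ k L : ℕ} {b : ℝ} (h : Good G ℓ b) (hL : ℓ * ((k : ℝ) - 1) + b < L) :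
    DavLE G k L :=
  fun S hS => h k S (hL.trans_le (by exact_mod_cast hS))

/-- Passing from `Good` to `DavLE` with a controlled length. -/
theorem Good.exists_davLE {ℓ k : ℕ} {b : ℝ} (h : Good G ℓ b) (hk : 1 ≤ k) (hb : 0 ≤ b) :
    ∃ L : ℕ, DavLE G k L ∧ (L : ℝ) + 1 ≤ ℓ * k + (b + 2 - ℓ) := by
  have hk' : (1 : ℝ) ≤ k := by exact_mod_cast hk
  have h0 : 0 ≤ ℓ * ((k : ℝ) - 1) + b := by
    have : (0 : ℝ) ≤ ℓ := by positivity
    nlinarith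
  refine ⟨⌊ℓ * ((k : ℝ) - 1) + b⌋₊ + 1, h.davLE (by exact_mod_cast Nat.lt_floor_add_one _), ?_⟩
  have := Nat.floor_le h0
  push_cast
  linarith

end Good

section ChevalleyWarning

open MvPolynomial

theorem sum_neg_one_pow_mul_eval_indicator {ι R : Type*} [Fintype ι] [DecidableEq ι] [CommRing R]
    (Q : MvPolynomial ι R) (hQ : Q.totalDegree < Fintype.card ι) :
    ∑ T : Finset ι, (-1 : R) ^ T.card * eval (fun i => if i ∈ T then (1 : R) else 0) Q = 0 := by
  simp_rw [eval_eq', Finset.mul_sum]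
  rw [Finset.sum_comm]
  refine Finset.sum_eq_zero fun s hs => ?_
  obtain ⟨i, hi⟩ : ∃ i, s i = 0 := by
    by_contra! hne
    have h1 : s.support = Finset.univ := by
      ext i; simpa using hne i
    have h2 := le_totalDegree hs
    have h3 : s.support.card ≤ s.sum fun _ e => e := by
      rw [Finset.card_eq_sum_ones, Finsupp.sum]
      exact Finset.sum_le_sum fun i _ => Nat.one_le_iff_ne_zero.2 (hne i)
    rw [h1, Finset.card_univ] at h3
    omega
  have h4 : ∏ j : ι, ((-1 : R) + 0 ^ s j) = 0 :=
    Finset.prod_eq_zero (Finset.mem_univ i) (by simp [hi])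
  rw [Finset.prod_add] at h4
  rw [Finset.powerset_univ] at h4
  have h5 : ∀ T : Finset ι, (-1 : R) ^ T.card * (coeff s Q *
      ∏ j, (if j ∈ T then (1 : R) else 0) ^ s j) =
      coeff s Q * ((∏ _j ∈ T, (-1 : R)) * ∏ j ∈ Finset.univ \ T, (0 : R) ^ s j) := by
    intro T
    have h6 : ∏ j, (if j ∈ T then (1 : R) else 0) ^ s j = ∏ j ∈ Finset.univ \ T, (0 : R) ^ s j := by
      rw [← Finset.prod_sdiff (Finset.subset_univ T)]
      rw [Finset.prod_eq_one (s := T), mul_one]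
      · exact Finset.prod_congr rfl fun j hj => by simp [(Finset.mem_sdiff.1 hj).2]
      · intro j hj; simp [hj]
    rw [h6, Finset.prod_const]; ring
  simp_rw [h5]
  rw [← Finset.mul_sum, h4, mul_zero]

/-- On subsets `T` of a finite set, `f T.card` is given by a polynomial of total degree at
most `D` in the indicator of `T`. -/
def DegLE (p D : ℕ) (f : ℕ → ZMod p) : Prop :=
  ∀ m : ℕ, ∃ Q : MvPolynomial (Fin m) (ZMod p), Q.totalDegree ≤ D ∧
    ∀ T : Finset (Fin m), eval (fun i => if i ∈ T then (1 : ZMod p) else 0) Q = f T.card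

variable {p : ℕ}

theorem degLE_const [Fact p.Prime] (c : ZMod p) : DegLE p 0 fun _ => c :=
  fun _ => ⟨C c, by simp, by simp⟩

theorem degLE_choose [Fact p.Prime] (k : ℕ) : DegLE p k fun x => (x.choose k : ZMod p) := by
  intro m
  refine ⟨∑ U ∈ Finset.powersetCard k Finset.univ, ∏ i ∈ U, X i, ?_, ?_⟩
  · refine totalDegree_finsetSum_le fun U hU => ?_
    refine (totalDegree_finsetProd _ _).trans ?_
    simp [(Finset.mem_powersetCard.1 hU).2]
  · intro T
    simp only [map_sum, map_prod, eval_X]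
    rw [← Finset.card_powersetCard, Finset.cast_card]
    rw [← Finset.sum_subset (Finset.powersetCard_mono (Finset.subset_univ T))]
    · refine Finset.sum_congr rfl fun U hU => ?_
      exact Finset.prod_eq_one fun i hi => if_pos ((Finset.mem_powersetCard.1 hU).1 hi)
    · intro U hU hU'
      obtain ⟨i, hi, hiT⟩ : ∃ i ∈ U, i ∉ T := by
        by_contra! hne
        exact hU' (Finset.mem_powersetCard.2 ⟨hne, (Finset.mem_powersetCard.1 hU).2⟩)
      exact Finset.prod_eq_zero hi (if_neg hiT)

theorem degLE_natCast [Fact p.Prime] : DegLE p 1 fun x => (x : ZMod p) := by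
  simpa using degLE_choose (p := p) 1

theorem DegLE.mul {D D' : ℕ} {f g : ℕ → ZMod p} (hf : DegLE p D f) (hg : DegLE p D' g) :
    DegLE p (D + D') fun x => f x * g x := by
  intro m
  obtain ⟨P, h1, h2⟩ := hf m
  obtain ⟨Q, h3, h4⟩ := hg m
  exact ⟨P * Q, (totalDegree_mul _ _).trans (add_le_add h1 h3), fun T => by simp [h2, h4]⟩

theorem DegLE.sub {D : ℕ} {f g : ℕ → ZMod p} (hf : DegLE p D f) (hg : DegLE p D g) :
    DegLE p D fun x => f x - g x := by
  intro m
  obtain ⟨P, h1, h2⟩ := hf m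
  obtain ⟨Q, h3, h4⟩ := hg m
  exact ⟨P - Q, (totalDegree_sub _ _).trans (max_le h1 h3), fun T => by simp [h2, h4]⟩

theorem DegLE.mono {D D' : ℕ} {f : ℕ → ZMod p} (hf : DegLE p D f) (h : D ≤ D') :
    DegLE p D' f := fun m => by
  obtain ⟨P, h1, h2⟩ := hf m
  exact ⟨P, h1.trans h, h2⟩

theorem DegLE.pow {D : ℕ} {f : ℕ → ZMod p} (hf : DegLE p D f) (k : ℕ) :
    DegLE p (k * D) fun x => f x ^ k := by
  intro m
  obtain ⟨P, h1, h2⟩ := hf m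
  exact ⟨P ^ k, (totalDegree_pow _ _).trans (Nat.mul_le_mul_left _ h1), fun T => by simp [h2]⟩

variable [Fact p.Prime] {V : Type*} [AddCommGroup V] [Module (ZMod p) V]
  [Module.Finite (ZMod p) V]

theorem exists_zero_sum_of_degLE {D : ℕ} {f : ℕ → ZMod p} (hf : DegLE p D f) (h0 : f 0 ≠ 0)
    (S : Multiset V) (hS : Module.finrank (ZMod p) V * (p - 1) + D < S.card) :
    ∃ T ≤ S, T ≠ 0 ∧ T.sum = 0 ∧ f T.card ≠ 0 := by
  classical
  obtain ⟨m, g, rfl⟩ : ∃ (m : ℕ) (g : Fin m → V), S = Finset.univ.val.map g := by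
    refine ⟨S.toList.length, S.toList.get, ?_⟩
    conv_lhs => rw [← S.coe_toList, ← List.ofFn_get S.toList]
    simp
  have hm : Module.finrank (ZMod p) V * (p - 1) + D < m := by simpa using hS
  have key : ∃ T : Finset (Fin m), T ≠ ∅ ∧ ∑ i ∈ T, g i = 0 ∧ f T.card ≠ 0 := by
    by_contra! hne
    obtain ⟨P, hP, hPe⟩ := hf m
    let b := Module.finBasis (ZMod p) V
    let lin : Fin (Module.finrank (ZMod p) V) → MvPolynomial (Fin m) (ZMod p) :=
      fun c => ∑ i, C (b.repr (g i) c) * X i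
    have hlin : ∀ c (T : Finset (Fin m)),
        eval (fun i => if i ∈ T then (1 : ZMod p) else 0) (lin c) = b.repr (∑ i ∈ T, g i) c := by
      intro c T
      simp [lin, map_sum, Finset.sum_ite_mem]
    have hdeg : ∀ c, (1 - lin c ^ (p - 1)).totalDegree ≤ p - 1 := by
      intro c
      refine (totalDegree_sub _ _).trans (max_le (by simp) ?_)
      refine (totalDegree_pow _ _).trans ?_
      have : (lin c).totalDegree ≤ 1 := by
        refine totalDegree_finsetSum_le fun i _ => ?_
        refine (totalDegree_mul _ _).trans ?_
        simp
      calc _ ≤ (p - 1) * 1 := Nat.mul_le_mul_left _ this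
        _ = _ := mul_one _
    let Q := (∏ c, (1 - lin c ^ (p - 1))) * P
    have hQ : Q.totalDegree < Fintype.card (Fin m) := by
      refine lt_of_le_of_lt (totalDegree_mul _ _) ?_
      have h1 : (∏ c, (1 - lin c ^ (p - 1))).totalDegree ≤
          Module.finrank (ZMod p) V * (p - 1) := by
        refine (totalDegree_finsetProd _ _).trans ?_
        refine (Finset.sum_le_sum fun c _ => hdeg c).trans ?_
        simp
      rw [Fintype.card_fin]
      omega
    have hsum := sum_neg_one_pow_mul_eval_indicator Q hQ
    have hp1 : p - 1 ≠ 0 := by have := (Fact.out : p.Prime).two_le; omega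
    rw [Finset.sum_eq_single ∅] at hsum
    · simp only [Finset.card_empty, pow_zero, one_mul, Q, map_mul, map_prod, map_sub, map_one,
        map_pow, hlin, hPe, Finset.sum_empty, map_zero, Finsupp.coe_zero, Pi.zero_apply,
        zero_pow hp1, sub_zero, Finset.prod_const_one] at hsum
      exact h0 hsum
    · intro T _ hT
      simp only [Q, map_mul, map_prod, map_sub, map_one, map_pow, hlin, hPe]
      by_cases hz : ∑ i ∈ T, g i = 0
      · rw [hne T (Finset.nonempty_iff_ne_empty.2 hT) hz]; simp
      · obtain ⟨c, hc⟩ : ∃ c, b.repr (∑ i ∈ T, g i) c ≠ 0 := by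
          by_contra! hh
          exact hz (b.repr.map_eq_zero_iff.1 (Finsupp.ext hh))
        rw [Finset.prod_eq_zero (Finset.mem_univ c)]
        · simp
        · rw [ZMod.pow_card_sub_one_eq_one hc, sub_self]
    · simp
  obtain ⟨T, hT, hs, hfT⟩ := key
  refine ⟨T.val.map g, Multiset.map_le_map (Finset.val_le_iff.2 (Finset.subset_univ T)), ?_, hs,
    by simpa using hfT⟩
  simpa using hT

theorem natCast_choose_prime (x : ℕ) : (x.choose p : ZMod p) = (x / p : ℕ) := by
  have := Choose.choose_modEq_choose_mod_mul_choose_div_nat (n := x) (k := p) (p := p)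
  rw [Nat.mod_self, Nat.choose_zero_right, one_mul, Nat.div_self (Fact.out : p.Prime).pos,
    Nat.choose_one_right] at this
  exact (ZMod.natCast_eq_natCast_iff _ _ _).2 this

end ChevalleyWarning

/-- Every multiset with at least `m` elements contains a nonempty zero-sum submultiset with at
most `ℓ` elements. -/
def ShortNat (G : Type*) [AddCommGroup G] (m ℓ : ℕ) : Prop :=
  ∀ S : Multiset G, m ≤ S.card → ∃ T ≤ S, T ≠ 0 ∧ T.sum = 0 ∧ T.card ≤ ℓ

theorem exists_le_card_eq {α : Type*} {m : ℕ} {S : Multiset α} (h : m ≤ S.card) :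
    ∃ T ≤ S, T.card = m := by
  induction S using Quotient.inductionOn with
  | _ l => exact ⟨l.take m, (List.take_sublist m l).subperm, by simpa using h⟩

theorem shortNat_of_card_eq {G : Type*} [AddCommGroup G] {m ℓ : ℕ}
    (h : ∀ S : Multiset G, S.card = m → ∃ T ≤ S, T ≠ 0 ∧ T.sum = 0 ∧ T.card ≤ ℓ) :
    ShortNat G m ℓ := by
  intro S hS
  obtain ⟨S', hS', hc⟩ := exists_le_card_eq hS
  obtain ⟨T, hT, h1⟩ := h S' hc
  exact ⟨T, hT.trans hS', h1⟩

theorem exists_card_eq_sum_ne_zero {p : ℕ} [Fact p.Prime] {V : Type*} [AddCommGroup V]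
    [Module (ZMod p) V] {m : ℕ} {S : Multiset V} (hS : S.card = m + 1)
    (hm : p ≤ m) (hp : ∀ T ≤ S, T ≠ 0 → T.sum = 0 → p < T.card) :
    ∃ S' ≤ S, S'.card = m ∧ S'.sum ≠ 0 := by
  by_contra! hne
  have hall : ∀ a ∈ S, a = S.sum := by
    intro a ha
    obtain ⟨R, rfl⟩ := Multiset.exists_cons_of_mem ha
    have := hne R (Multiset.le_cons_self _ _) (by simpa using hS)
    simp [this]
  have hrep := Multiset.eq_replicate.2 ⟨hS, hall⟩
  have hp0 : p ≠ 0 := (Fact.out : p.Prime).ne_zero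
  have h2 := hp (Multiset.replicate p S.sum) (by
    conv_rhs => rw [hrep]
    exact (Multiset.replicate_le_replicate _).2 (by omega)) (by
      rw [← Multiset.card_pos, Multiset.card_replicate]; omega) (by
      rw [Multiset.sum_replicate, ← Nat.cast_smul_eq_nsmul (ZMod p)]; simp)
  simp at h2

section SmallRank

variable {p : ℕ} [Fact p.Prime] {V : Type*} [AddCommGroup V] [Module (ZMod p) V]
  [Module.Finite (ZMod p) V]

theorem shortNat_davenport {j : ℕ} (hj : Module.finrank (ZMod p) V = j) :
    ShortNat V (j * (p - 1) + 1) (j * (p - 1) + 1) := by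
  refine shortNat_of_card_eq fun S hS => ?_
  obtain ⟨T, h1, h2, h3, -⟩ := exists_zero_sum_of_degLE (degLE_const (1 : ZMod p)) one_ne_zero S
    (by rw [hj]; omega)
  exact ⟨T, h1, h2, h3, hS ▸ Multiset.card_le_card h1⟩

theorem exists_split {j : ℕ} (hj : Module.finrank (ZMod p) V = j) {T : Multiset V}
    (hT : T.sum = 0) (hc : j * (p - 1) + 1 < T.card) :
    ∃ T₁ T₂ : Multiset V, T = T₁ + T₂ ∧ T₁ ≠ 0 ∧ T₁.sum = 0 ∧ T₂ ≠ 0 ∧ T₂.sum = 0 := by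
  obtain ⟨a, ha⟩ := Multiset.card_pos_iff_exists_mem.1 (by omega : 0 < T.card)
  obtain ⟨T', rfl⟩ := Multiset.exists_cons_of_mem ha
  obtain ⟨T₁, h1, h2, h3, -⟩ := shortNat_davenport hj T' (by simpa using hc)
  obtain ⟨R, rfl⟩ := Multiset.le_iff_exists_add.1 h1
  refine ⟨T₁, a ::ₘ R, by simp, h2, h3, by simp, ?_⟩
  simpa [h3] using hT

theorem exists_half {j : ℕ} (hj : Module.finrank (ZMod p) V = j) {T : Multiset V}
    (hT : T.sum = 0) (hc : j * (p - 1) + 1 < T.card) :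
    ∃ U ≤ T, U ≠ 0 ∧ U.sum = 0 ∧ 2 * U.card ≤ T.card := by
  obtain ⟨T₁, T₂, rfl, h1, h2, h3, h4⟩ := exists_split hj hT hc
  rw [Multiset.card_add]
  rcases le_total T₁.card T₂.card with h | h
  · exact ⟨T₁, Multiset.le_add_right _ _, h1, h2, by omega⟩
  · exact ⟨T₂, Multiset.le_add_left _ _, h3, h4, by omega⟩

theorem exists_block_dvd_card {j : ℕ} (hj : Module.finrank (ZMod p) V = j) {S : Multiset V}
    (hc : (j + 1) * (p - 1) < S.card) :
    ∃ T ≤ S, T ≠ 0 ∧ T.sum = 0 ∧ p ∣ T.card := by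
  have hp1 : p - 1 ≠ 0 := by have := (Fact.out : p.Prime).two_le; omega
  have hf := ((degLE_const (1 : ZMod p)).mono (Nat.zero_le _)).sub (degLE_natCast.pow (p - 1))
  obtain ⟨T, h1, h2, h3, h4⟩ := exists_zero_sum_of_degLE hf (by simp [hp1]) S
    (by rw [hj]; linarith)
  refine ⟨T, h1, h2, h3, ?_⟩
  rw [← ZMod.natCast_eq_zero_iff]
  by_contra hne
  exact h4 (by rw [ZMod.pow_card_sub_one_eq_one hne, sub_self])

theorem shortNat_rank_two (hj : Module.finrank (ZMod p) V = 2) : ShortNat V (3 * p - 2) p := by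
  have hp := (Fact.out : p.Prime).two_le
  refine shortNat_of_card_eq fun S hS => ?_
  obtain ⟨T, h1, h2, h3, ⟨c, hc⟩⟩ := exists_block_dvd_card hj (S := S) (by omega)
  have h4 := Multiset.card_le_card h1
  have : c < 3 := by by_contra! h; have := Nat.mul_le_mul_left p h; omega
  interval_cases c
  · simp at hc; exact absurd hc h2
  · exact ⟨T, h1, h2, h3, by omega⟩
  · obtain ⟨U, g1, g2, g3, g4⟩ := exists_half hj h3 (by omega)
    exact ⟨U, g1.trans h1, g2, g3, by omega⟩

theorem shortNat_rank_three (hj : Module.finrank (ZMod p) V = 3) :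
    ShortNat V (4 * p - 3) (2 * p) := by
  have hp := (Fact.out : p.Prime).two_le
  refine shortNat_of_card_eq fun S hS => ?_
  obtain ⟨T, h1, h2, h3, ⟨c, hc⟩⟩ := exists_block_dvd_card hj (S := S) (by omega)
  have h4 := Multiset.card_le_card h1
  have : c < 4 := by by_contra! h; have := Nat.mul_le_mul_left p h; omega
  interval_cases c
  · simp at hc; exact absurd hc h2
  · exact ⟨T, h1, h2, h3, by omega⟩
  · exact ⟨T, h1, h2, h3, by omega⟩
  · obtain ⟨U, g1, g2, g3, g4⟩ := exists_half hj h3 (by omega)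
    exact ⟨U, g1.trans h1, g2, g3, by omega⟩

theorem degLE_choose_prime_sub (c : ZMod p) :
    DegLE p (p + 2) fun x => ((x / p : ℕ) - c) * (((x : ZMod p) - -1) * ((x : ZMod p) - -2)) := by
  have h1 := (degLE_choose (p := p) p).sub ((degLE_const c).mono (Nat.zero_le _))
  have h2 := (degLE_natCast (p := p)).sub ((degLE_const (-1)).mono (Nat.zero_le _))
  have h3 := (degLE_natCast (p := p)).sub ((degLE_const (-2)).mono (Nat.zero_le _))
  simpa only [natCast_choose_prime] using h1.mul (h2.mul h3)

theorem natCast_sub_neg_eq_zero {x c : ℕ} (h : p ∣ x + c) : (x : ZMod p) - -(c : ZMod p) = 0 := by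
  rw [sub_neg_eq_add, ← Nat.cast_add]
  exact (ZMod.natCast_eq_zero_iff _ _).2 h

theorem shortNat_rank_three_strong (hp : 3 ≤ p) (hj : Module.finrank (ZMod p) V = 3) :
    ShortNat V (4 * p + 1) (2 * p - 2) := by
  refine shortNat_of_card_eq fun S hS => ?_
  by_contra! hne
  obtain ⟨S', hS', hc, hs⟩ := exists_card_eq_sum_ne_zero (p := p) hS (by omega)
    (fun T h1 h2 h3 => by have := hne T h1 h2 h3; omega)
  have h4 : (4 : ZMod p) ≠ 0 := by
    intro h
    have h5 : p ∣ 2 ^ 2 := (ZMod.natCast_eq_zero_iff _ _).1 (by exact_mod_cast h)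
    have := Nat.le_of_dvd (by norm_num) ((Fact.out : p.Prime).dvd_of_dvd_pow h5)
    omega
  obtain ⟨T, h1, h2, h3, hf⟩ := exists_zero_sum_of_degLE (degLE_choose_prime_sub (2 : ZMod p))
    (by
      simp only [Nat.zero_div, Nat.cast_zero]
      ring_nf
      simpa using h4) S' (by rw [hj]; omega)
  apply hf
  have hlo := hne T (h1.trans hS') h2 h3
  have hhi := Multiset.card_le_card h1
  rw [hc] at hhi
  have hne4 : T.card ≠ 4 * p := by
    intro h
    have := Multiset.eq_of_le_of_card_le h1 (by omega)
    exact hs (this ▸ h3)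
  rcases Nat.lt_or_ge (3 * (p - 1) + 1) T.card with hlt | hge
  · obtain ⟨T₁, T₂, rfl, g1, g2, g3, g4⟩ := exists_split hj h3 hlt
    have e1 := hne T₁ ((Multiset.le_add_right _ _).trans (h1.trans hS')) g1 g2
    have e2 := hne T₂ ((Multiset.le_add_left _ _).trans (h1.trans hS')) g3 g4
    rw [Multiset.card_add] at *
    have : T₁.card + T₂.card = 4 * p - 1 ∨ T₁.card + T₂.card = 4 * p - 2 := by omega
    rcases this with h | h <;> rw [h]
    · have := natCast_sub_neg_eq_zero (p := p) (x := 4 * p - 1) (c := 1) ⟨4, by omega⟩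
      push_cast at this
      rw [this]; ring
    · have := natCast_sub_neg_eq_zero (p := p) (x := 4 * p - 2) (c := 2) ⟨4, by omega⟩
      push_cast at this
      rw [this]; ring
  · rcases Nat.lt_or_ge T.card (2 * p) with h | h
    · have := natCast_sub_neg_eq_zero (p := p) (x := T.card) (c := 1) ⟨2, by omega⟩
      push_cast at this
      rw [this]; ring
    · have : T.card / p = 2 := Nat.div_eq_of_lt_le (by omega) (by omega)
      rw [this]; push_cast; ring

theorem shortNat_rank_four (hp : 5 ≤ p) (hj : Module.finrank (ZMod p) V = 4) :
    ShortNat V (5 * p - 1) (3 * p - 3) := by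
  refine shortNat_of_card_eq fun S hS => ?_
  by_contra! hne
  have h6 : (6 : ZMod p) ≠ 0 := by
    intro h
    have h5 : p ∣ 2 * 3 := (ZMod.natCast_eq_zero_iff _ _).1 (by exact_mod_cast h)
    rcases (Nat.Prime.dvd_mul Fact.out).1 h5 with h | h <;>
      have := Nat.le_of_dvd (by norm_num) h <;> omega
  obtain ⟨T, h1, h2, h3, hf⟩ := exists_zero_sum_of_degLE (degLE_choose_prime_sub (3 : ZMod p))
    (by
      simp only [Nat.zero_div, Nat.cast_zero]
      ring_nf
      simpa using h6) S (by rw [hj]; omega)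
  apply hf
  have hlo := hne T h1 h2 h3
  have hhi := Multiset.card_le_card h1
  rw [hS] at hhi
  rcases Nat.lt_or_ge (4 * (p - 1) + 1) T.card with hlt | hge
  · obtain ⟨T₁, T₂, rfl, g1, g2, g3, g4⟩ := exists_split hj h3 hlt
    have e1 := hne T₁ ((Multiset.le_add_right _ _).trans h1) g1 g2
    have e2 := hne T₂ ((Multiset.le_add_left _ _).trans h1) g3 g4
    rw [Multiset.card_add] at hhi
    omega
  · rcases Nat.lt_or_ge T.card (3 * p) with h | h
    · have : T.card = 3 * p - 1 ∨ T.card = 3 * p - 2 := by omega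
      rcases this with h | h <;> rw [h]
      · have := natCast_sub_neg_eq_zero (p := p) (x := 3 * p - 1) (c := 1) ⟨3, by omega⟩
        push_cast at this
        rw [this]; ring
      · have := natCast_sub_neg_eq_zero (p := p) (x := 3 * p - 2) (c := 2) ⟨3, by omega⟩
        push_cast at this
        rw [this]; ring
    · have : T.card / p = 3 := Nat.div_eq_of_lt_le (by omega) (by omega)
      rw [this]; push_cast; ring

end SmallRank

theorem shortNat_ternary_rank_three {V : Type*} [AddCommGroup V] [Module (ZMod 3) V]
    [Module.Finite (ZMod 3) V] (hj : Module.finrank (ZMod 3) V = 3) : ShortNat V 10 5 := by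
  refine shortNat_of_card_eq fun S hS => ?_
  by_contra! hne
  have hf := (degLE_choose (p := 3) 3).sub ((degLE_const 2).mono (Nat.zero_le _))
  obtain ⟨T, h1, h2, h3, hf⟩ := exists_zero_sum_of_degLE hf (by decide) S (by rw [hj]; omega)
  apply hf
  have hlo := hne T h1 h2 h3
  have hhi := Multiset.card_le_card h1
  rcases Nat.lt_or_ge 7 T.card with hlt | hge
  · obtain ⟨T₁, T₂, rfl, g1, g2, g3, g4⟩ := exists_split hj h3 hlt
    have e1 := hne T₁ ((Multiset.le_add_right _ _).trans h1) g1 g2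
    have e2 := hne T₂ ((Multiset.le_add_left _ _).trans h1) g3 g4
    rw [Multiset.card_add] at hhi
    omega
  · rw [natCast_choose_prime]
    have : T.card / 3 = 2 := by omega
    rw [this]; rfl

section Averaging

variable {p : ℕ} [Fact p.Prime]

theorem pow_le_card_dual_vanishing {V : Type*} [AddCommGroup V] [Module (ZMod p) V]
    [Module.Finite (ZMod p) V] {d : ℕ} (hd : Module.finrank (ZMod p) V = d + 1) (g : V) :
    p ^ d ≤ Nat.card {φ : Module.Dual (ZMod p) V // φ g = 0} := by
  let e := Module.Dual.eval (ZMod p) V g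
  have h1 := LinearMap.finrank_range_add_finrank_ker e
  rw [Subspace.dual_finrank_eq, hd] at h1
  have h2 : Module.finrank (ZMod p) (LinearMap.range e) ≤ 1 := by
    simpa using Submodule.finrank_le (LinearMap.range e)
  have h3 : Nat.card (LinearMap.ker e) = p ^ Module.finrank (ZMod p) (LinearMap.ker e) := by
    rw [Module.natCard_eq_pow_finrank (K := ZMod p), Nat.card_zmod]
  have h4 : Nat.card {φ : Module.Dual (ZMod p) V // φ g = 0} = Nat.card (LinearMap.ker e) :=
    rfl
  rw [h4, h3]
  exact Nat.pow_le_pow_right (Fact.out : p.Prime).pos (by omega)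

theorem exists_dual_countP {V : Type*} [AddCommGroup V] [Module (ZMod p) V]
    [Module.Finite (ZMod p) V] {d : ℕ} (hd : Module.finrank (ZMod p) V = d + 1)
    (S : Multiset V) :
    ∃ φ : Module.Dual (ZMod p) V, φ ≠ 0 ∧
      S.card * ((p : ℝ) ^ d - 1) ≤ S.countP (fun g => φ g = 0) * ((p : ℝ) ^ (d + 1) - 1) := by
  classical
  have : Finite (Module.Dual (ZMod p) V) := Module.finite_of_finite (ZMod p)
  have := Fintype.ofFinite (Module.Dual (ZMod p) V)
  let s : Finset (Module.Dual (ZMod p) V) := Finset.univ.erase 0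
  have hs : (s.card : ℝ) = (p : ℝ) ^ (d + 1) - 1 := by
    have h1 : Fintype.card (Module.Dual (ZMod p) V) = p ^ (d + 1) := by
      rw [← Nat.card_eq_fintype_card, Module.natCard_eq_pow_finrank (K := ZMod p), Nat.card_zmod,
        Subspace.dual_finrank_eq, hd]
    have h2 : 1 ≤ p ^ (d + 1) := Nat.one_le_pow _ _ (Fact.out : p.Prime).pos
    rw [Finset.card_erase_of_mem (Finset.mem_univ _), Finset.card_univ, h1]
    push_cast [h2]; rfl
  have hp2 : (2 : ℝ) ≤ p := by exact_mod_cast (Fact.out : p.Prime).two_le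
  have hpos : 0 < (s.card : ℝ) := by
    rw [hs]
    have : (1 : ℝ) < (p : ℝ) ^ (d + 1) := one_lt_pow₀ (by linarith) (by omega)
    linarith
  have hcount : ∀ g : V, (p : ℝ) ^ d - 1 ≤ ((s.filter fun φ => φ g = 0).card : ℝ) := by
    intro g
    have h1 := pow_le_card_dual_vanishing hd g
    rw [Nat.card_eq_fintype_card, Fintype.card_subtype] at h1
    have h2 : (s.filter fun φ => φ g = 0) = (Finset.univ.filter fun φ => φ g = 0).erase 0 := by
      ext φ; simp [s]
    rw [h2, Finset.card_erase_of_mem (by simp)]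
    have h3 : 1 ≤ p ^ d := Nat.one_le_pow _ _ (Fact.out : p.Prime).pos
    rw [Nat.cast_sub (h3.trans h1)]
    have : (p : ℝ) ^ d ≤ ((Finset.univ.filter fun φ : Module.Dual (ZMod p) V => φ g = 0).card : ℝ) := by
      exact_mod_cast h1
    push_cast
    linarith
  have hsum : S.card * ((p : ℝ) ^ d - 1) ≤ ∑ φ ∈ s, (S.countP (fun g => φ g = 0) : ℝ) := by
    induction S using Multiset.induction with
    | empty => simp
    | cons g S ih =>
      simp only [Multiset.countP_cons, Multiset.card_cons, Nat.cast_add, Finset.sum_add_distrib]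
      have h5 : ∑ φ ∈ s, ((if φ g = 0 then 1 else 0 : ℕ) : ℝ) =
          ((s.filter fun φ => φ g = 0).card : ℝ) := by
        rw [Finset.card_filter]; push_cast; rfl
      rw [h5]
      have := hcount g
      push_cast
      linarith
  by_contra! hne
  have h6 : ∑ φ ∈ s, (S.countP (fun g => φ g = 0) : ℝ) * ((p : ℝ) ^ (d + 1) - 1) <
      ∑ φ ∈ s, S.card * ((p : ℝ) ^ d - 1) := by
    refine Finset.sum_lt_sum_of_nonempty ?_ fun φ hφ => ?_
    · rw [← Finset.card_pos]; exact_mod_cast hpos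
    · have := hne φ (by simpa [s] using hφ)
      exact this
  rw [← Finset.sum_mul, Finset.sum_const, nsmul_eq_mul, hs, mul_comm] at h6
  rw [hs] at hpos
  exact absurd (lt_of_mul_lt_mul_left h6 hpos.le) (not_lt.2 hsum)

theorem short_of_shortNat {j m ℓ : ℕ} (hj : 1 ≤ j)
    (h : ∀ (W : Type u) [AddCommGroup W] [Module (ZMod p) W] [Module.Finite (ZMod p) W],
      Module.finrank (ZMod p) W = j → ShortNat W m ℓ) {d : ℕ} (hd : j ≤ d) :
    ∀ (V : Type u) [AddCommGroup V] [Module (ZMod p) V] [Module.Finite (ZMod p) V],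
      Module.finrank (ZMod p) V = d →
        Short V (((m : ℝ) - 1) / ((p : ℝ) ^ j - 1) * ((p : ℝ) ^ d - 1)) ℓ := by
  have hp2 : (2 : ℝ) ≤ p := by exact_mod_cast (Fact.out : p.Prime).two_le
  have hpow : ∀ i, 1 ≤ i → 0 < (p : ℝ) ^ i - 1 := fun i hi => by
    have : (1 : ℝ) < (p : ℝ) ^ i := one_lt_pow₀ (by linarith) (by omega)
    linarith
  induction d, hd using Nat.le_induction with
  | base =>
    intro V _ _ _ hV S hS
    rw [div_mul_cancel₀ _ (hpow j hj).ne'] at hS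
    exact h V hV S (by
      have : (m : ℝ) < S.card + 1 := by linarith
      have : m < S.card + 1 := by exact_mod_cast this
      omega)
  | succ d hd ih =>
    intro V _ _ _ hV S hS
    obtain ⟨φ, hφ, hc⟩ := exists_dual_countP hV S
    have hker : Module.finrank (ZMod p) (LinearMap.ker φ) = d := by
      have h1 := LinearMap.finrank_range_add_finrank_ker φ
      rw [LinearMap.range_eq_top.2 (LinearMap.surjective hφ)] at h1
      simp [hV] at h1
      omega
    obtain ⟨W, hW⟩ : ∃ W : Multiset (LinearMap.ker φ),
        W.map Subtype.val = S.filter fun g => φ g = 0 := by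
      lift S.filter fun g => φ g = 0 to Multiset (LinearMap.ker φ) with W hW
      · intro x hx
        exact (Multiset.mem_filter.1 hx).2
      exact ⟨W, rfl⟩
    have hWc : W.card = S.countP fun g => φ g = 0 := by
      rw [Multiset.countP_eq_card_filter, ← hW, Multiset.card_map]
    obtain ⟨T, h1, h2, h3, h4⟩ := ih (LinearMap.ker φ) hker W (by
      rw [hWc]
      have h0 := hpow d (hj.trans hd)
      have h0' := hpow (d + 1) (by omega)
      have h5 := mul_lt_mul_of_pos_right hS h0
      have h6 : ((m : ℝ) - 1) / ((p : ℝ) ^ j - 1) * ((p : ℝ) ^ d - 1) * ((p : ℝ) ^ (d + 1) - 1) <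
        S.countP (fun g => φ g = 0) * ((p : ℝ) ^ (d + 1) - 1) := by linarith
      exact lt_of_mul_lt_mul_right h6 h0'.le)
    refine ⟨T.map Subtype.val, ?_, by simpa using h2, ?_, by simpa using h4⟩
    · exact (Multiset.map_le_map h1).trans (hW ▸ Multiset.filter_le _ _)
    · have := map_multiset_sum (LinearMap.ker φ).subtype T
      rw [h3] at this
      simpa using this.symm

end Averaging

theorem Good.mono {G : Type*} [AddCommGroup G] {ℓ : ℕ} {b b' : ℝ} (h : Good G ℓ b)
    (hb : b ≤ b') : Good G ℓ b' :=
  fun k S hS => h k S (by linarith)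

section Elementary

variable {p : ℕ} [Fact p.Prime] {V : Type*} [AddCommGroup V] [Module (ZMod p) V]
  [Module.Finite (ZMod p) V]

theorem davLE_rank_one (hV : Module.finrank (ZMod p) V = 1) {k : ℕ} : DavLE V k (p * k) := by
  have hp := (Fact.out : p.Prime).two_le
  induction k with
  | zero => exact fun S _ => hasBlocks_zero S
  | succ k ih =>
    intro S hS
    rw [mul_add, mul_one] at hS
    obtain ⟨T, h1, h2, h3, h4⟩ := shortNat_davenport hV S (by omega)
    obtain ⟨R, rfl⟩ := Multiset.le_iff_exists_add.1 h1
    rw [Multiset.card_add] at hS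
    exact (ih R (by omega)).cons h2 h3

theorem davLE_rank_two (hV : Module.finrank (ZMod p) V = 2) {k : ℕ} (hk : 1 ≤ k) :
    DavLE V k (p * (k + 1) - 1) := by
  have hp := (Fact.out : p.Prime).two_le
  induction k, hk using Nat.le_induction with
  | base =>
    intro S hS
    obtain ⟨T, h1, h2, h3, -⟩ := shortNat_davenport hV S (by omega)
    exact hasBlocks_one h1 h2 h3
  | succ k hk ih =>
    intro S hS
    have h0 : p * 1 ≤ p * k := Nat.mul_le_mul_left p hk
    have e1 : p * (k + 1) = p * k + p := by ring
    have e2 : p * (k + 1 + 1) = p * k + p + p := by ring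
    rw [e1] at ih
    rw [e2] at hS
    obtain ⟨T, h1, h2, h3, h4⟩ := shortNat_rank_two hV S (by omega)
    obtain ⟨R, rfl⟩ := Multiset.le_iff_exists_add.1 h1
    rw [Multiset.card_add] at hS
    exact (ih R (by omega)).cons h2 h3

theorem davLE_rank_three (hV : Module.finrank (ZMod p) V = 3) {k : ℕ} (hk : 1 ≤ k) :
    DavLE V k (2 * (p * k) + p - 2) := by
  have hp := (Fact.out : p.Prime).two_le
  induction k, hk using Nat.le_induction with
  | base =>
    intro S hS
    obtain ⟨T, h1, h2, h3, -⟩ := shortNat_davenport hV S (by omega)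
    exact hasBlocks_one h1 h2 h3
  | succ k hk ih =>
    intro S hS
    have h0 : p * 1 ≤ p * k := Nat.mul_le_mul_left p hk
    have e1 : p * (k + 1) = p * k + p := by ring
    rw [e1] at hS
    obtain ⟨T, h1, h2, h3, h4⟩ := shortNat_rank_three hV S (by omega)
    obtain ⟨R, rfl⟩ := Multiset.le_iff_exists_add.1 h1
    rw [Multiset.card_add] at hS
    exact (ih R (by omega)).cons h2 h3

theorem exists_davLE_rank_three (hV : Module.finrank (ZMod p) V = 3) {k : ℕ} (hk : 1 ≤ k)
    (hkp : k * p ^ 2 < p ^ 3) : ∃ L, DavLE V k L ∧ (L + 1) ^ 2 ≤ 4 * (k * p ^ 3) := by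
  have hp := (Fact.out : p.Prime).two_le
  refine ⟨_, davLE_rank_three hV hk, ?_⟩
  have hkp' : k < p := by
    rw [pow_succ' p 2] at hkp
    exact lt_of_mul_lt_mul_right hkp (Nat.zero_le _)
  obtain ⟨t, rfl⟩ : ∃ t, p = k + t + 1 := ⟨p - 1 - k, by omega⟩
  have e : 2 * ((k + t + 1) * k) + (k + t + 1) - 2 + 1 = 2 * ((k + t + 1) * k) + (k + t) := by
    have : 1 ≤ k + t := by omega
    omega
  rw [e]
  obtain ⟨s, rfl⟩ : ∃ s, k = s + 1 := ⟨k - 1, by omega⟩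
  ring_nf
  nlinarith [Nat.zero_le (s * t), Nat.zero_le (s * t ^ 2), Nat.zero_le (s ^ 2 * t),
    Nat.zero_le (t ^ 2), Nat.zero_le (s ^ 2), Nat.zero_le (s ^ 2 * t ^ 2), Nat.zero_le (s ^ 3 * t),
    Nat.zero_le (s ^ 3), Nat.zero_le (t ^ 3), Nat.zero_le (s * t ^ 3)]

end Elementary

section LargePrime

variable {p : ℕ} [Fact p.Prime] {V : Type u} [AddCommGroup V] [Module (ZMod p) V]
  [Module.Finite (ZMod p) V]

theorem short_exp {d : ℕ} (hd : 2 ≤ d) (hV : Module.finrank (ZMod p) V = d) :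
    Short V ((3 * (p : ℝ) - 3) / ((p : ℝ) ^ 2 - 1) * ((p : ℝ) ^ d - 1)) p := by
  have hp := (Fact.out : p.Prime).two_le
  have := short_of_shortNat (p := p) (by norm_num) (fun W _ _ _ hW => shortNat_rank_two hW) hd V hV
  rw [Nat.cast_sub (by omega)] at this
  push_cast at this
  convert this using 3
  ring

theorem short_two_exp_sub_two (hp : 3 ≤ p) {d : ℕ} (hd : 3 ≤ d)
    (hV : Module.finrank (ZMod p) V = d) :
    Short V (4 * (p : ℝ) / ((p : ℝ) ^ 3 - 1) * ((p : ℝ) ^ d - 1)) (2 * p - 2) := by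
  have := short_of_shortNat (p := p) (by norm_num)
    (fun W _ _ _ hW => shortNat_rank_three_strong hp hW) hd V hV
  push_cast at this
  convert this using 3
  ring

theorem short_three_exp_sub_three (hp : 5 ≤ p) {d : ℕ} (hd : 4 ≤ d)
    (hV : Module.finrank (ZMod p) V = d) :
    Short V ((5 * (p : ℝ) - 2) / ((p : ℝ) ^ 4 - 1) * ((p : ℝ) ^ d - 1)) (3 * p - 3) := by
  have := short_of_shortNat (p := p) (by norm_num)
    (fun W _ _ _ hW => shortNat_rank_four hp hW) hd V hV
  rw [Nat.cast_sub (by omega)] at this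
  push_cast at this
  convert this using 3
  ring

theorem exists_davLE_linear_of_five_le (hp : 5 ≤ p) {d : ℕ} (hd : 3 ≤ d)
    (hV : Module.finrank (ZMod p) V = d) {k : ℕ} (hk : 1 ≤ k) :
    ∃ L : ℕ, DavLE V k L ∧ (L : ℝ) + 1 ≤ p * k + 3 / 2 * (p : ℝ) ^ (d - 1) := by
  have hq : (5 : ℝ) ≤ p := by exact_mod_cast hp
  obtain ⟨e, rfl⟩ : ∃ e, d = e + 1 := ⟨d - 1, by omega⟩
  rw [Nat.add_sub_cancel]
  have h1 := short_exp (by omega) hV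
  have h2 := (short_two_exp_sub_two (by omega) hd hV).good
  set q : ℝ := (p : ℝ) with hq_def
  set P : ℝ := q ^ (e + 1) - 1 with hP
  have hP0 : 0 ≤ P := by
    have : (1 : ℝ) ≤ q ^ (e + 1) := one_le_pow₀ (by linarith)
    linarith
  have hq2 : 0 < q ^ 2 - 1 := by nlinarith
  have hq3 : 0 < q ^ 3 - 1 := by nlinarith [pow_pos (by linarith : 0 < q) 2]
  have hcast : ((2 * p - 2 : ℕ) : ℝ) = 2 * q - 2 := by
    rw [Nat.cast_sub (by omega)]; push_cast; ring
  set θ₁ := (3 * q - 3) / (q ^ 2 - 1) * P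
  set θ₂ := 4 * q / (q ^ 3 - 1) * P
  have hb : θ₁ - (θ₁ - θ₂) * q / (2 * q - 2) ≤ 3 / 2 * q ^ e := by
    have e1 : θ₁ - (θ₁ - θ₂) * q / (2 * q - 2) =
        P * ((3 * q * (q - 2) * (q ^ 3 - 1) + 4 * q ^ 3 * (q + 1)) /
          (2 * q * (q ^ 2 - 1) * (q ^ 3 - 1))) := by
      have h3 : 2 * q - 2 ≠ 0 := by linarith
      have h3' : q - 1 ≠ 0 := by linarith
      simp only [θ₁, θ₂]
      have : q ^ 2 - 1 ≠ 0 := hq2.ne'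
      have : q ^ 3 - 1 ≠ 0 := hq3.ne'
      have : q ≠ 0 := by linarith
      field_simp
      ring
    have e2 : (3 * q * (q - 2) * (q ^ 3 - 1) + 4 * q ^ 3 * (q + 1)) /
          (2 * q * (q ^ 2 - 1) * (q ^ 3 - 1)) ≤ 3 / (2 * q) := by
      rw [div_le_div_iff₀ (by positivity) (by positivity)]
      have h4 : 3 * q * (q - 2) * (q ^ 3 - 1) + 4 * q ^ 3 * (q + 1) ≤
          3 * (q ^ 2 - 1) * (q ^ 3 - 1) := by
        nlinarith [mul_nonneg (pow_pos (by linarith : 0 < q) 3).le (by linarith : 0 ≤ q - 5),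
          pow_pos (by linarith : 0 < q) 3, mul_nonneg (by linarith : 0 ≤ q) (by nlinarith : 0 ≤ q ^ 2 - 6)]
      nlinarith
    rw [e1]
    refine (mul_le_mul_of_nonneg_left e2 hP0).trans ?_
    have e3 : P ≤ q * q ^ e := by rw [hP, pow_succ']; linarith
    rw [mul_div_assoc', div_le_iff₀ (by positivity)]
    nlinarith
  have hg := h1.good_step h2 (b := θ₁ - (θ₁ - θ₂) * q / (2 * q - 2)) (by omega) (by omega) (by
    rw [hcast, sub_sub_cancel, div_mul_cancel₀ _ (by linarith)])
  have hg' := hg.mono hb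
  obtain ⟨L, hL, hL'⟩ := hg'.exists_davLE hk (by positivity)
  exact ⟨L, hL, by linarith⟩

theorem exists_davLE_quadratic_of_five_le (hp : 5 ≤ p) {d : ℕ} (hd : 3 ≤ d)
    (hV : Module.finrank (ZMod p) V = d) {k : ℕ} (hk : 1 ≤ k) (hk1 : k * p ^ 2 < p ^ d)
    (hk2 : p ^ d ≤ k * p ^ 4) : ∃ L, DavLE V k L ∧ (L + 1) ^ 2 ≤ 4 * (k * p ^ d) := by
  rcases hd.eq_or_lt with rfl | hd
  · exact exists_davLE_rank_three hV hk hk1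
  have hq : (5 : ℝ) ≤ p := by exact_mod_cast hp
  obtain ⟨e, rfl⟩ : ∃ e, d = e + 2 := ⟨d - 2, by omega⟩
  have h2 := short_two_exp_sub_two (by omega) (by omega) hV
  have h4 := (short_three_exp_sub_three hp hd hV).good
  have hk1' : (k : ℝ) * p ^ 2 ≤ p ^ (e + 2) := by exact_mod_cast hk1.le
  have hk2' : (p : ℝ) ^ (e + 2) ≤ k * p ^ 4 := by exact_mod_cast hk2
  have hk0 : (1 : ℝ) ≤ k := by exact_mod_cast hk
  suffices hgoal : ∃ L, DavLE V k L ∧ ((L : ℝ) + 1) ^ 2 ≤ 4 * (k * (p : ℝ) ^ (e + 2)) by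
    obtain ⟨L, hL, hL'⟩ := hgoal
    exact ⟨L, hL, by exact_mod_cast hL'⟩
  have hcast : ((2 * p - 2 : ℕ) : ℝ) = 2 * (p : ℝ) - 2 := by
    rw [Nat.cast_sub (by omega)]; push_cast; ring
  have hcast' : ((3 * p - 3 : ℕ) : ℝ) = 3 * (p : ℝ) - 3 := by
    rw [Nat.cast_sub (by omega)]; push_cast; ring
  set q : ℝ := (p : ℝ) with hq_def
  have hq0 : 0 < q := by linarith
  have hpow : q ^ (e + 2) = q ^ 2 * q ^ e := by ring
  set M : ℝ := q ^ e with hM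
  have hM0 : 0 < M := by positivity
  have hq3 : 125 ≤ q ^ 3 := by nlinarith [mul_nonneg (by linarith : 0 ≤ q - 5) (by linarith : 0 ≤ q)]
  have hq4 : 625 ≤ q ^ 4 := by nlinarith
  rw [hpow] at h2 h4 hk1' hk2' ⊢
  have hkM : (k : ℝ) ≤ M := by
    have : 0 < q ^ 2 := by positivity
    nlinarith
  have hMk : M ≤ k * q ^ 2 := by
    have h0 : 0 < q ^ 2 := by positivity
    have : q ^ 2 * M ≤ q ^ 2 * (k * q ^ 2) := by nlinarith
    exact le_of_mul_le_mul_left this h0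
  have hθ₄ : (5 * q - 2) / (q ^ 4 - 1) * (q ^ 2 * M - 1) ≤ 98 / 100 * M := by
    rw [div_mul_eq_mul_div, div_le_iff₀ (by linarith)]
    have : (5 * q - 2) * q ^ 2 ≤ 98 / 100 * (q ^ 4 - 1) := by nlinarith [sq_nonneg (q - 5)]
    nlinarith
  have hθ₂ : 4 * q / (q ^ 3 - 1) * (q ^ 2 * M - 1) ≤ 404 / 100 * M := by
    rw [div_mul_eq_mul_div, div_le_iff₀ (by linarith)]
    nlinarith
  have g4 := h4.mono hθ₄
  have h2' : Short V (404 / 100 * M) (2 * p - 2) := fun S hS => h2 S (by linarith)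
  have g2 : Good V (2 * p - 2) (2 * M) := h2'.good_step g4 (by omega) (by omega) (by
    rw [hcast, hcast']; nlinarith)
  rcases le_total M (k * (q - 1) ^ 2) with hcase | hcase
  · obtain ⟨L, hL, hL'⟩ := g2.exists_davLE hk (by positivity)
    refine ⟨L, hL, ?_⟩
    rw [hcast] at hL'
    have h5 : (L : ℝ) + 1 ≤ 2 * ((q - 1) * k + M) := by linarith
    have h6 : ((L : ℝ) + 1) ^ 2 ≤ (2 * ((q - 1) * k + M)) ^ 2 := pow_le_pow_left₀ (by positivity) h5 2
    nlinarith [mul_nonneg (sub_nonneg.2 hkM) (sub_nonneg.2 hcase)]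
  · obtain ⟨L, hL, hL'⟩ := g4.exists_davLE hk (by positivity)
    refine ⟨L, hL, ?_⟩
    rw [hcast'] at hL'
    have h5 : (L : ℝ) + 1 ≤ 3 * (q - 1) * k + M := by linarith
    have h6 : ((L : ℝ) + 1) ^ 2 ≤ (3 * (q - 1) * k + M) ^ 2 := pow_le_pow_left₀ (by positivity) h5 2
    refine h6.trans ?_
    have h7 : k * (q - 1) ^ 2 * k ≤ M * k := mul_le_mul_of_nonneg_right hcase (by positivity)
    have h8 : M * M ≤ k * q ^ 2 * M := mul_le_mul_of_nonneg_right hMk hM0.le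
    have h9 : 0 ≤ (3 * q ^ 2 - 6 * q - 3) * (k * M) :=
      mul_nonneg (by nlinarith) (by positivity)
    linarith

end LargePrime

section Ternary

variable {V : Type u} [AddCommGroup V] [Module (ZMod 3) V] [Module.Finite (ZMod 3) V]

theorem ternary_short {j m ℓ : ℕ} (hj : 1 ≤ j)
    (h : ∀ (W : Type u) [AddCommGroup W] [Module (ZMod 3) W] [Module.Finite (ZMod 3) W],
      Module.finrank (ZMod 3) W = j → ShortNat W m ℓ) {d : ℕ} (hd : j ≤ d)
    (hV : Module.finrank (ZMod 3) V = d) {c : ℝ} (hc : ((m : ℝ) - 1) / (3 ^ j - 1) = c) :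
    Short V (c * ((3 : ℝ) ^ d - 1)) ℓ := by
  have := short_of_shortNat (p := 3) hj h hd V hV
  rw [← hc]
  exact_mod_cast this

theorem ternary_good_four {d : ℕ} (hd : 3 ≤ d) (hV : Module.finrank (ZMod 3) V = d) {b : ℝ}
    (h : Good V 7 b) : Good V 4 (229 / 1365 * ((3 : ℝ) ^ d - 1) + 4 / 7 * b) := by
  have s6 : Short V (8 / 26 * ((3 : ℝ) ^ d - 1)) 6 :=
    ternary_short (by norm_num) (fun W _ _ _ hW => shortNat_rank_three hW) hd hV (by norm_num)
  have s5 : Short V (9 / 26 * ((3 : ℝ) ^ d - 1)) 5 :=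
    ternary_short (by norm_num) (fun W _ _ _ hW => shortNat_ternary_rank_three hW) hd hV
      (by norm_num)
  have s4 : Short V (12 / 26 * ((3 : ℝ) ^ d - 1)) 4 :=
    ternary_short (by norm_num) (fun W _ _ _ hW => shortNat_rank_three_strong le_rfl hW) hd hV
      (by norm_num)
  set P : ℝ := (3 : ℝ) ^ d - 1
  have g6 : Good V 6 (8 / 182 * P + 6 / 7 * b) :=
    s6.good_step h (by norm_num) (by norm_num) (by push_cast; linarith)
  have g5 : Good V 5 (9 / 156 * P + 5 / 6 * (8 / 182 * P + 6 / 7 * b)) :=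
    s5.good_step g6 (by norm_num) (by norm_num) (by push_cast; linarith)
  exact s4.good_step g5 (by norm_num) (by norm_num) (by push_cast; linarith)

theorem ternary_good_seven {d : ℕ} (hd : 3 ≤ d) (hV : Module.finrank (ZMod 3) V = d) :
    Good V 7 (6 / 26 * ((3 : ℝ) ^ d - 1)) := by
  have s7 : Short V (6 / 26 * ((3 : ℝ) ^ d - 1)) 7 :=
    ternary_short (by norm_num) (fun W _ _ _ hW => shortNat_davenport hW) hd hV (by norm_num)
  exact s7.good

theorem ternary_short_nine {d : ℕ} (hd : 4 ≤ d) (hV : Module.finrank (ZMod 3) V = d) :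
    Short V (8 / 80 * ((3 : ℝ) ^ d - 1)) 9 :=
  ternary_short (by norm_num) (fun W _ _ _ hW => shortNat_davenport hW) hd hV (by norm_num)

theorem ternary_good_four_of_good_nine {d : ℕ} (hd : 3 ≤ d) (hV : Module.finrank (ZMod 3) V = d)
    {b : ℝ} (h : Good V 9 b) :
    Good V 4 (229 / 1365 * ((3 : ℝ) ^ d - 1) +
      4 / 7 * (12 / 234 * ((3 : ℝ) ^ d - 1) + 7 / 9 * b)) := by
  have s7 : Short V (6 / 26 * ((3 : ℝ) ^ d - 1)) 7 :=
    ternary_short (by norm_num) (fun W _ _ _ hW => shortNat_davenport hW) hd hV (by norm_num)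
  exact ternary_good_four hd hV
    (s7.good_step h (by norm_num) (by norm_num) (by push_cast; linarith))

theorem ternary_good_nine {d : ℕ} (hd : 5 ≤ d) (hV : Module.finrank (ZMod 3) V = d) :
    Good V 9 (26 / 500 * ((3 : ℝ) ^ d - 1)) := by
  have s11 : Short V (10 / 242 * ((3 : ℝ) ^ d - 1)) 11 :=
    ternary_short (by norm_num) (fun W _ _ _ hW => shortNat_davenport hW) hd hV (by norm_num)
  have hP : 1 ≤ (3 : ℝ) ^ d := one_le_pow₀ (by norm_num)
  exact (ternary_short_nine (by omega) hV).good_step s11.good (by norm_num) (by norm_num)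
    (by push_cast; linarith)

/-- For `d ≥ 4`: the two lines that bound `D_k` for ternary elementary groups. -/
theorem ternary_good_lines {d : ℕ} (hd : 2 ≤ d) (hV : Module.finrank (ZMod 3) V = d + 2) :
    Good V 4 (2 * (3 : ℝ) ^ d + 2) ∧ Good V 9 (3 / 4 * (3 : ℝ) ^ d + 7) := by
  have hpow : (3 : ℝ) ^ (d + 2) = 9 * 3 ^ d := by ring
  rcases hd.eq_or_lt with rfl | hd
  · have h9 := (ternary_short_nine (by norm_num) hV).good
    have h4 := ternary_good_four_of_good_nine (by norm_num) hV h9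
    exact ⟨h4.mono (by norm_num), h9.mono (by norm_num)⟩
  · have h9 := ternary_good_nine (by omega) hV
    have h4 := ternary_good_four_of_good_nine (by omega) hV h9
    have h1 : 1 ≤ (3 : ℝ) ^ d := one_le_pow₀ (by norm_num)
    rw [hpow] at h9 h4
    exact ⟨h4.mono (by linarith), h9.mono (by linarith)⟩

theorem exists_davLE_linear_ternary {d : ℕ} (hd : 3 ≤ d) (hV : Module.finrank (ZMod 3) V = d)
    {k : ℕ} (hk : 1 ≤ k) :
    ∃ L : ℕ, DavLE V k L ∧ (L : ℝ) + 1 ≤ 3 * k + 5 / 4 * (3 : ℝ) ^ (d - 1) := by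
  have s3 : Short V (6 / 8 * ((3 : ℝ) ^ d - 1)) 3 :=
    ternary_short (by norm_num) (fun W _ _ _ hW => shortNat_rank_two hW) (by omega) hV
      (by norm_num)
  have key : Good V 3 (5 / 4 * (3 : ℝ) ^ (d - 1) + 1) := by
    rcases hd.eq_or_lt with rfl | hd
    · exact s3.good_step (ternary_good_four le_rfl hV (ternary_good_seven le_rfl hV))
        (by norm_num) (by norm_num) (by norm_num)
    · obtain ⟨e, rfl⟩ : ∃ e, d = e + 2 := ⟨d - 2, by omega⟩
      have e1 : (3 : ℝ) ^ (e + 2) = 9 * 3 ^ e := by ring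
      have e2 : (3 : ℝ) ^ (e + 2 - 1) = 3 * 3 ^ e := by
        rw [show e + 2 - 1 = e + 1 by omega]; ring
      have h1 : 9 ≤ (3 : ℝ) ^ e := by
        calc (9 : ℝ) = 3 ^ 2 := by norm_num
          _ ≤ 3 ^ e := pow_le_pow_right₀ (by norm_num) (by omega)
      refine s3.good_step (ternary_good_lines (by omega) hV).1 (by norm_num) (by norm_num) ?_
      rw [e1, e2]
      push_cast
      linarith
  obtain ⟨L, hL, hL'⟩ := key.exists_davLE hk (by positivity)
  exact ⟨L, hL, by push_cast at hL'; linarith⟩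

theorem exists_davLE_quadratic_ternary {d : ℕ} (hd : 3 ≤ d)
    (hV : Module.finrank (ZMod 3) V = d) {k : ℕ} (hk : 1 ≤ k) (hk1 : k * 3 ^ 2 < 3 ^ d)
    (hk2 : 3 ^ d ≤ k * 3 ^ 4) : ∃ L, DavLE V k L ∧ (L + 1) ^ 2 ≤ 4 * (k * 3 ^ d) := by
  rcases hd.eq_or_lt with rfl | hd
  · exact exists_davLE_rank_three hV hk hk1
  obtain ⟨e, rfl⟩ : ∃ e, d = e + 2 := ⟨d - 2, by omega⟩
  obtain ⟨h4, h9⟩ := ternary_good_lines (by omega) hV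
  have hk1' : (k : ℝ) * 3 ^ 2 ≤ 3 ^ (e + 2) := by exact_mod_cast hk1.le
  have hk2' : (3 : ℝ) ^ (e + 2) ≤ k * 3 ^ 4 := by exact_mod_cast hk2
  suffices hgoal : ∃ L, DavLE V k L ∧ ((L : ℝ) + 1) ^ 2 ≤ 4 * (k * (3 : ℝ) ^ (e + 2)) by
    obtain ⟨L, hL, hL'⟩ := hgoal
    exact ⟨L, hL, by exact_mod_cast hL'⟩
  have hpow : (3 : ℝ) ^ (e + 2) = 9 * 3 ^ e := by ring
  rw [hpow] at hk1' hk2' ⊢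
  set M : ℝ := 3 ^ e
  rcases le_total M (4 * k) with hcase | hcase
  · obtain ⟨L, hL, hL'⟩ := h4.exists_davLE hk (by positivity)
    refine ⟨L, hL, ?_⟩
    push_cast at hL'
    have h6 : ((L : ℝ) + 1) ^ 2 ≤ (4 * k + 2 * M) ^ 2 :=
      pow_le_pow_left₀ (by positivity) (by linarith) 2
    nlinarith [mul_nonneg (by linarith : 0 ≤ M - k) (sub_nonneg.2 hcase)]
  · obtain ⟨L, hL, hL'⟩ := h9.exists_davLE hk (by positivity)
    refine ⟨L, hL, ?_⟩
    push_cast at hL'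
    have h6 : ((L : ℝ) + 1) ^ 2 ≤ (9 * k + 3 / 4 * M) ^ 2 :=
      pow_le_pow_left₀ (by positivity) (by linarith) 2
    nlinarith [mul_nonneg (by linarith : 0 ≤ 9 * k - M) (sub_nonneg.2 hcase)]

end Ternary

section Binary

variable {V : Type u} [AddCommGroup V] [Module (ZMod 2) V]

theorem shortNat_binary {m ℓ : ℕ} (hℓ : 2 ≤ ℓ)
    (h : ∀ S : Finset V, 0 ∉ S → S.card = m →
      ∃ T : Finset V, T ⊆ S ∧ T ≠ ∅ ∧ ∑ x ∈ T, x = 0 ∧ T.card ≤ ℓ) : ShortNat V m ℓ := by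
  classical
  refine shortNat_of_card_eq fun S hS => ?_
  by_cases h0 : (0 : V) ∈ S
  · exact ⟨{0}, by simpa using h0, by simp, by simp, by simp; omega⟩
  by_cases hnd : S.Nodup
  · obtain ⟨T, h1, h2, h3, h4⟩ := h ⟨S, hnd⟩ h0 hS
    exact ⟨T.val, Finset.val_le_iff.2 h1, by simpa using h2, (Finset.sum_val T).trans h3, h4⟩
  · obtain ⟨a, ha⟩ : ∃ a, a ::ₘ a ::ₘ 0 ≤ S := by
      by_contra! hne
      exact hnd (Multiset.nodup_iff_le.2 hne)
    refine ⟨_, ha, by simp, ?_, by simpa using hℓ⟩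
    have : a + a = 0 := by
      have := ZModModule.char_nsmul_eq_zero 2 a
      rwa [two_nsmul] at this
    simpa using this

theorem add_self_binary (a : V) : a + a = 0 := by
  have := ZModModule.char_nsmul_eq_zero 2 a
  rwa [two_nsmul] at this

variable [Module.Finite (ZMod 2) V]

theorem card_eq_two_pow {d : ℕ} (hV : Module.finrank (ZMod 2) V = d) : Nat.card V = 2 ^ d := by
  rw [Module.natCard_eq_pow_finrank (K := ZMod 2), Nat.card_zmod, hV]

theorem shortNat_binary_two {d : ℕ} (hV : Module.finrank (ZMod 2) V = d) :
    ShortNat V (2 ^ d) 2 := by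
  classical
  have : Finite V := Module.finite_of_finite (ZMod 2)
  have := Fintype.ofFinite V
  refine shortNat_binary le_rfl fun S h0 hS => ?_
  have h1 := Finset.card_lt_univ_of_notMem h0
  rw [← Nat.card_eq_fintype_card, card_eq_two_pow hV] at h1
  omega

theorem shortNat_binary_three {d : ℕ} (hV : Module.finrank (ZMod 2) V = d + 1) :
    ShortNat V (2 ^ d + 1) 3 := by
  classical
  have : Finite V := Module.finite_of_finite (ZMod 2)
  have := Fintype.ofFinite V
  refine shortNat_binary (by norm_num) fun S h0 hS => ?_
  obtain ⟨x, hx⟩ := Finset.card_pos.1 (hS ▸ Nat.succ_pos _ : 0 < S.card)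
  have hx0 : x ≠ 0 := fun h => h0 (h ▸ hx)
  have hA : (S.erase x).card = 2 ^ d := by rw [Finset.card_erase_of_mem hx, hS]; rfl
  have hB : ((S.erase x).image (x + ·)).card = 2 ^ d := by
    rw [Finset.card_image_of_injective _ (add_right_injective x), hA]
  have hnd : ¬ Disjoint (S.erase x) ((S.erase x).image (x + ·)) := by
    intro hdis
    have h1 : 0 ∉ S.erase x ∪ (S.erase x).image (x + ·) := by
      simp only [Finset.mem_union, Finset.mem_image, not_or, not_exists, not_and]
      refine ⟨fun h => h0 (Finset.mem_of_mem_erase h), fun y hy hxy => ?_⟩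
      apply (Finset.mem_erase.1 hy).1
      have := add_self_binary x
      exact add_left_cancel (hxy.trans this.symm)
    have h2 := Finset.card_lt_univ_of_notMem h1
    rw [Finset.card_union_of_disjoint hdis, hA, hB, ← Nat.card_eq_fintype_card,
      card_eq_two_pow hV, pow_succ] at h2
    omega
  obtain ⟨y, hy, hy'⟩ := Finset.not_disjoint_iff.1 hnd
  obtain ⟨z, hz, rfl⟩ := Finset.mem_image.1 hy'
  obtain ⟨hzx, hzS⟩ := Finset.mem_erase.1 hz
  obtain ⟨hyx, hyS⟩ := Finset.mem_erase.1 hy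
  refine ⟨{x, x + z, z}, ?_, by simp, ?_, Finset.card_le_three⟩
  · intro w hw
    simp only [Finset.mem_insert, Finset.mem_singleton] at hw
    rcases hw with rfl | rfl | rfl <;> assumption
  · rw [Finset.sum_insert, Finset.sum_insert, Finset.sum_singleton]
    · have e1 := add_self_binary x
      have e2 := add_self_binary z
      calc x + (x + z + z) = (x + x) + (z + z) := by abel
        _ = 0 := by rw [e1, e2, add_zero]
    · simpa using hx0
    · simp only [Finset.mem_insert, Finset.mem_singleton, not_or]
      exact ⟨fun h => hyx h.symm, fun h => hzx h.symm⟩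

theorem shortNat_binary_four {d τ : ℕ} (hV : Module.finrank (ZMod 2) V = d)
    (hτ : 2 ^ d ≤ τ + τ.choose 2) : ShortNat V τ 4 := by
  classical
  have : Finite V := Module.finite_of_finite (ZMod 2)
  have := Fintype.ofFinite V
  refine shortNat_binary (by norm_num) fun S h0 hS => ?_
  let F := (Finset.range 3).biUnion fun i => S.powersetCard i
  have hF : F.card = 1 + τ + τ.choose 2 := by
    rw [Finset.card_biUnion]
    · simp [Finset.sum_range_succ, hS]
    · intro i _ j _ hij
      exact Finset.pairwise_disjoint_powersetCard S hij
  have hmem : ∀ T ∈ F, T ⊆ S ∧ T.card ≤ 2 := by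
    intro T hT
    obtain ⟨i, hi, hiT⟩ := Finset.mem_biUnion.1 hT
    rw [Finset.mem_powersetCard] at hiT
    have := Finset.mem_range.1 hi
    exact ⟨hiT.1, by omega⟩
  obtain ⟨P, hP, Q, hQ, hne, hPQ⟩ := Finset.exists_ne_map_eq_of_card_lt_of_maps_to
    (s := F) (t := Finset.univ) (f := fun T => ∑ x ∈ T, x) (by
      rw [hF, Finset.card_univ, ← Nat.card_eq_fintype_card, card_eq_two_pow hV]; omega)
    (fun _ _ => by simp)
  obtain ⟨hPS, hPc⟩ := hmem P hP
  obtain ⟨hQS, hQc⟩ := hmem Q hQ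
  refine ⟨(P \ Q) ∪ (Q \ P), ?_, ?_, ?_, ?_⟩
  · exact Finset.union_subset (Finset.sdiff_subset.trans hPS) (Finset.sdiff_subset.trans hQS)
  · intro h
    rw [Finset.union_eq_empty, Finset.sdiff_eq_empty_iff_subset,
      Finset.sdiff_eq_empty_iff_subset] at h
    exact hne (h.1.antisymm h.2)
  · rw [Finset.sum_union (disjoint_sdiff_sdiff)]
    have e1 := Finset.sum_inter_add_sum_sdiff P Q (fun x => x)
    have e2 := Finset.sum_inter_add_sum_sdiff Q P (fun x => x)
    rw [Finset.inter_comm] at e2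
    have e3 := add_self_binary (∑ x ∈ P, x)
    have e4 := add_self_binary (∑ x ∈ P ∩ Q, x)
    have hPQ' : ∑ x ∈ P, x = ∑ x ∈ Q, x := hPQ
    calc _ = (∑ x ∈ P ∩ Q, x + ∑ x ∈ P \ Q, x) + (∑ x ∈ P ∩ Q, x + ∑ x ∈ Q \ P, x)
          - (∑ x ∈ P ∩ Q, x + ∑ x ∈ P ∩ Q, x) := by abel
      _ = 0 := by rw [e1, e2, e4, ← hPQ', e3, sub_zero]
  · refine (Finset.card_union_le _ _).trans ?_
    have := Finset.card_le_card (Finset.sdiff_subset (s := P) (t := Q))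
    have := Finset.card_le_card (Finset.sdiff_subset (s := Q) (t := P))
    omega

theorem ShortNat.short {G : Type*} [AddCommGroup G] {m ℓ : ℕ} (h : ShortNat G m ℓ) :
    Short G ((m : ℝ) - 1) ℓ := by
  intro S hS
  refine h S ?_
  have : (m : ℝ) < S.card + 1 := by linarith
  have : m < S.card + 1 := by exact_mod_cast this
  omega

theorem binary_good_three {e τ : ℕ} (hV : Module.finrank (ZMod 2) V = e + 2)
    (hτ : 2 ^ (e + 2) ≤ τ + τ.choose 2) :
    Good V 3 ((2 : ℝ) ^ e / 2 + 3 / 4 * ((τ : ℝ) - 1)) := by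
  have h4 := (shortNat_binary_four hV hτ).short.good
  have h3 := (shortNat_binary_three (d := e + 1) hV).short
  refine h3.good_step h4 (by norm_num) (by norm_num) ?_
  push_cast
  rw [pow_succ]
  linarith

theorem binary_good_two {e : ℕ} (hV : Module.finrank (ZMod 2) V = e + 2) {b : ℝ}
    (h : Good V 3 b) : Good V 2 ((4 * (2 : ℝ) ^ e - 1) / 3 + 2 / 3 * b) := by
  refine (shortNat_binary_two hV).short.good_step h (by norm_num) (by norm_num) ?_
  push_cast
  rw [pow_succ, pow_succ]
  linarith

theorem le_add_choose_two {n τ : ℕ} (h : 2 * n ≤ τ * (τ + 1)) : n ≤ τ + τ.choose 2 := by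
  have := Nat.triangle_succ τ
  rw [Nat.choose_two_right]
  rw [Nat.add_sub_cancel] at this
  rw [mul_comm τ] at h
  omega

/-- A suitable size for the sets whose sums of at most two elements collide. -/
theorem exists_collision_size {e : ℕ} (he : 4 ≤ e) :
    ∃ τ : ℕ, 2 ^ (e + 2) ≤ τ + τ.choose 2 ∧ 3 * (τ : ℝ) ≤ 2 * 2 ^ e + 7 := by
  have hM : 2 ^ 4 ≤ 2 ^ e := Nat.pow_le_pow_right (by norm_num) he
  refine ⟨(2 * 2 ^ e + 7) / 3, le_add_choose_two ?_, ?_⟩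
  · rw [pow_add]
    generalize 2 ^ e = M at *
    obtain ⟨τ, hτ⟩ : ∃ τ, τ = (2 * M + 7) / 3 := ⟨_, rfl⟩
    rw [← hτ]
    have h1 : 2 * M + 5 ≤ 3 * τ := by omega
    nlinarith [Nat.mul_le_mul h1 h1]
  · have : 3 * ((2 * 2 ^ e + 7) / 3) ≤ 2 * 2 ^ e + 7 := Nat.mul_div_le _ _
    exact_mod_cast this

theorem exists_davLE_linear_binary {d : ℕ} (hd : 3 ≤ d) (hV : Module.finrank (ZMod 2) V = d)
    {k : ℕ} (hk : 1 ≤ k) :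
    ∃ L : ℕ, DavLE V k L ∧ (L : ℝ) + 1 ≤ 2 * k + (2 : ℝ) ^ (d - 1) := by
  obtain ⟨e, rfl⟩ : ∃ e, d = e + 2 := ⟨d - 2, by omega⟩
  obtain ⟨τ, h1, h2⟩ : ∃ τ : ℕ, 2 ^ (e + 2) ≤ τ + τ.choose 2 ∧ 3 * (τ : ℝ) < 2 * 2 ^ e + 11 := by
    rcases Nat.lt_or_ge e 4 with he | he
    · have : 1 ≤ e := by omega
      interval_cases e
      · exact ⟨4, by decide, by norm_num⟩
      · exact ⟨6, by decide, by norm_num⟩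
      · exact ⟨8, by decide, by norm_num⟩
    · obtain ⟨τ, h1, h2⟩ := exists_collision_size he
      exact ⟨τ, h1, by linarith⟩
  have hg := binary_good_two hV (binary_good_three hV h1)
  have e2 : (2 : ℝ) ^ (e + 2 - 1) = 2 * 2 ^ e := by
    rw [show e + 2 - 1 = e + 1 by omega]; ring
  refine ⟨2 * k + 2 * 2 ^ e - 1, hg.davLE ?_, ?_⟩
  · rw [Nat.cast_sub (by omega)]
    push_cast
    linarith
  · rw [Nat.cast_sub (by omega), e2]
    push_cast
    linarith

theorem exists_davLE_quadratic_binary {d : ℕ} (hd : 3 ≤ d)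
    (hV : Module.finrank (ZMod 2) V = d) {k : ℕ} (hk : 1 ≤ k) (hk1 : k * 2 ^ 2 < 2 ^ d)
    (hk2 : 2 ^ d ≤ k * 2 ^ 4) : ∃ L, DavLE V k L ∧ (L + 1) ^ 2 ≤ 4 * (k * 2 ^ d) := by
  rcases hd.eq_or_lt with rfl | hd
  · exact exists_davLE_rank_three hV hk hk1
  obtain ⟨e, rfl⟩ : ∃ e, d = e + 2 := ⟨d - 2, by omega⟩
  rcases Nat.lt_or_ge e 4 with he | he
  · have he2 : 2 ≤ e := by omega
    interval_cases e
    · have hg := binary_good_three (τ := 6) hV (by decide)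
      refine ⟨3 * k + 3, hg.davLE (by push_cast; linarith), ?_⟩
      have : k ≤ 3 := by omega
      interval_cases k <;> norm_num
    · have hg := binary_good_three (τ := 8) hV (by decide)
      refine ⟨3 * k + 7, hg.davLE (by push_cast; linarith), ?_⟩
      have : k ≤ 7 := by omega
      have : 2 ≤ k := by omega
      interval_cases k <;> norm_num
  · obtain ⟨τ, h1, h2⟩ := exists_collision_size he
    have hg : Good V 3 ((2 : ℝ) ^ e + 1) := (binary_good_three hV h1).mono (by linarith)
    have hk1' : (k : ℝ) * 2 ^ 2 ≤ 2 ^ (e + 2) := by exact_mod_cast hk1.le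
    have hk2' : (2 : ℝ) ^ (e + 2) ≤ k * 2 ^ 4 := by exact_mod_cast hk2
    obtain ⟨L, hL, hL'⟩ := hg.exists_davLE hk (by positivity)
    refine ⟨L, hL, ?_⟩
    suffices hgoal : ((L : ℝ) + 1) ^ 2 ≤ 4 * (k * (2 : ℝ) ^ (e + 2)) by exact_mod_cast hgoal
    have hpow : (2 : ℝ) ^ (e + 2) = 4 * 2 ^ e := by ring
    rw [hpow] at hk1' hk2' ⊢
    set M : ℝ := 2 ^ e
    push_cast at hL'
    have h6 : ((L : ℝ) + 1) ^ 2 ≤ (3 * k + M) ^ 2 :=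
      pow_le_pow_left₀ (by positivity) (by linarith) 2
    nlinarith [mul_nonneg (by linarith : 0 ≤ M - k) (by linarith : 0 ≤ 9 * (k : ℝ) - M)]

end Binary

/-- The constant in the linear bound for elementary abelian `p`-groups. -/
noncomputable def alpha (p : ℕ) : ℝ := if p = 2 then 1 else if p = 3 then 5 / 4 else 3 / 2

section ElementaryGroup

variable {p : ℕ} [Fact p.Prime] {R : Type u} [AddCommGroup R] [Finite R]

theorem five_le_of_ne (h2 : p ≠ 2) (h3 : p ≠ 3) : 5 ≤ p := by
  have hp := (Fact.out : p.Prime)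
  have := hp.two_le
  by_contra! h
  have : p = 4 := by omega
  subst this
  exact absurd hp (by decide)

theorem finrank_eq_of_card [Module (ZMod p) R] {d : ℕ} (hc : Nat.card R = p ^ d) :
    Module.finrank (ZMod p) R = d := by
  rw [Module.natCard_eq_pow_finrank (K := ZMod p), Nat.card_zmod] at hc
  exact Nat.pow_right_injective (Fact.out : p.Prime).two_le hc

theorem exists_card_eq_pow (h : ∀ x : R, p • x = 0) : ∃ d, Nat.card R = p ^ d := by
  obtain ⟨_⟩ : Nonempty (Module (ZMod p) R) := ⟨AddCommGroup.zmodModule h⟩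
  exact ⟨_, by rw [Module.natCard_eq_pow_finrank (K := ZMod p), Nat.card_zmod]⟩

theorem davLE_of_card_eq_prime (h : ∀ x : R, p • x = 0) (hc : Nat.card R = p ^ 1) {k : ℕ} :
    DavLE R k (p * k) := by
  obtain ⟨_⟩ : Nonempty (Module (ZMod p) R) := ⟨AddCommGroup.zmodModule h⟩
  have hV : Module.finrank (ZMod p) R = 1 := finrank_eq_of_card hc
  exact davLE_rank_one hV

theorem davLE_of_card_eq_prime_sq (h : ∀ x : R, p • x = 0) (hc : Nat.card R = p ^ 2) {k : ℕ}
    (hk : 1 ≤ k) : DavLE R k (p * (k + 1) - 1) := by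
  obtain ⟨_⟩ : Nonempty (Module (ZMod p) R) := ⟨AddCommGroup.zmodModule h⟩
  have hV : Module.finrank (ZMod p) R = 2 := finrank_eq_of_card hc
  exact davLE_rank_two hV hk

theorem exists_davLE_linear (h : ∀ x : R, p • x = 0) {d : ℕ} (hd : 3 ≤ d)
    (hc : Nat.card R = p ^ d) {k : ℕ} (hk : 1 ≤ k) :
    ∃ L : ℕ, DavLE R k L ∧ (L : ℝ) + 1 ≤ p * k + alpha p * (p : ℝ) ^ (d - 1) := by
  obtain ⟨_⟩ : Nonempty (Module (ZMod p) R) := ⟨AddCommGroup.zmodModule h⟩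
  have hV : Module.finrank (ZMod p) R = d := finrank_eq_of_card hc
  rw [alpha]
  split_ifs with h2 h3
  · subst h2
    simpa using exists_davLE_linear_binary hd hV hk
  · subst h3
    simpa using exists_davLE_linear_ternary hd hV hk
  · exact exists_davLE_linear_of_five_le (five_le_of_ne h2 h3) hd hV hk

theorem exists_davLE_quadratic (h : ∀ x : R, p • x = 0) {d : ℕ} (hd : 3 ≤ d)
    (hc : Nat.card R = p ^ d) {k : ℕ} (hk : 1 ≤ k) (hk1 : k * p ^ 2 < p ^ d)
    (hk2 : p ^ d ≤ k * p ^ 4) : ∃ L, DavLE R k L ∧ (L + 1) ^ 2 ≤ 4 * (k * p ^ d) := by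
  obtain ⟨_⟩ : Nonempty (Module (ZMod p) R) := ⟨AddCommGroup.zmodModule h⟩
  have hV : Module.finrank (ZMod p) R = d := finrank_eq_of_card hc
  by_cases h2 : p = 2
  · subst h2
    exact exists_davLE_quadratic_binary hd hV hk hk1 hk2
  by_cases h3 : p = 3
  · subst h3
    exact exists_davLE_quadratic_ternary hd hV hk hk1 hk2
  · exact exists_davLE_quadratic_of_five_le (five_le_of_ne h2 h3) hd hV hk hk1 hk2

theorem exists_surjective_plane (h : ∀ x : R, p • x = 0) {d : ℕ} (hd : 2 ≤ d)
    (hc : Nat.card R = p ^ d) : ∃ f : R →+ (Fin 2 → ZMod p), Function.Surjective f := by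
  obtain ⟨_⟩ : Nonempty (Module (ZMod p) R) := ⟨AddCommGroup.zmodModule h⟩
  have hV : Module.finrank (ZMod p) R = d := finrank_eq_of_card hc
  let e := (Module.finBasisOfFinrankEq (ZMod p) R hV).equivFun
  let g := LinearMap.funLeft (ZMod p) (ZMod p) (Fin.castLE hd)
  have hg : Function.Surjective g :=
    LinearMap.funLeft_surjective_of_injective _ _ _ (Fin.castLE_injective hd)
  exact ⟨(g.comp e.toLinearMap).toAddMonoidHom, hg.comp e.surjective⟩

end ElementaryGroup

section Structure

variable {G : Type u} [AddCommGroup G]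

theorem card_eq_card_ker_mul [Finite G] {Q : Type*} [AddCommGroup Q] {φ : G →+ Q}
    (hφ : Function.Surjective φ) : Nat.card G = Nat.card φ.ker * Nat.card Q := by
  rw [AddSubgroup.card_eq_card_quotient_mul_card_addSubgroup φ.ker, mul_comm]
  congr 1
  exact Nat.card_congr (QuotientAddGroup.quotientKerEquivOfSurjective φ hφ).toEquiv

/-- The image of multiplication by `exp G / p`. -/
noncomputable abbrev topRange (G : Type u) [AddCommGroup G] (p : ℕ) : AddSubgroup G :=
  (nsmulAddMonoidHom (α := G) (AddMonoid.exponent G / p)).range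

/-- Multiplication by `exp G / p`, onto its image. -/
noncomputable abbrev topMap (G : Type u) [AddCommGroup G] (p : ℕ) : G →+ topRange G p :=
  (nsmulAddMonoidHom (α := G) (AddMonoid.exponent G / p)).rangeRestrict

theorem topMap_surjective (p : ℕ) : Function.Surjective (topMap G p) :=
  AddMonoidHom.rangeRestrict_surjective _

theorem mem_topMap_ker {p : ℕ} {x : G} :
    x ∈ (topMap G p).ker ↔ (AddMonoid.exponent G / p) • x = 0 := by
  rw [AddMonoidHom.ker_rangeRestrict, AddMonoidHom.mem_ker, nsmulAddMonoidHom_apply]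

theorem topRange_nsmul {p : ℕ} (hp : p ∣ AddMonoid.exponent G) (x : topRange G p) :
    p • x = 0 := by
  obtain ⟨_, y, rfl⟩ := x
  ext
  simp only [nsmulAddMonoidHom_apply, AddSubgroup.coe_nsmul, ZeroMemClass.coe_zero]
  rw [smul_smul, Nat.mul_div_cancel' hp, AddMonoid.exponent_nsmul_eq_zero]

theorem exponent_topMap_ker [Finite G] {p : ℕ} (hp : p ∣ AddMonoid.exponent G) (hp0 : 0 < p) :
    AddMonoid.exponent (topMap G p).ker = AddMonoid.exponent G / p := by
  apply Nat.dvd_antisymm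
  · refine AddMonoid.exponent_dvd_of_forall_nsmul_eq_zero fun x => ?_
    ext
    simpa using mem_topMap_ker.1 x.2
  · rw [Nat.div_dvd_iff_dvd_mul hp hp0]
    refine AddMonoid.exponent_dvd_of_forall_nsmul_eq_zero fun x => ?_
    have hx : p • x ∈ (topMap G p).ker := by
      rw [mem_topMap_ker, smul_smul, Nat.div_mul_cancel hp, AddMonoid.exponent_nsmul_eq_zero]
    have := congrArg Subtype.val
      (AddMonoid.exponent_nsmul_eq_zero (G := (topMap G p).ker) ⟨p • x, hx⟩)
    rw [mul_comm, mul_smul]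
    simpa using this

theorem exponent_quotient_topRange_dvd (p : ℕ) :
    AddMonoid.exponent (G ⧸ topRange G p) ∣ AddMonoid.exponent G / p := by
  refine AddMonoid.exponent_dvd_of_forall_nsmul_eq_zero fun x => ?_
  obtain ⟨y, rfl⟩ := QuotientAddGroup.mk_surjective x
  rw [← QuotientAddGroup.mk_nsmul, QuotientAddGroup.eq_zero_iff]
  exact ⟨y, rfl⟩

/-- Every `p`-rank of `(exp G / p) G` is at least three. -/
def Thick (G : Type u) [AddCommGroup G] : Prop :=
  ∀ p : ℕ, p.Prime → p ∣ AddMonoid.exponent G → p ^ 3 ≤ Nat.card (topRange G p)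

theorem Thick.topMap_ker [Finite G] (h : Thick G) {p : ℕ} (hp : p ∣ AddMonoid.exponent G)
    (hp0 : 0 < p) : Thick (topMap G p).ker := by
  intro r hr hrn
  rw [exponent_topMap_ker hp hp0] at hrn
  refine (h r hr (hrn.trans (Nat.div_dvd_of_dvd hp))).trans ?_
  have hle : topRange G r ≤ (topRange (topMap G p).ker r).map (topMap G p).ker.subtype := by
    rintro _ ⟨x, rfl⟩
    have hx : p • x ∈ (topMap G p).ker := by
      rw [mem_topMap_ker, smul_smul, Nat.div_mul_cancel hp, AddMonoid.exponent_nsmul_eq_zero]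
    refine ⟨_, ⟨⟨p • x, hx⟩, rfl⟩, ?_⟩
    simp only [nsmulAddMonoidHom_apply, AddSubgroup.subtype_apply, AddSubgroup.coe_nsmul]
    rw [exponent_topMap_ker hp hp0, smul_smul]
    congr 1
    rw [mul_comm, ← Nat.mul_div_assoc _ hrn, Nat.mul_div_cancel' hp]
  calc Nat.card (topRange G r)
      ≤ Nat.card ((topRange (topMap G p).ker r).map (topMap G p).ker.subtype) :=
        Nat.card_le_card_of_injective _ (AddSubgroup.inclusion_injective hle)
    _ = Nat.card (topRange (topMap G p).ker r) :=
        Nat.card_congr ((topRange (topMap G p).ker r).equivMapOfInjective _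
          Subtype.val_injective).toEquiv.symm

theorem Thick.exponent_pow_le (n : ℕ) : ∀ (G : Type u) [AddCommGroup G] [Finite G],
    Thick G → AddMonoid.exponent G = n → n ^ 3 ≤ Nat.card G := by
  induction n using Nat.strong_induction_on with
  | _ n ih =>
    intro G _ _ hG hn
    have hn0 : AddMonoid.exponent G ≠ 0 := AddMonoid.exponent_ne_zero_of_finite
    by_cases h1 : n = 1
    · rw [h1, one_pow]; exact Nat.card_pos
    obtain ⟨p, hp, hpn⟩ := Nat.exists_prime_and_dvd h1
    have hdvd : p ∣ AddMonoid.exponent G := hn ▸ hpn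
    have := ih (n / p) (Nat.div_lt_self (by omega) hp.one_lt) (topMap G p).ker
      (hG.topMap_ker hdvd hp.pos) (by rw [exponent_topMap_ker hdvd hp.pos, hn])
    rw [card_eq_card_ker_mul (topMap_surjective (G := G) p)]
    calc n ^ 3 = (n / p) ^ 3 * p ^ 3 := by rw [← mul_pow, Nat.div_mul_cancel hpn]
      _ ≤ _ := Nat.mul_le_mul this (hG p hp hdvd)

end Structure

theorem DavLE.one_le {G : Type*} [AddCommGroup G] {k L : ℕ} (h : DavLE G k L) (hk : 1 ≤ k) :
    1 ≤ L := by
  by_contra! h0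
  obtain ⟨F, h1, h2, h3⟩ := h 0 (by simp; omega)
  obtain ⟨T, hT⟩ := Multiset.card_pos_iff_exists_mem.1 (by omega : 0 < F.card)
  exact (h2 T hT).1 (Multiset.le_zero.1 ((Multiset.le_sum_of_mem hT).trans h3))

/-- The ratio that the linear bound attains on thick groups of composite exponent with least
prime factor `q`. -/
noncomputable def tau (q : ℕ) : ℝ := (2 * q - 1) / (q : ℝ) ^ 2

/-- The constant in the linear bound for thick groups of exponent `n`. -/
noncomputable def coeff (n : ℕ) : ℝ := if n.Prime then alpha n else tau n.minFac

theorem one_le_alpha (p : ℕ) : 1 ≤ alpha p := by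
  rw [alpha]
  split_ifs <;> norm_num

theorem alpha_le (p : ℕ) : alpha p ≤ 3 / 2 := by
  rw [alpha]
  split_ifs <;> norm_num

theorem tau_le_alpha {q : ℕ} (hq : 0 < q) : tau q ≤ alpha q := by
  have hq' : (0 : ℝ) < q := by exact_mod_cast hq
  refine le_trans ?_ (one_le_alpha q)
  rw [tau, div_le_one (by positivity)]
  nlinarith [sq_nonneg ((q : ℝ) - 1)]

theorem coeff_le_alpha {n : ℕ} : coeff n ≤ alpha n.minFac := by
  rw [coeff]
  split_ifs with h
  · rw [h.minFac_eq]
  · exact tau_le_alpha n.minFac_pos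

theorem alpha_div_add_le {p q : ℕ} (hp : p.Prime) (hq : q.Prime) (hqp : q ≤ p) :
    alpha q / p + alpha p / (q : ℝ) ^ 2 ≤ tau q := by
  have hq0 : (0 : ℝ) < q := by exact_mod_cast hq.pos
  have hp0 : (0 : ℝ) < p := by exact_mod_cast hp.pos
  have hqp' : (q : ℝ) ≤ p := by exact_mod_cast hqp
  suffices h : alpha q * (q : ℝ) ^ 2 / p + alpha p ≤ 2 * q - 1 by
    rw [tau, le_div_iff₀ (by positivity)]
    rwa [add_mul, div_mul_cancel₀ _ (by positivity), div_mul_eq_mul_div]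
  have hfive : ∀ r : ℕ, r.Prime → r ≠ 2 → r ≠ 3 → (5 : ℝ) ≤ r := fun r hr h2 h3 => by
    have : Fact r.Prime := ⟨hr⟩
    exact_mod_cast five_le_of_ne h2 h3
  rw [← le_sub_iff_add_le, div_le_iff₀ hp0]
  by_cases hq2 : q = 2
  · subst hq2
    by_cases hp2 : p = 2
    · subst hp2; norm_num [alpha]
    by_cases hp3 : p = 3
    · subst hp3; norm_num [alpha]
    have := hfive p hp hp2 hp3
    norm_num [alpha, hp2, hp3]
    linarith
  by_cases hq3 : q = 3
  · subst hq3
    by_cases hp3 : p = 3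
    · subst hp3; norm_num [alpha]
    have := hfive p hp (by omega) hp3
    norm_num [alpha, hp3, show p ≠ 2 by omega]
    linarith
  have h5 := hfive q hq hq2 hq3
  nlinarith [alpha_le q, alpha_le p, mul_le_mul_of_nonneg_left hqp' hq0.le,
    mul_le_mul_of_nonneg_right (alpha_le q) (sq_nonneg (q : ℝ)),
    mul_le_mul_of_nonneg_right (alpha_le p) hp0.le, mul_le_mul_of_nonneg_right h5 hp0.le]

theorem linear_step {p q a A b t Z P : ℝ} (hp : 0 < p) (hq : 0 < q) (hZ : q ^ 2 ≤ Z)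
    (hP : p ^ 2 ≤ P) (ha : a ≤ A) (hA : 0 ≤ A) (hb : 0 ≤ b) (ht : A / p + b / q ^ 2 ≤ t) :
    p * (a * Z) + b * P ≤ t * (P * Z) := by
  have hZ0 : 0 < Z := lt_of_lt_of_le (by positivity) hZ
  have hP0 : 0 < P := lt_of_lt_of_le (by positivity) hP
  have h1 : p * (a * Z) ≤ A / p * (P * Z) := by
    rw [div_mul_eq_mul_div, le_div_iff₀ hp]
    calc p * (a * Z) * p = a * (p ^ 2 * Z) := by ring
      _ ≤ A * (p ^ 2 * Z) := by gcongr
      _ ≤ A * (P * Z) := by gcongr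
  have h2 : b * P ≤ b / q ^ 2 * (P * Z) := by
    rw [div_mul_eq_mul_div, le_div_iff₀ (by positivity)]
    calc b * P * q ^ 2 ≤ b * P * Z := by gcongr
      _ = b * (P * Z) := by ring
  calc _ ≤ (A / p + b / q ^ 2) * (P * Z) := by linarith
    _ ≤ _ := by gcongr

theorem quadratic_step {q y Z : ℝ} (hq : 1 ≤ q) (hy : y ≤ Z) (hZ : Z ≤ q ^ 2 * y) (hy0 : 0 ≤ y) :
    (y + (2 * q - 1) / q ^ 2 * Z) ^ 2 ≤ 4 * (y * Z) := by
  have hq0 : (q : ℝ) ≠ 0 := by positivity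
  have h1 : 0 ≤ y - Z / q ^ 2 := by
    rw [sub_nonneg, div_le_iff₀ (by positivity)]
    linarith
  have h2 : 0 ≤ (2 * q - 1) ^ 2 * Z / q ^ 2 - y := by
    rw [sub_nonneg, le_div_iff₀ (by positivity)]
    have : q ^ 2 ≤ (2 * q - 1) ^ 2 := by nlinarith
    calc y * q ^ 2 ≤ Z * q ^ 2 := by gcongr
      _ ≤ Z * (2 * q - 1) ^ 2 := by gcongr; linarith
      _ = _ := by ring
  have e : (y + (2 * q - 1) / q ^ 2 * Z) ^ 2 - 4 * (y * Z)
      = -((y - Z / q ^ 2) * ((2 * q - 1) ^ 2 * Z / q ^ 2 - y)) := by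
    field_simp
    ring
  linarith [mul_nonneg h1 h2]

theorem nsmul_eq_zero_of_exponent {G : Type*} [AddCommGroup G] {n : ℕ}
    (h : AddMonoid.exponent G = n) (x : G) : n • x = 0 := by
  rw [← h, AddMonoid.exponent_nsmul_eq_zero]

theorem Thick.exists_card_eq {G : Type u} [AddCommGroup G] [Finite G] (hG : Thick G) {p : ℕ}
    (hp : p.Prime) (h : AddMonoid.exponent G = p) : ∃ d, 3 ≤ d ∧ Nat.card G = p ^ d := by
  have : Fact p.Prime := ⟨hp⟩
  obtain ⟨d, hd⟩ := exists_card_eq_pow (nsmul_eq_zero_of_exponent h)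
  have h3 := Thick.exponent_pow_le p G hG h
  rw [hd] at h3
  exact ⟨d, (Nat.pow_le_pow_iff_right hp.one_lt).1 h3, hd⟩

theorem Thick.exists_davLE (n : ℕ) : ∀ (G : Type u) [AddCommGroup G] [Finite G],
    Thick G → AddMonoid.exponent G = n → n ≠ 1 → ∀ k : ℕ, 1 ≤ k →
      ∃ L : ℕ, DavLE G k L ∧ (L : ℝ) + 1 ≤ k * n + coeff n * (Nat.card G / n) := by
  induction n using Nat.strong_induction_on with
  | _ n ih =>
    intro G _ _ hG hn hn1 k hk
    have hn0 : n ≠ 0 := hn ▸ AddMonoid.exponent_ne_zero_of_finite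
    by_cases hprime : n.Prime
    · have : Fact n.Prime := ⟨hprime⟩
      obtain ⟨d, hd, hc⟩ := hG.exists_card_eq hprime hn
      obtain ⟨L, hL, hL'⟩ := exists_davLE_linear (nsmul_eq_zero_of_exponent hn) hd hc hk
      refine ⟨L, hL, hL'.trans_eq ?_⟩
      have hn0' : (n : ℝ) ≠ 0 := by exact_mod_cast hn0
      obtain ⟨e, rfl⟩ : ∃ e, d = e + 1 := ⟨d - 1, by omega⟩
      rw [coeff, if_pos hprime, hc]
      push_cast
      rw [pow_succ, mul_div_cancel_right₀ _ hn0', mul_comm (k : ℝ)]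
    · have hqP := Nat.minFac_prime hn1
      set q := n.minFac with hq
      obtain ⟨p, hp, hpn⟩ := Nat.exists_prime_and_dvd (n := n / q) fun h => hprime <| by
        rwa [← Nat.eq_of_dvd_of_div_eq_one n.minFac_dvd h]
      have hqpn : q * p ∣ n := (Nat.dvd_div_iff_mul_dvd n.minFac_dvd).1 hpn
      have hpn : p ∣ n := (Dvd.intro_left _ rfl).trans hqpn
      have hqp : q ≤ p := Nat.minFac_le_of_dvd hp.two_le hpn
      obtain ⟨m, rfl⟩ := hpn
      have hqm : q ∣ m := by
        rw [mul_comm] at hqpn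
        exact Nat.dvd_of_mul_dvd_mul_left hp.pos hqpn
      have hm0 : 0 < m := Nat.pos_of_ne_zero fun h => hn0 (by simp [h])
      have hm1 : m ≠ 1 := fun h => hqP.one_lt.not_ge (Nat.le_of_dvd one_pos (h ▸ hqm))
      have hmq : m.minFac = q := le_antisymm (Nat.minFac_le_of_dvd hqP.two_le hqm)
        (Nat.minFac_le_of_dvd (Nat.minFac_prime hm1).two_le
          (m.minFac_dvd.trans (Dvd.intro_left _ rfl)))
      have hdvd : p ∣ AddMonoid.exponent G := hn ▸ Dvd.intro _ rfl
      have hexp : AddMonoid.exponent (topMap G p).ker = m := by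
        rw [exponent_topMap_ker hdvd hp.pos, hn, Nat.mul_div_cancel_left _ hp.pos]
      have hH := hG.topMap_ker hdvd hp.pos
      obtain ⟨L', hL', hb'⟩ := ih m (lt_mul_of_one_lt_left hm0 hp.one_lt) _ hH hexp hm1 k hk
      have : Fact p.Prime := ⟨hp⟩
      obtain ⟨d, hd⟩ := exists_card_eq_pow (topRange_nsmul hdvd)
      have hd3 : 3 ≤ d := (Nat.pow_le_pow_iff_right hp.one_lt).1 (hd ▸ hG p hp hdvd)
      obtain ⟨L, hL, hb⟩ := exists_davLE_linear (topRange_nsmul hdvd) hd3 hd (hL'.one_le hk)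
      refine ⟨L, DavLE.comp (topMap G p) hL' hL, ?_⟩
      have hcH := Thick.exponent_pow_le m _ hH hexp
      rw [card_eq_card_ker_mul (topMap_surjective (G := G) p), hd, coeff, if_neg hprime, ← hq]
      set C := Nat.card (topMap G p).ker
      obtain ⟨e, rfl⟩ : ∃ e, d = e + 1 := ⟨d - 1, by omega⟩
      rw [Nat.add_sub_cancel] at hb
      have hp0 : (0 : ℝ) < p := by exact_mod_cast hp.pos
      have hp1 : (1 : ℝ) ≤ p := by exact_mod_cast hp.one_lt.le
      have hq0 : (0 : ℝ) < q := by exact_mod_cast hqP.pos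
      have hm0' : (0 : ℝ) < m := by exact_mod_cast hm0
      have hqm' : (q : ℝ) ≤ m := by exact_mod_cast Nat.le_of_dvd hm0 hqm
      have hcH' : (m : ℝ) ^ 3 ≤ C := by exact_mod_cast hcH
      have hZ : (q : ℝ) ^ 2 ≤ C / m := by
        rw [le_div_iff₀ hm0']
        calc (q : ℝ) ^ 2 * m ≤ (m : ℝ) ^ 2 * m := by gcongr
          _ = (m : ℝ) ^ 3 := by ring
          _ ≤ (C : ℝ) := hcH'
      have key := linear_step hp0 hq0 hZ (pow_le_pow_right₀ hp1 (by omega : 2 ≤ e))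
        (hmq ▸ coeff_le_alpha (n := m)) (zero_le_one.trans (one_le_alpha q))
        (zero_le_one.trans (one_le_alpha p)) (alpha_div_add_le hp hqP hqp)
      have e1 : ((C * p ^ (e + 1) : ℕ) : ℝ) / ((p * m : ℕ) : ℝ) = (p : ℝ) ^ e * (C / m) := by
        push_cast
        field_simp
        ring
      rw [e1]
      push_cast
      have := mul_le_mul_of_nonneg_left hb' hp0.le
      nlinarith

theorem exists_davLE_of_plane {G : Type*} [AddCommGroup G] [Finite G] {Q : Type*}
    [AddCommGroup Q] [Finite Q] {φ : G →+ Q} (hφ : Function.Surjective φ) {p : ℕ} (hp : p.Prime)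
    (hQ : ∀ x : Q, p • x = 0) (hc : Nat.card Q = p ^ 2) {k : ℕ} (hk : 1 ≤ k)
    (h : ∃ L, DavLE φ.ker k L ∧ (L + 1) ^ 2 ≤ 4 * (k * Nat.card φ.ker)) :
    ∃ L, DavLE G k L ∧ (L + 1) ^ 2 ≤ 4 * (k * Nat.card G) := by
  have : Fact p.Prime := ⟨hp⟩
  obtain ⟨L, hL, hb⟩ := h
  refine ⟨_, hL.comp φ (davLE_of_card_eq_prime_sq hQ hc (hL.one_le hk)), ?_⟩
  rw [Nat.sub_add_cancel (Nat.mul_pos hp.pos L.succ_pos), card_eq_card_ker_mul hφ, hc]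
  calc (p * (L + 1)) ^ 2 = (L + 1) ^ 2 * p ^ 2 := by ring
    _ ≤ 4 * (k * Nat.card φ.ker) * p ^ 2 := by gcongr
    _ = _ := by ring

theorem card_topRange_ne_one {G : Type u} [AddCommGroup G] [Finite G] {p : ℕ} (hp : p.Prime)
    (hpn : p ∣ AddMonoid.exponent G) : Nat.card (topRange G p) ≠ 1 := by
  intro h
  have hn0 : 0 < AddMonoid.exponent G := Nat.pos_of_ne_zero AddMonoid.exponent_ne_zero_of_finite
  rw [AddSubgroup.card_eq_one] at h
  have h1 : AddMonoid.exponent G ∣ AddMonoid.exponent G / p := by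
    refine AddMonoid.exponent_dvd_of_forall_nsmul_eq_zero fun x => ?_
    have : (AddMonoid.exponent G / p) • x ∈ topRange G p := ⟨x, rfl⟩
    rwa [h, AddSubgroup.mem_bot] at this
  exact (Nat.le_of_dvd (Nat.div_pos (Nat.le_of_dvd hn0 hpn) hp.pos) h1).not_gt
    (Nat.div_lt_self hn0 hp.one_lt)

theorem Thick.exists_davLE_quadratic {G : Type u} [AddCommGroup G] [Finite G] (hG : Thick G)
    (hn1 : AddMonoid.exponent G ≠ 1) {k : ℕ} (hk : 1 ≤ k)
    (h1 : k * AddMonoid.exponent G ^ 2 < Nat.card G)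
    (h2 : Nat.card G ≤ k * (AddMonoid.exponent G).minFac ^ 2 * AddMonoid.exponent G ^ 2) :
    ∃ L, DavLE G k L ∧ (L + 1) ^ 2 ≤ 4 * (k * Nat.card G) := by
  obtain ⟨n, hn⟩ : ∃ n, AddMonoid.exponent G = n := ⟨_, rfl⟩
  rw [hn] at hn1 h1 h2
  have hn0 : n ≠ 0 := hn ▸ AddMonoid.exponent_ne_zero_of_finite
  by_cases hprime : n.Prime
  · have : Fact n.Prime := ⟨hprime⟩
    obtain ⟨d, hd, hc⟩ := hG.exists_card_eq hprime hn
    rw [hc] at h1 h2 ⊢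
    rw [hprime.minFac_eq, mul_assoc, ← pow_add] at h2
    exact Davenport.exists_davLE_quadratic (nsmul_eq_zero_of_exponent hn) hd hc hk h1 h2
  · obtain ⟨L, hL, hb⟩ := Thick.exists_davLE n G hG hn hn1 k hk
    refine ⟨L, hL, ?_⟩
    rw [coeff, if_neg hprime, tau] at hb
    have hn0' : (0 : ℝ) < n := by exact_mod_cast Nat.pos_of_ne_zero hn0
    have hq1 : (1 : ℝ) ≤ n.minFac := by exact_mod_cast n.minFac_pos
    have h1' : (k : ℝ) * n ^ 2 ≤ Nat.card G := by exact_mod_cast h1.le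
    have h2' : (Nat.card G : ℝ) ≤ k * (n.minFac : ℝ) ^ 2 * n ^ 2 := by exact_mod_cast h2
    have key := quadratic_step (y := k * n) (Z := Nat.card G / n) hq1
      (by rw [le_div_iff₀ hn0']; linarith) (by rw [div_le_iff₀ hn0']; linarith) (by positivity)
    have e : (k : ℝ) * n * (Nat.card G / n) = k * Nat.card G := by field_simp
    rw [e] at key
    have : ((L : ℝ) + 1) ^ 2 ≤ 4 * (k * Nat.card G) := by
      refine le_trans ?_ key
      gcongr
    exact_mod_cast this

theorem exists_davLE_of_exponent_sq_lt (N : ℕ) : ∀ (G : Type u) [AddCommGroup G] [Finite G],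
    Nat.card G = N → ∀ k : ℕ, 1 ≤ k → k * AddMonoid.exponent G ^ 2 < Nat.card G →
      ∃ L, DavLE G k L ∧ (L + 1) ^ 2 ≤ 4 * (k * Nat.card G) := by
  induction N using Nat.strong_induction_on with
  | _ N ih =>
    intro G _ _ hN k hk hlt
    obtain ⟨n, hn⟩ : ∃ n, AddMonoid.exponent G = n := ⟨_, rfl⟩
    have hn1 : n ≠ 1 := by
      rintro rfl
      have := AddMonoid.exp_eq_one_iff.1 hn
      rw [hn, Nat.card_of_subsingleton (0 : G)] at hlt
      omega
    by_cases hone : ∃ p, p.Prime ∧ p ∣ AddMonoid.exponent G ∧ Nat.card (topRange G p) = p ^ 1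
    · obtain ⟨p, hp, hpn, hc⟩ := hone
      have : Fact p.Prime := ⟨hp⟩
      have hker : DavLE (QuotientAddGroup.mk' (topRange G p)).ker k (p * k) := by
        rw [QuotientAddGroup.ker_mk']
        exact davLE_of_card_eq_prime (topRange_nsmul hpn) hc
      have hcard := AddSubgroup.card_eq_card_quotient_mul_card_addSubgroup (topRange G p)
      rw [hc, pow_one] at hcard
      have hpos : 0 < Nat.card (G ⧸ topRange G p) := Nat.card_pos
      have hexp := Nat.le_of_dvd (Nat.div_pos (Nat.le_of_dvd
        (Nat.pos_of_ne_zero AddMonoid.exponent_ne_zero_of_finite) hpn) hp.pos)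
        (exponent_quotient_topRange_dvd (G := G) p)
      obtain ⟨L, hL, hb⟩ := ih _ (by rw [← hN, hcard]; exact lt_mul_of_one_lt_right hpos hp.one_lt)
        (G ⧸ topRange G p) rfl (p * k) (Nat.mul_pos hp.pos hk) (by
          refine lt_of_mul_lt_mul_right (a := p) ?_ (Nat.zero_le _)
          rw [← hcard]
          refine lt_of_le_of_lt ?_ hlt
          calc p * k * AddMonoid.exponent (G ⧸ topRange G p) ^ 2 * p
              ≤ p * k * (AddMonoid.exponent G / p) ^ 2 * p := by gcongr
            _ = k * (AddMonoid.exponent G / p * p) ^ 2 := by ring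
            _ = _ := by rw [Nat.div_mul_cancel hpn])
      refine ⟨L, hker.comp _ hL, hb.trans_eq ?_⟩
      rw [hcard]
      ring
    by_cases htwo : ∃ p, p.Prime ∧ p ∣ AddMonoid.exponent G ∧ Nat.card (topRange G p) = p ^ 2
    · obtain ⟨p, hp, hpn, hc⟩ := htwo
      have hcard := card_eq_card_ker_mul (topMap_surjective (G := G) p)
      rw [hc] at hcard
      refine exists_davLE_of_plane (topMap_surjective p) hp (topRange_nsmul hpn) hc hk
        (ih _ ?_ _ rfl k hk ?_)
      · rw [← hN, hcard]
        exact lt_mul_of_one_lt_right Nat.card_pos (Nat.one_lt_pow two_ne_zero hp.one_lt)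
      · refine lt_of_mul_lt_mul_right (a := p ^ 2) ?_ (Nat.zero_le _)
        rwa [← hcard, exponent_topMap_ker hpn hp.pos, mul_assoc, ← mul_pow, Nat.div_mul_cancel hpn]
    have hrank : ∀ p, p.Prime → p ∣ AddMonoid.exponent G →
        ∃ d, 3 ≤ d ∧ Nat.card (topRange G p) = p ^ d := by
      intro p hp hpn
      have : Fact p.Prime := ⟨hp⟩
      obtain ⟨d, hd⟩ := exists_card_eq_pow (topRange_nsmul hpn)
      refine ⟨d, ?_, hd⟩
      by_contra! h3
      interval_cases d
      · exact card_topRange_ne_one hp hpn (by simpa using hd)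
      · exact hone ⟨p, hp, hpn, hd⟩
      · exact htwo ⟨p, hp, hpn, hd⟩
    have hthick : Thick G := fun p hp hpn => by
      obtain ⟨d, hd, hc⟩ := hrank p hp hpn
      rw [hc]
      exact Nat.pow_le_pow_right hp.pos hd
    by_cases hbig : Nat.card G ≤
        k * (AddMonoid.exponent G).minFac ^ 2 * AddMonoid.exponent G ^ 2
    · exact hthick.exists_davLE_quadratic (hn ▸ hn1) hk hlt hbig
    have hq := Nat.minFac_prime (hn ▸ hn1 : AddMonoid.exponent G ≠ 1)
    have hqn := (AddMonoid.exponent G).minFac_dvd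
    set q := (AddMonoid.exponent G).minFac
    have : Fact q.Prime := ⟨hq⟩
    obtain ⟨d, hd, hc⟩ := hrank q hq hqn
    obtain ⟨f, hf⟩ := exists_surjective_plane (topRange_nsmul hqn) (by omega) hc
    have hφ : Function.Surjective (f.comp (topMap G q)) := hf.comp (topMap_surjective q)
    have hcQ : Nat.card (Fin 2 → ZMod q) = q ^ 2 := by simp
    have hcard := card_eq_card_ker_mul hφ
    rw [hcQ] at hcard
    have hexp : AddMonoid.exponent (f.comp (topMap G q)).ker ≤ AddMonoid.exponent G :=
      Nat.le_of_dvd (Nat.pos_of_ne_zero AddMonoid.exponent_ne_zero_of_finite)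
        (AddMonoid.exponent_dvd_of_addMonoidHom (AddSubgroup.subtype _) Subtype.val_injective)
    refine exists_davLE_of_plane hφ hq (fun x => by ext; simp) hcQ hk (ih _ ?_ _ rfl k hk ?_)
    · rw [← hN, hcard]
      exact lt_mul_of_one_lt_right Nat.card_pos (Nat.one_lt_pow two_ne_zero hq.one_lt)
    · refine lt_of_mul_lt_mul_right (a := q ^ 2) ?_ (Nat.zero_le _)
      rw [← hcard]
      refine lt_of_le_of_lt ?_ (not_le.1 hbig)
      calc k * AddMonoid.exponent (f.comp (topMap G q)).ker ^ 2 * q ^ 2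
          ≤ k * AddMonoid.exponent G ^ 2 * q ^ 2 := by gcongr
        _ = _ := by ring

end Davenport

theorem davenport_le_of_small_exponent (G : Type*) [AddCommGroup G] [Fintype G]
    (h : (AddMonoid.exponent G : ℝ) < Real.sqrt (Fintype.card G)) :
    (davenportConstant G : ℝ) ≤ 2 * Real.sqrt (Fintype.card G) - 1 := by
  have hlt : 1 * AddMonoid.exponent G ^ 2 < Nat.card G := by
    rw [one_mul, Nat.card_eq_fintype_card]
    exact_mod_cast (Real.lt_sqrt (Nat.cast_nonneg _)).1 h
  obtain ⟨L, hL, hb⟩ := Davenport.exists_davLE_of_exponent_sq_lt _ G rfl 1 le_rfl hlt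
  have hD : davenportConstant G ≤ L := Nat.sInf_le fun S hS => hL.exists_block hS.ge
  rw [one_mul, Nat.card_eq_fintype_card] at hb
  have hb' : ((L : ℝ) + 1) ^ 2 ≤ 4 * Fintype.card G := by exact_mod_cast hb
  have hD' : (davenportConstant G : ℝ) ≤ L := by exact_mod_cast hD
  have hs : (L : ℝ) + 1 ≤ 2 * Real.sqrt (Fintype.card G) := by
    refine abs_le_of_sq_le_sq' ?_ (by positivity) |>.2
    rw [mul_pow, Real.sq_sqrt (Nat.cast_nonneg _)]
    linarith
  linarith
end
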